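/- Let f, g ∈ ℂ[x, y, z] be irreducible homogeneous polynomials of positive degree, so that S = V(f) and S' = V(g) are homogeneous irreducible affine algebraic surfaces in ℂ³. If S \ {0} and S' \ {0} are homeomorphic as topological spaces (with the subspace topology from ℂ³), then the total degree of f equals the total degree of g. -/

import Mathlib

section

open Filter Topology MvPolynomial

/-- The tangent cone at infinity of a subset `A` of a normed space: `v` is a tangent
vector at infinity if there are points `x i ∈ A` with `‖x i‖ → ∞` and positive reals
`t i` with `x i / t i → v`. -/
def TangentConeAtInfty {E : Type*} [NormedAddCommGroup E] [NormedSpace ℝ E]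
    (A : Set E) : Set E :=
  {v | ∃ (x : ℕ → E) (t : ℕ → ℝ), (∀ i, x i ∈ A) ∧ (∀ i, 0 < t i) ∧
    Tendsto (fun i => ‖x i‖) atTop atTop ∧
    Tendsto (fun i => (t i)⁻¹ • x i) atTop (𝓝 v)}

/-- `X` and `Y` are outer bi-Lipschitz homeomorphic at infinity: there are compact sets
`K`, `K'` and a bijection `φ : X \ K → Y \ K'` which is Lipschitz with Lipschitz inverse,
with respect to the Euclidean (outer) distance. -/
def OuterBiLipAtInfty {E F : Type*} [NormedAddCommGroup E] [NormedAddCommGroup F]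
    (X : Set E) (Y : Set F) : Prop :=
  ∃ (K : Set E) (K' : Set F) (φ : E → F),
    IsCompact K ∧ IsCompact K' ∧ Set.BijOn φ (X \ K) (Y \ K') ∧
    (∃ C > (0:ℝ), ∀ a ∈ X \ K, ∀ b ∈ X \ K, dist (φ a) (φ b) ≤ C * dist a b) ∧
    (∃ c > (0:ℝ), ∀ a ∈ X \ K, ∀ b ∈ X \ K, dist a b ≤ c * dist (φ a) (φ b))

/-- The germs `(X,0)` and `(Y,0)` are outer bi-Lipschitz homeomorphic: there are
`ε, δ > 0` and a bijection `φ : X ∩ B̄_ε(0) → Y ∩ B̄_δ(0)` with `φ 0 = 0` which is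
Lipschitz with Lipschitz inverse for the Euclidean (outer) distance. -/
def OuterBiLipGerm {E F : Type*} [NormedAddCommGroup E] [NormedAddCommGroup F]
    (X : Set E) (Y : Set F) : Prop :=
  ∃ ε > (0:ℝ), ∃ δ > (0:ℝ), ∃ φ : E → F,
    Set.BijOn φ (X ∩ Metric.closedBall 0 ε) (Y ∩ Metric.closedBall 0 δ) ∧ φ 0 = 0 ∧
    (∃ C > (0:ℝ), ∀ a ∈ X ∩ Metric.closedBall 0 ε, ∀ b ∈ X ∩ Metric.closedBall 0 ε,
      dist (φ a) (φ b) ≤ C * dist a b) ∧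
    (∃ c > (0:ℝ), ∀ a ∈ X ∩ Metric.closedBall 0 ε, ∀ b ∈ X ∩ Metric.closedBall 0 ε,
      dist a b ≤ c * dist (φ a) (φ b))

/-- The zero set in `ℂⁿ` (with the Euclidean norm) of a polynomial. -/
noncomputable def mvZeroSet {n : ℕ} (f : MvPolynomial (Fin n) ℂ) :
    Set (EuclideanSpace ℂ (Fin n)) :=
  {x | MvPolynomial.eval (x : Fin n → ℂ) f = 0}

end

section

open Filter Topology Polynomial

namespace HomSurf

lemma exists_perm_of_prod_eq {d : ℕ} {r s : Fin d → ℂ}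
    (h : ∏ i, (X - C (s i)) = ∏ i, (X - C (r i))) : ∃ π : Equiv.Perm (Fin d), s = r ∘ π := by
  have hroots : ∀ t : Fin d → ℂ, (∏ i, (X - C (t i))).roots = Finset.univ.val.map t := fun t => by
    simpa [Finset.prod, Function.comp_def] using
      roots_multiset_prod_X_sub_C (Finset.univ.val.map t)
  have hm : Finset.univ.val.map s = Finset.univ.val.map r := by rw [← hroots, ← hroots, h]
  have hcard : ∀ z, Nonempty ({i // s i = z} ≃ {i // r i = z}) := fun z => by
    have := congrArg (Multiset.count z) hm
    rw [Multiset.count_map, Multiset.count_map] at this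
    rw [← Fintype.card_eq, Fintype.card_subtype, Fintype.card_subtype]
    simpa [Finset.card, eq_comm] using this
  have E := fun z => (hcard z).some
  refine ⟨(Equiv.sigmaFiberEquiv s).symm.trans
    ((Equiv.sigmaCongrRight fun z => E z).trans (Equiv.sigmaFiberEquiv r)), ?_⟩
  funext i
  exact ((E (s i) ⟨i, rfl⟩).2).symm

lemma exists_eq_prod {d : ℕ} {p : ℂ[X]} (hp : p.Monic) (hd : p.natDegree = d) :
    ∃ r : Fin d → ℂ, p = ∏ i, (X - C (r i)) := by
  have hs : p.Splits := IsAlgClosed.splits p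
  have hcard : p.roots.card = d := by rw [← hd]; exact hs.natDegree_eq_card_roots.symm
  have hprod : p = (p.roots.map fun a => X - C a).prod := by
    simpa [hp.leadingCoeff] using hs.eq_prod_roots
  obtain ⟨l, hl⟩ : ∃ l : List ℂ, (l : Multiset ℂ) = p.roots := ⟨p.roots.toList, by simp⟩
  have hlen : l.length = d := by rw [← hcard, ← hl]; simp
  subst hlen
  refine ⟨l.get, ?_⟩
  rw [hprod, ← hl]
  simp [← List.prod_ofFn]
  rw [← List.ofFn_get (l.map fun a => X - C a)]
  simp

lemma prod_perm {d : ℕ} (r : Fin d → ℂ) (π : Equiv.Perm (Fin d)) :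
    ∏ i, (X - C ((r ∘ π) i)) = ∏ i, (X - C (r i)) :=
  Equiv.prod_comp π (fun i => X - C (r i))

lemma continuous_coeff_prod {d : ℕ} (k : ℕ) :
    Continuous fun r : Fin d → ℂ => (∏ i, (X - C (r i))).coeff k := by
  suffices h : ∀ (s : Finset (Fin d)) (k : ℕ),
      Continuous fun r : Fin d → ℂ => (∏ i ∈ s, (X - C (r i))).coeff k from h _ k
  intro s
  induction s using Finset.induction_on with
  | empty => intro k; simp; exact continuous_const
  | insert a s ha ih =>
    intro k
    simp only [Finset.prod_insert ha, sub_mul, coeff_sub, coeff_C_mul]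
    refine Continuous.sub ?_ ((continuous_apply a).mul (ih k))
    cases k with
    | zero => simp; exact continuous_const
    | succ k => simpa [coeff_X_mul] using ih k

lemma norm_root_le {p : ℂ[X]} (hp : p.Monic) {M : ℝ} (hM : 0 ≤ M)
    (hc : ∀ k < p.natDegree, ‖p.coeff k‖ ≤ M) {z : ℂ} (hz : p.IsRoot z) : ‖z‖ ≤ M + 1 := by
  have h := hz.norm_lt_cauchyBound hp.ne_zero
  refine (NNReal.coe_le_coe.2 h.le).trans ?_
  rw [cauchyBound, hp.leadingCoeff, nnnorm_one, div_one, NNReal.coe_add, NNReal.coe_one,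
    add_le_add_iff_right]
  have : (Finset.range p.natDegree).sup (fun x => ‖p.coeff x‖₊) ≤ ⟨M, hM⟩ := by
    apply Finset.sup_le
    intro k hk
    exact hc k (Finset.mem_range.1 hk)
  exact NNReal.coe_le_coe.2 this

/-- The roots of a continuous family of monic polynomials can be labelled continuously at a
given parameter. -/
theorem exists_labelling {T : Type*} [TopologicalSpace T] {d : ℕ} {G : T → ℂ[X]}
    (hm : ∀ t, (G t).Monic) (hd : ∀ t, (G t).natDegree = d)
    (hc : ∀ k, Continuous fun t => (G t).coeff k) (t₀ : T) (r₀ : Fin d → ℂ)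
    (h0 : G t₀ = ∏ i, (X - C (r₀ i))) :
    ∃ ρ : T → Fin d → ℂ, (∀ t, G t = ∏ i, (X - C (ρ t i))) ∧ ρ t₀ = r₀ ∧ ContinuousAt ρ t₀ := by
  have hmin : ∀ t, ∃ r : Fin d → ℂ, G t = ∏ i, (X - C (r i)) ∧
      ∀ π : Equiv.Perm (Fin d), dist r r₀ ≤ dist (r ∘ π) r₀ := fun t => by
    obtain ⟨r, hr⟩ := exists_eq_prod (hm t) (hd t)
    obtain ⟨π, -, hπ⟩ := Finset.exists_min_image (Finset.univ : Finset (Equiv.Perm (Fin d)))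
      (fun π => dist (r ∘ π) r₀) ⟨1, by simp⟩
    refine ⟨r ∘ π, by rw [prod_perm, hr], fun π' => ?_⟩
    have := hπ (π * π') (by simp)
    simpa [Function.comp_assoc] using this
  choose ρ hρ hρmin using hmin
  have hρ0 : ρ t₀ = r₀ := by
    obtain ⟨π, hπ⟩ := exists_perm_of_prod_eq ((h0.symm.trans (hρ t₀)))
    have := hρmin t₀ π
    rw [← hπ, dist_self] at this
    exact dist_le_zero.1 this
  refine ⟨ρ, hρ, hρ0, ?_⟩
  rw [ContinuousAt, hρ0, tendsto_iff_ultrafilter]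
  intro U hU
  obtain ⟨M, hM0, hM⟩ : ∃ M : ℝ, 0 ≤ M ∧ ∀ k < d, ‖(G t₀).coeff k‖ < M := by
    refine ⟨∑ k ∈ Finset.range d, ‖(G t₀).coeff k‖ + 1, by positivity, fun k hk => ?_⟩
    have := Finset.single_le_sum (f := fun k => ‖(G t₀).coeff k‖) (fun i _ => norm_nonneg _)
      (Finset.mem_range.2 hk)
    linarith
  have hev : ∀ᶠ t in 𝓝 t₀, ∀ k ∈ Finset.range d, ‖(G t).coeff k‖ < M := by
    rw [Filter.eventually_all_finset]
    intro k hk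
    exact (hc k).norm.continuousAt.eventually_lt continuousAt_const (hM k (Finset.mem_range.1 hk))
  have hb : ∀ᶠ t in 𝓝 t₀, ρ t ∈ Metric.closedBall (0 : Fin d → ℂ) (M + 1) := by
    filter_upwards [hev] with t ht
    rw [mem_closedBall_zero_iff, pi_norm_le_iff_of_nonneg (by positivity)]
    intro i
    refine norm_root_le (hm t) hM0 (fun k hk => (ht k (by simpa [hd] using hk)).le) ?_
    rw [hρ t, IsRoot.def, eval_prod]
    exact Finset.prod_eq_zero (Finset.mem_univ i) (by simp)
  obtain ⟨s, -, hs⟩ := (isCompact_closedBall (0 : Fin d → ℂ) (M + 1)).ultrafilter_le_nhds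
    (U.map ρ) (by rw [le_principal_iff]; exact hU hb)
  have hs' : Tendsto ρ U (𝓝 s) := hs
  have hsG : G t₀ = ∏ i, (X - C (s i)) := by
    ext k
    have h1 : Tendsto (fun t => (G t).coeff k) U (𝓝 ((G t₀).coeff k)) :=
      ((hc k).tendsto t₀).mono_left hU
    have h2 := ((continuous_coeff_prod k).tendsto s).comp hs'
    refine tendsto_nhds_unique h1 (h2.congr fun t => ?_)
    simp [Function.comp, ← hρ t]
  obtain ⟨π, hπ⟩ := exists_perm_of_prod_eq (h0.symm.trans hsG)
  rw [tendsto_iff_dist_tendsto_zero]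
  have h3 : Tendsto (fun t => dist (ρ t ∘ π) r₀) U (𝓝 0) := by
    rw [hπ, ← tendsto_iff_dist_tendsto_zero]
    have : Continuous fun r : Fin d → ℂ => r ∘ π := by fun_prop
    exact (this.tendsto s).comp hs'
  exact squeeze_zero (fun _ => dist_nonneg) (fun t => hρmin t π) h3

end HomSurf

end

section

open Filter Topology Polynomial

namespace HomSurf

/-- Near a parameter with simple roots, the roots of a continuous family of monic polynomials are
continuous functions. -/
theorem exists_local_splitting {T : Type*} [TopologicalSpace T] {d : ℕ} {G : T → ℂ[X]}
    (hm : ∀ t, (G t).Monic) (hd : ∀ t, (G t).natDegree = d)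
    (hc : ∀ k, Continuous fun t => (G t).coeff k) (t₀ : T) (hsep : (G t₀).Separable) :
    ∃ V : Set T, IsOpen V ∧ t₀ ∈ V ∧ ∃ ρ : T → Fin d → ℂ,
      (∀ t, G t = ∏ i, (X - C (ρ t i))) ∧ ContinuousOn ρ V ∧
      ∀ t ∈ V, Function.Injective (ρ t) := by
  obtain ⟨r₀, hr₀⟩ := exists_eq_prod (hm t₀) (hd t₀)
  have hinj : Function.Injective r₀ := by
    rwa [hr₀, separable_prod_X_sub_C_iff] at hsep
  obtain ⟨ρ, hρ, hρ0, hρc⟩ := exists_labelling hm hd hc t₀ r₀ hr₀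
  obtain ⟨η, hη, hη2⟩ : ∃ η > 0, ∀ i j, i ≠ j → 2 * η ≤ dist (r₀ i) (r₀ j) := by
    have : ∀ᶠ η in 𝓝[>] (0 : ℝ), ∀ i j, i ≠ j → 2 * η ≤ dist (r₀ i) (r₀ j) := by
      simp only [Filter.eventually_all]
      intro i j hij
      have hpos := dist_pos.2 (hinj.ne hij)
      filter_upwards [Ioo_mem_nhdsGT (half_pos hpos)] with η hη
      linarith [hη.2]
    obtain ⟨η, h1, h2⟩ := (this.and self_mem_nhdsWithin).exists
    exact ⟨η, h2, h1⟩
  have hsep' : ∀ (z : ℂ) (i j : Fin d), dist z (r₀ i) < η → dist z (r₀ j) < η → i = j := by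
    intro z i j h1 h2
    by_contra hij
    have := hη2 i j hij
    have := dist_triangle_left (r₀ i) (r₀ j) z
    linarith
  have hV := hρc (by rw [hρ0]; exact Metric.ball_mem_nhds r₀ hη)
  obtain ⟨V, hVs, hVo, htV⟩ := mem_nhds_iff.1 hV
  refine ⟨V, hVo, htV, ρ, hρ, fun t₁ ht₁ => ContinuousAt.continuousWithinAt ?_, fun t ht i j hij => ?_⟩
  · obtain ⟨ρ', hρ', hρ'1, hρ'c⟩ := exists_labelling hm hd hc t₁ (ρ t₁) (hρ t₁)
    refine hρ'c.congr ?_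
    have hb : ρ' t₁ ∈ Metric.ball r₀ η := by rw [hρ'1]; exact hVs ht₁
    filter_upwards [hVo.mem_nhds ht₁, hρ'c.preimage_mem_nhds (Metric.isOpen_ball.mem_nhds hb)]
      with t h1 h2
    obtain ⟨π, hπ⟩ := exists_perm_of_prod_eq ((hρ' t).symm.trans (hρ t))
    have h1' : dist (ρ t) r₀ < η := hVs h1
    have h2' : dist (ρ' t) r₀ < η := h2
    have : ∀ i, i = π i := fun i => hsep' (ρ' t i) i (π i) ((dist_le_pi_dist _ _ i).trans_lt h2')
      (by rw [hπ]; exact (dist_le_pi_dist _ _ (π i)).trans_lt h1')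
    funext i
    rw [hπ, Function.comp, ← this i]
  · have h1' : dist (ρ t) r₀ < η := hVs ht
    exact hsep' (ρ t i) i j ((dist_le_pi_dist _ _ i).trans_lt h1')
      (by rw [hij]; exact (dist_le_pi_dist _ _ j).trans_lt h1')

lemma isRoot_prod_iff {d : ℕ} {r : Fin d → ℂ} {z : ℂ} :
    (∏ i, (X - C (r i))).IsRoot z ↔ ∃ i, z = r i := by
  simp [IsRoot.def, eval_prod, Finset.prod_eq_zero_iff, sub_eq_zero]

/-- A product over the roots of a continuous family of polynomials is continuous. -/
theorem exists_continuous_norm {T : Type*} [TopologicalSpace T] {d : ℕ} {G : T → ℂ[X]}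
    (hm : ∀ t, (G t).Monic) (hd : ∀ t, (G t).natDegree = d)
    (hc : ∀ k, Continuous fun t => (G t).coeff k) (φ : T × ℂ → ℂ)
    (hφ : ContinuousOn φ {q | (G q.1).IsRoot q.2}) :
    ∃ N : T → ℂ, Continuous N ∧
      ∀ t (r : Fin d → ℂ), G t = ∏ i, (X - C (r i)) → N t = ∏ i, φ (t, r i) := by
  have key : ∀ t (r : Fin d → ℂ), G t = ∏ i, (X - C (r i)) →
      ((G t).roots.map fun z => φ (t, z)).prod = ∏ i, φ (t, r i) := fun t r h => by
    have : (G t).roots = Finset.univ.val.map r := by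
      rw [h]
      simpa [Finset.prod, Function.comp_def] using
        roots_multiset_prod_X_sub_C (Finset.univ.val.map r)
    rw [this, Multiset.map_map]
    rfl
  refine ⟨fun t => ((G t).roots.map fun z => φ (t, z)).prod, ?_, key⟩
  rw [continuous_iff_continuousAt]
  intro t₀
  obtain ⟨r₀, hr₀⟩ := exists_eq_prod (hm t₀) (hd t₀)
  obtain ⟨ρ, hρ, hρ0, hρc⟩ := exists_labelling hm hd hc t₀ r₀ hr₀
  have : (fun t => ((G t).roots.map fun z => φ (t, z)).prod) = fun t => ∏ i, φ (t, ρ t i) :=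
    funext fun t => key t _ (hρ t)
  rw [this]
  refine tendsto_finsetProd _ fun i _ => ?_
  have hmem : ∀ t, (t, ρ t i) ∈ {q : T × ℂ | (G q.1).IsRoot q.2} := fun t => by
    show (G t).IsRoot (ρ t i)
    rw [hρ t, isRoot_prod_iff]
    exact ⟨i, rfl⟩
  have h1 : ContinuousAt (fun t => (t, ρ t i)) t₀ :=
    continuousAt_id.prodMk ((continuousAt_pi.1 hρc) i)
  exact ((hφ _ (hmem t₀)).tendsto).comp
    (tendsto_nhdsWithin_iff.2 ⟨h1, Eventually.of_forall hmem⟩)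

/-- A map with finitely many exhaustive disjoint local sections is a covering map. -/
theorem isCoveringMap_of_sections {E T : Type*} [TopologicalSpace E] [TopologicalSpace T]
    [T2Space E] {p : E → T} (hp : Continuous p) {n : ℕ}
    (H : ∀ t, ∃ V : Set T, IsOpen V ∧ t ∈ V ∧ ∃ s : Fin n → T → E,
      (∀ i, ContinuousOn (s i) V) ∧ (∀ i, ∀ x ∈ V, p (s i x) = x) ∧
      (∀ x ∈ V, Function.Injective fun i => s i x) ∧ ∀ e, p e ∈ V → ∃ i, e = s i (p e)) :
    IsCoveringMap p := by
  intro t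
  obtain ⟨V, hVo, htV, s, hsc, hps, hinj, hsurj⟩ := H t
  have h1 : IsEvenlyCovered p t (Fin n) := by
    refine ⟨inferInstance, V, htV, hVo, hVo.preimage hp, ?_⟩
    choose idx hidx using fun e : p ⁻¹' V => hsurj e.1 e.2
    have hidx' : ∀ (e : p ⁻¹' V) i, idx e = i ↔ e.1 = s i (p e.1) := fun e i =>
      ⟨fun h => h ▸ hidx e, fun h => hinj _ e.2 ((hidx e).symm.trans h)⟩
    have hcidx : Continuous idx := by
      rw [continuous_iff_isClosed]
      intro A _
      have : idx ⁻¹' A = ⋃ i ∈ A, {e : p ⁻¹' V | e.1 = s i (p e.1)} := by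
        ext e
        simp only [Set.mem_preimage, Set.mem_iUnion, Set.mem_ofPred_eq, ← hidx']
        simp
      rw [this]
      refine A.toFinite.isClosed_biUnion fun i _ => ?_
      refine isClosed_eq continuous_subtype_val ?_
      exact (hsc i).comp_continuous (hp.comp continuous_subtype_val) fun e => e.2
    refine ⟨⟨⟨fun e => (⟨p e.1, e.2⟩, idx e), fun q => ⟨s q.2 q.1.1, ?_⟩, ?_, ?_⟩, ?_, ?_⟩, ?_⟩
    · show p _ ∈ V
      rw [hps _ _ q.1.2]
      exact q.1.2
    · intro e
      exact Subtype.ext (hidx e).symm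
    · rintro ⟨⟨x, hx⟩, i⟩
      refine Prod.ext (Subtype.ext (hps i x hx)) ?_
      rw [hidx']
      simp [hps i x hx]
    · exact Continuous.prodMk ((hp.comp continuous_subtype_val).subtype_mk _) hcidx
    · refine Continuous.subtype_mk ?_ _
      rw [continuous_prod_of_discrete_right]
      intro i
      exact (hsc i).comp_continuous continuous_subtype_val fun x => x.2
    · intro e
      rfl
  exact h1.to_isEvenlyCovered_preimage

/-- The space of roots of a continuous family of separable monic polynomials. -/
abbrev RootSpace {T : Type*} (G : T → ℂ[X]) : Type _ := {q : T × ℂ // (G q.1).IsRoot q.2}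

theorem isCoveringMap_rootSpace {T : Type*} [TopologicalSpace T] [T2Space T] {d : ℕ} {G : T → ℂ[X]}
    (hm : ∀ t, (G t).Monic) (hd : ∀ t, (G t).natDegree = d)
    (hc : ∀ k, Continuous fun t => (G t).coeff k) (hsep : ∀ t, (G t).Separable) :
    IsCoveringMap fun q : RootSpace G => q.1.1 := by
  refine isCoveringMap_of_sections (n := d) (by fun_prop) fun t => ?_
  obtain ⟨V, hV, htV, ρ, hρ, hρc, hinj⟩ := exists_local_splitting hm hd hc t (hsep t)
  refine ⟨V, hV, htV, fun i x => ⟨(x, ρ x i), ?_⟩, fun i => ?_, fun i x _ => rfl, ?_, ?_⟩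
  · show (G x).IsRoot _
    rw [hρ x, isRoot_prod_iff]
    exact ⟨i, rfl⟩
  · rw [continuousOn_iff_continuous_domRestrict] at hρc ⊢
    exact Continuous.subtype_mk (continuous_subtype_val.prodMk ((continuous_apply i).comp hρc)) _
  · intro x hx i j hij
    exact hinj x hx (congrArg (fun q : RootSpace G => q.1.2) hij)
  · rintro ⟨⟨x, z⟩, hz⟩ hx
    obtain ⟨i, hi⟩ := isRoot_prod_iff.1 ((hρ x) ▸ hz)
    exact ⟨i, Subtype.ext (Prod.ext rfl hi)⟩

end HomSurf

end

section

open Filter Topology Polynomial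

namespace HomSurf

theorem exists_lift_of_convex {E T : Type*} [TopologicalSpace E] [TopologicalSpace T] {p : E → T}
    (hp : IsCoveringMap p) {K : Set ℂ} (hconv : Convex ℝ K) {φ : K → T}
    (hφ : Continuous φ) (k₀ : K) (e₀ : E) (h0 : p e₀ = φ k₀) :
    ∃ ψ : K → E, Continuous ψ ∧ (∀ k, p (ψ k) = φ k) ∧ ψ k₀ = e₀ := by
  have : ContractibleSpace K := hconv.contractibleSpace ⟨k₀, k₀.2⟩
  have : LocallyPathConnectedSpace K := hconv.locallyPathConnectedSpace
  obtain ⟨ψ, ⟨h1, h2⟩, -⟩ := hp.existsUnique_continuousMap_lifts ⟨φ, hφ⟩ k₀ e₀ h0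
  exact ⟨ψ, ψ.continuous, fun k => congrFun h2 k, h1⟩

theorem exists_log_of_convex {K : Set ℂ} (hconv : Convex ℝ K) {g : ℂ → ℂ}
    (hg : ContinuousOn g K) (hg0 : ∀ x ∈ K, g x ≠ 0) :
    ∃ l : ℂ → ℂ, ContinuousOn l K ∧ ∀ x ∈ K, Complex.exp (l x) = g x := by
  classical
  rcases K.eq_empty_or_nonempty with rfl | ⟨k₀, hk₀⟩
  · exact ⟨0, by simp, by simp⟩
  have hφ : Continuous fun k : K => (⟨g k, hg0 k k.2⟩ : {z : ℂ // z ≠ 0}) :=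
    (continuousOn_iff_continuous_domRestrict.1 hg).subtype_mk _
  obtain ⟨ψ, hψ, hψp, -⟩ := exists_lift_of_convex Complex.isCoveringMap_exp hconv hφ ⟨k₀, hk₀⟩
    (Complex.log (g k₀)) (Subtype.ext (Complex.exp_log (hg0 _ hk₀)))
  refine ⟨fun x => if hx : x ∈ K then ψ ⟨x, hx⟩ else 0, ?_, fun x hx => ?_⟩
  · rw [continuousOn_iff_continuous_domRestrict]
    convert hψ using 1
    funext x
    simp [Set.domRestrict]
  · simpa [hx] using congrArg Subtype.val (hψp ⟨x, hx⟩)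

/-- A `d`-sheeted branched covering of the affine line by a curve, together with its cone. -/
structure Sheeted (d : ℕ) where
  F : ℂ → ℂ → ℂ[X]
  monic : ∀ x y, (F x y).Monic
  natDegree_eq : ∀ x y, (F x y).natDegree = d
  continuous_coeff : ∀ k, Continuous fun q : ℂ × ℂ => (F q.1 q.2).coeff k
  homog : ∀ {l x y z : ℂ}, l ≠ 0 → (F x y).IsRoot z → (F (l * x) (l * y)).IsRoot (l * z)
  pos : 0 < d
  B : Finset ℂ
  separable : ∀ x, x ∉ B → (F x 1).Separable
  preconnected : IsPreconnected {q : ℂ × ℂ | q.1 ∉ B ∧ (F q.1 1).IsRoot q.2}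
  δ : ℝ
  δ_pos : 0 < δ
  δ_B : ∀ b ∈ B, ‖b‖ * δ < 1
  ζ : Fin d → ℂ → ℂ
  ζ_cont : ∀ i, ContinuousOn (ζ i) (Metric.ball 0 δ)
  ζ_eq : ∀ t ∈ Metric.ball (0 : ℂ) δ, F 1 t = ∏ i, (X - C (ζ i t))
  ζ_inj : ∀ t ∈ Metric.ball (0 : ℂ) δ, Function.Injective fun i => ζ i t

namespace Sheeted
variable {d : ℕ} (S : Sheeted d)

/-- The affine curve. -/
def curve : Set (ℂ × ℂ) := {q | (S.F q.1 1).IsRoot q.2}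

/-- The unbranched part of the curve. -/
def reg : Set (ℂ × ℂ) := {q | q.1 ∉ S.B ∧ (S.F q.1 1).IsRoot q.2}

/-- The punctured cone. -/
def cone : Set (ℂ × ℂ × ℂ) := {p | (p.1 ≠ 0 ∨ p.2.1 ≠ 0) ∧ (S.F p.1 p.2.1).IsRoot p.2.2}

/-- The `i`-th sheet of the cone near `y = 0`. -/
noncomputable def sheet (i : Fin d) (x y : ℂ) : ℂ := x * S.ζ i (y / x)

/-- The `i`-th end of the curve. -/
noncomputable def endp (i : Fin d) (x : ℂ) : ℂ × ℂ := (x, S.sheet i x 1)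

/-- The domain of the sheets. -/
def far : Set (ℂ × ℂ) := {q | q.1 ≠ 0 ∧ ‖q.2 / q.1‖ < S.δ}

@[simp] lemma endp_fst (i : Fin d) (x : ℂ) : (S.endp i x).1 = x := rfl

lemma reg_subset_curve : S.reg ⊆ S.curve := fun _ h => h.2

lemma isOpen_far : IsOpen S.far := by
  rw [isOpen_iff_mem_nhds]
  rintro ⟨x, y⟩ ⟨h1, h2⟩
  have hx : ContinuousAt (fun q : ℂ × ℂ => q.1) (x, y) := continuousAt_fst
  have hd : ContinuousAt (fun q : ℂ × ℂ => ‖q.2 / q.1‖) (x, y) :=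
    (continuousAt_snd.div continuousAt_fst h1).norm
  filter_upwards [hx.eventually_ne h1, hd.eventually_lt continuousAt_const h2] with q a b
  exact ⟨a, b⟩

lemma continuousOn_sheet (i : Fin d) :
    ContinuousOn (fun q : ℂ × ℂ => S.sheet i q.1 q.2) S.far := by
  refine continuousOn_fst.mul ((S.ζ_cont i).comp (continuousOn_snd.div continuousOn_fst fun q h => h.1)
    fun q h => ?_)
  simpa using h.2

lemma isRoot_sheet (i : Fin d) {x y : ℂ} (h : (x, y) ∈ S.far) :
    (S.F x y).IsRoot (S.sheet i x y) := by
  have hx : x ≠ 0 := h.1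
  have h1 : (S.F 1 (y / x)).IsRoot (S.ζ i (y / x)) := by
    rw [S.ζ_eq _ (by simpa using h.2), isRoot_prod_iff]
    exact ⟨i, rfl⟩
  have := S.homog hx h1
  rwa [mul_one, mul_div_cancel₀ _ hx] at this

lemma exists_sheet {x y z : ℂ} (h : (x, y) ∈ S.far) (hz : (S.F x y).IsRoot z) :
    ∃ i, z = S.sheet i x y := by
  have hx : x ≠ 0 := h.1
  have h1 := S.homog (inv_ne_zero hx) hz
  rw [inv_mul_cancel₀ hx, inv_mul_eq_div, S.ζ_eq _ (by simpa using h.2), isRoot_prod_iff] at h1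
  obtain ⟨i, hi⟩ := h1
  refine ⟨i, ?_⟩
  rw [sheet, ← hi, mul_inv_cancel_left₀ hx]

lemma sheet_injective {x y : ℂ} (h : (x, y) ∈ S.far) : Function.Injective fun i => S.sheet i x y := by
  intro i j hij
  exact S.ζ_inj (y / x) (by simpa using h.2) (mul_left_cancel₀ h.1 hij)

lemma sheet_mul (i : Fin d) {l x y : ℂ} (hl : l ≠ 0) :
    S.sheet i (l * x) (l * y) = l * S.sheet i x y := by
  rw [sheet, sheet, mul_div_mul_left _ _ hl, mul_assoc]

/-- Being on the `i`-th sheet is an open condition on roots. -/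
lemma eventually_sheet {i : Fin d} {x y z : ℂ} (h : (x, y) ∈ S.far) (hz : z = S.sheet i x y) :
    ∀ᶠ p in 𝓝 (x, y, z), (S.F p.1 p.2.1).IsRoot p.2.2 → p.2.2 = S.sheet i p.1 p.2.1 := by
  have hfar : ∀ᶠ p : ℂ × ℂ × ℂ in 𝓝 (x, y, z), (p.1, p.2.1) ∈ S.far := by
    have : ContinuousAt (fun p : ℂ × ℂ × ℂ => (p.1, p.2.1)) (x, y, z) := by fun_prop
    exact this.eventually (S.isOpen_far.mem_nhds h)
  have hne : ∀ j, j ≠ i → ∀ᶠ p : ℂ × ℂ × ℂ in 𝓝 (x, y, z), p.2.2 ≠ S.sheet j p.1 p.2.1 := by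
    intro j hj
    have h1 : ContinuousAt (fun p : ℂ × ℂ × ℂ => p.2.2 - S.sheet j p.1 p.2.1) (x, y, z) := by
      refine ContinuousAt.sub (by fun_prop) ?_
      exact ContinuousAt.comp (f := fun p : ℂ × ℂ × ℂ => (p.1, p.2.1))
        ((S.continuousOn_sheet j).continuousAt (S.isOpen_far.mem_nhds h)) (by fun_prop)
    have h2 : z - S.sheet j x y ≠ 0 := by
      rw [hz, sub_ne_zero]
      exact fun e => hj (S.sheet_injective h e.symm)
    filter_upwards [h1.eventually_ne h2] with p hp
    exact sub_ne_zero.1 hp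
  have hall : ∀ᶠ p : ℂ × ℂ × ℂ in 𝓝 (x, y, z), ∀ j, j ≠ i → p.2.2 ≠ S.sheet j p.1 p.2.1 := by
    simp only [Filter.eventually_all]
    exact hne
  filter_upwards [hfar, hall] with p hp1 hp2 hroot
  obtain ⟨j, hj⟩ := S.exists_sheet hp1 hroot
  by_cases hji : j = i
  · rwa [← hji]
  · exact absurd hj (hp2 j hji)

lemma far_one {x : ℂ} (h : 1 < ‖x‖ * S.δ) : (x, (1 : ℂ)) ∈ S.far := by
  have hx : x ≠ 0 := by rintro rfl; simp at h; linarith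
  refine ⟨hx, ?_⟩
  rw [norm_div, norm_one, div_lt_iff₀ (norm_pos_iff.2 hx)]
  linarith

lemma notMem_B {x : ℂ} (h : 1 < ‖x‖ * S.δ) : x ∉ S.B := fun hx => by
  linarith [S.δ_B x hx]

lemma endp_mem (i : Fin d) {x : ℂ} (h : 1 < ‖x‖ * S.δ) : S.endp i x ∈ S.curve :=
  S.isRoot_sheet i (S.far_one h)

lemma endp_mem_reg (i : Fin d) {x : ℂ} (h : 1 < ‖x‖ * S.δ) : S.endp i x ∈ S.reg :=
  ⟨S.notMem_B h, S.endp_mem i h⟩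

lemma endp_inj {i j : Fin d} {x : ℂ} (h : 1 < ‖x‖ * S.δ) (hij : S.endp i x = S.endp j x) : i = j :=
  S.sheet_injective (S.far_one h) (congrArg Prod.snd hij)

lemma isOpen_large : IsOpen {x : ℂ | 1 < ‖x‖ * S.δ} :=
  isOpen_lt continuous_const (by fun_prop)

lemma continuousOn_endp (i : Fin d) : ContinuousOn (S.endp i) {x : ℂ | 1 < ‖x‖ * S.δ} := by
  refine continuousOn_id.prodMk ?_
  exact (S.continuousOn_sheet i).comp (f := fun x : ℂ => (x, (1 : ℂ))) (by fun_prop)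
    fun x hx => S.far_one hx

/-- Lying on the `i`-th end is an open condition on the curve. -/
lemma eventually_endp {i : Fin d} {x : ℂ} (h : 1 < ‖x‖ * S.δ) :
    ∀ᶠ q in 𝓝[S.curve] (S.endp i x), q = S.endp i q.1 := by
  have h1 := S.eventually_sheet (i := i) (S.far_one h) rfl
  have h2 : ContinuousAt (fun q : ℂ × ℂ => (q.1, (1 : ℂ), q.2)) (S.endp i x) := by fun_prop
  have h3 := h2.eventually h1
  filter_upwards [nhdsWithin_le_nhds h3, self_mem_nhdsWithin] with q hq hq'
  exact Prod.ext rfl (hq hq')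

lemma continuous_coeff_one (k : ℕ) : Continuous fun x : ℂ => (S.F x 1).coeff k :=
  (S.continuous_coeff k).comp (f := fun x : ℂ => (x, (1 : ℂ))) (by fun_prop)

lemma curve_subset_closure_reg : S.curve ⊆ closure S.reg := by
  rintro ⟨b, z⟩ hz
  obtain ⟨r, hr⟩ := exists_eq_prod (S.monic b 1) (S.natDegree_eq b 1)
  obtain ⟨ρ, hρ, hρ0, hρc⟩ := exists_labelling (fun x => S.monic x 1) (fun x => S.natDegree_eq x 1)
    S.continuous_coeff_one b r hr
  obtain ⟨i, hi⟩ : ∃ i, z = r i := isRoot_prod_iff.1 (hr ▸ hz)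
  have h1 : Tendsto (fun x => (x, ρ x i)) (𝓝[≠] b) (𝓝 (b, z)) := by
    have : ContinuousAt (fun x => (x, ρ x i)) b := continuousAt_id.prodMk (continuousAt_pi.1 hρc i)
    have h := this.tendsto.mono_left (nhdsWithin_le_nhds (s := {b}ᶜ))
    rwa [hρ0, ← hi] at h
  refine mem_closure_of_tendsto h1 ?_
  have h2 : ∀ᶠ x in 𝓝[≠] b, x ∉ S.B := by
    have hf : ((S.B : Set ℂ) \ {b})ᶜ ∈ 𝓝 b :=
      ((S.B.finite_toSet.subset Set.sdiff_subset).isClosed).isOpen_compl.mem_nhds (by simp)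
    filter_upwards [nhdsWithin_le_nhds hf, self_mem_nhdsWithin] with x hx hxb hxB
    exact hx ⟨hxB, hxb⟩
  filter_upwards [h2] with x hx
  refine ⟨hx, ?_⟩
  show (S.F x 1).IsRoot (ρ x i)
  rw [hρ x, isRoot_prod_iff]
  exact ⟨i, rfl⟩

lemma isPreconnected_curve : IsPreconnected S.curve :=
  S.preconnected.subset_closure S.reg_subset_curve S.curve_subset_closure_reg

end Sheeted
end HomSurf

end

section

open Filter Topology Polynomial unitInterval

namespace HomSurf
namespace Sheeted
variable {d : ℕ} (S : Sheeted d)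

/-- The part of the curve lying over `K`. -/
abbrev Over (K : Set ℂ) : Type := {q : ℂ × ℂ // q ∈ S.curve ∧ q.1 ∈ K}

/-- The curve over a star-shaped set contracts to a small neighbourhood of the central fibre. -/
theorem exists_deformation {K : Set ℂ} {b : ℂ} (hstar : StarConvex ℝ b K)
    (hB : ∀ x ∈ K, x ∈ S.B → x = b) {ε : ℝ} (hε : 0 < ε) :
    ∃ D : C(I × S.Over K, S.Over K), (∀ a, D (0, a) = a) ∧ ∀ a, dist (D (1, a)).1.1 b < ε := by
  classical
  let G : {x : ℂ // x ∈ K ∧ x ≠ b} → ℂ[X] := fun x => S.F x.1 1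
  have hcov : IsCoveringMap fun q : RootSpace G => q.1.1 :=
    isCoveringMap_rootSpace (fun x => S.monic _ _) (fun x => S.natDegree_eq _ _)
      (fun k => (S.continuous_coeff_one k).comp continuous_subtype_val)
      fun x => S.separable _ fun h => x.2.2 (hB _ x.2.1 h)
  let m : ℂ → ℝ := fun x => (ε / 2) / max (ε / 2) (dist x b)
  have hmpos : ∀ x, 0 < max (ε / 2) (dist x b) := fun x => lt_max_of_lt_left (by positivity)
  have hm0 : ∀ x, 0 < m x := fun x => div_pos (by positivity) (hmpos x)
  have hm1 : ∀ x, m x ≤ 1 := fun x => (div_le_one (hmpos x)).2 (le_max_left _ _)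
  have hmc : Continuous m := by
    refine continuous_const.div (by fun_prop) fun x => (hmpos x).ne'
  have hmnear : ∀ x, dist x b ≤ ε / 2 → m x = 1 := fun x hx => by
    simp only [m, max_eq_left hx]
    field_simp
  have hmd : ∀ x, m x * dist x b ≤ ε / 2 := fun x => by
    simp only [m]
    rw [div_mul_eq_mul_div, div_le_iff₀ (hmpos x)]
    exact mul_le_mul_of_nonneg_left (le_max_right _ _) (by positivity)
  let c : I → ℂ → ℝ := fun t x => 1 - t * (1 - m x)
  have hc0 : ∀ t x, 0 < c t x := fun t x => by
    have h1 := t.2.1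
    have h2 := t.2.2
    have h3 := hm0 x
    have h4 := hm1 x
    simp only [c]
    nlinarith [mul_le_mul_of_nonneg_right h2 (sub_nonneg.2 h4)]
  have hc1 : ∀ t x, c t x ≤ 1 := fun t x => by
    have := mul_nonneg t.2.1 (sub_nonneg.2 (hm1 x))
    simp only [c]
    linarith
  let h : I → ℂ → ℂ := fun t x => b + c t x • (x - b)
  have hhc : Continuous fun q : I × ℂ => h q.1 q.2 := by
    simp only [h, c]
    fun_prop
  have hhK : ∀ t, ∀ x ∈ K, h t x ∈ K := fun t x hx => by
    have := hstar hx (a := 1 - c t x) (b := c t x) (by linarith [hc1 t x]) (hc0 t x).le (by ring)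
    convert this using 1
    simp only [h]
    module
  have hhb : ∀ t x, x ≠ b → h t x ≠ b := fun t x hx e => by
    have h1 : c t x • (x - b) = 0 := by simpa [h] using e
    rcases smul_eq_zero.1 h1 with h2 | h2
    · exact (hc0 t x).ne' h2
    · exact hx (sub_eq_zero.1 h2)
  let H : C(I × RootSpace G, {x : ℂ // x ∈ K ∧ x ≠ b}) :=
    ⟨fun q => ⟨h q.1 q.2.1.1.1, hhK _ _ q.2.1.1.2.1, hhb _ _ q.2.1.1.2.2⟩,
      Continuous.subtype_mk (hhc.comp (f := fun q : I × RootSpace G => (q.1, q.2.1.1.1))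
        (by fun_prop)) _⟩
  have H0 : ∀ a, H (0, a) = (ContinuousMap.id (RootSpace G) a).1.1 := fun a => by
    apply Subtype.ext
    simp [H, h, c]
  let Γ := hcov.liftHomotopy H (ContinuousMap.id (RootSpace G)) H0
  have hΓ : ∀ q, (Γ q).1.1 = H q := fun q => congrFun (hcov.liftHomotopy_lifts H _ H0) q
  have hΓ0 : ∀ a, Γ (0, a) = a := fun a => hcov.liftHomotopy_zero H _ H0 a
  have hΓnear : ∀ t (a : RootSpace G), dist a.1.1.1 b ≤ ε / 2 → Γ (t, a) = a := fun t a ha => by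
    have h1 : IsPreconnected (Set.univ : Set I) := isPreconnected_univ
    have e : ∀ t, H (t, a) = a.1.1 := fun t => by
      apply Subtype.ext
      simp [H, h, c, hmnear _ ha]
    have := hcov.eq_of_comp_eq (g₁ := fun t : I => Γ (t, a)) (g₂ := fun _ : I => a) (by fun_prop)
      continuous_const (by funext t; simp only [Function.comp]; rw [hΓ, e]) 0 (hΓ0 a)
    exact congrFun this t
  let up : (a : S.Over K) → a.1.1 ≠ b → RootSpace G := fun a ha => ⟨(⟨a.1.1, a.2.2, ha⟩, a.1.2), a.2.1⟩
  let down : RootSpace G → S.Over K := fun q => ⟨(q.1.1.1, q.1.2), q.2, q.1.1.2.1⟩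
  have hdown : Continuous down := by
    refine Continuous.subtype_mk ?_ _
    fun_prop
  let D : I × S.Over K → S.Over K := fun q =>
    if hq : q.2.1.1 ≠ b then down (Γ (q.1, up q.2 hq)) else q.2
  have hDnear : ∀ q : I × S.Over K, dist q.2.1.1 b ≤ ε / 2 → D q = q.2 := fun q hq => by
    by_cases hb : q.2.1.1 ≠ b
    · simp only [D, dif_pos hb]
      rw [hΓnear _ _ (by exact hq)]
    · simp only [D, dif_neg hb]
  have hDc : Continuous D := by
    rw [continuous_iff_continuousAt]
    intro q
    by_cases hb : q.2.1.1 ≠ b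
    · have hO : IsOpen {q : I × S.Over K | q.2.1.1 ≠ b} :=
        isOpen_ne_fun (by fun_prop) continuous_const
      refine ContinuousOn.continuousAt ?_ (hO.mem_nhds hb)
      rw [continuousOn_iff_continuous_domRestrict]
      have e : Set.domRestrict {q : I × S.Over K | q.2.1.1 ≠ b} D =
          fun q => down (Γ (q.1.1, up q.1.2 q.2)) := by
        funext q
        have hq : q.1.2.1.1 ≠ b := q.2
        simp only [Set.domRestrict, D, dif_pos hq]
      rw [e]
      refine hdown.comp (Γ.continuous.comp (Continuous.prodMk (by fun_prop) ?_))
      refine Continuous.subtype_mk (Continuous.prodMk (Continuous.subtype_mk ?_ _) ?_) _ <;> fun_prop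
    · have hlt : ∀ᶠ q' in 𝓝 q, dist q'.2.1.1 b < ε / 2 := by
        have : Continuous fun q' : I × S.Over K => dist q'.2.1.1 b := by fun_prop
        refine this.continuousAt.eventually_lt continuousAt_const ?_
        rw [not_not.1 hb, dist_self]
        positivity
      refine (continuous_snd.continuousAt (x := q)).congr ?_
      filter_upwards [hlt] with q' hq'
      exact (hDnear q' hq'.le).symm
  refine ⟨⟨D, hDc⟩, fun a => ?_, fun a => ?_⟩
  · show D (0, a) = a
    by_cases hb : a.1.1 ≠ b
    · simp only [D, dif_pos hb, hΓ0]
      rfl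
    · simp only [D, dif_neg hb]
  · show dist (D (1, a)).1.1 b < ε
    by_cases hb : a.1.1 ≠ b
    · simp only [D, dif_pos hb]
      have e1 : (down (Γ (1, up a hb))).1.1 = h 1 a.1.1 := by
        show ((Γ (1, up a hb)).1.1 : ℂ) = _
        rw [hΓ]
        rfl
      rw [e1]
      have e2 : dist (h 1 a.1.1) b = m a.1.1 * dist a.1.1 b := by
        rw [dist_eq_norm, dist_eq_norm]
        simp [h, c, abs_of_pos (hm0 _)]
      rw [e2]
      linarith [hmd a.1.1]
    · simp only [D, dif_neg hb]
      rw [not_not.1 hb, dist_self]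
      exact hε

end Sheeted
end HomSurf

end

section

open Filter Topology Polynomial unitInterval

namespace HomSurf

lemma exists_local_sections {E T : Type*} [TopologicalSpace E] [TopologicalSpace T] {p : E → T}
    (hp : IsCoveringMap p) (e : E) : ∃ (O : Set T) (s : T → E), IsOpen O ∧ p e ∈ O ∧
      ContinuousOn s O ∧ (∀ y ∈ O, p (s y) = y) ∧ s (p e) = e := by
  obtain ⟨g, hg, rfl⟩ := hp.isLocalHomeomorph e
  exact ⟨g.target, g.symm, g.open_target, g.map_source hg, g.continuousOn_symm,
    fun y hy => g.right_inv hy, g.left_inv hg⟩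

namespace Sheeted
variable {d : ℕ} (S : Sheeted d)

lemma exists_lift_near_fibre {E T : Type*} [TopologicalSpace E] [TopologicalSpace T] {p : E → T}
    (hp : IsCoveringMap p) (hsurj : Function.Surjective p) {K : Set ℂ} {b : ℂ} (hb : b ∈ K)
    {φ : S.Over K → T} (hφ : Continuous φ) :
    ∃ ε > 0, ∃ ψ : S.Over K → E, ContinuousOn ψ {a | dist a.1.1 b < ε} ∧
      ∀ a : S.Over K, dist a.1.1 b < ε → p (ψ a) = φ a := by
  classical
  choose e he using hsurj
  choose O s hO hyO hsO hps hse using fun y => exists_local_sections hp (e y)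
  obtain ⟨r, hr⟩ := exists_eq_prod (S.monic b 1) (S.natDegree_eq b 1)
  obtain ⟨ρ, hρ, hρ0, hρc⟩ := exists_labelling (fun x => S.monic x 1) (fun x => S.natDegree_eq x 1)
    S.continuous_coeff_one b r hr
  let a : Fin d → S.Over K := fun i => ⟨(b, r i), by
    refine ⟨?_, hb⟩
    show (S.F b 1).IsRoot (r i)
    rw [hr, isRoot_prod_iff]
    exact ⟨i, rfl⟩⟩
  have hη : ∀ᶠ η in 𝓝[>] (0 : ℝ), (∀ i j, r i ≠ r j → 2 * η ≤ dist (r i) (r j)) ∧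
      ∀ i, Metric.ball (a i) η ⊆ φ ⁻¹' O (φ (a i)) := by
    refine Filter.Eventually.and ?_ ?_
    · simp only [Filter.eventually_all]
      intro i j hij
      filter_upwards [Ioo_mem_nhdsGT (half_pos (dist_pos.2 hij))] with η hη
      linarith [hη.2]
    · simp only [Filter.eventually_all]
      intro i
      have : φ ⁻¹' O (φ (a i)) ∈ 𝓝 (a i) :=
        ((hO _).preimage hφ).mem_nhds (by have := hyO (φ (a i)); rwa [he] at this)
      obtain ⟨η₀, h0, hs⟩ := Metric.mem_nhds_iff.1 this
      filter_upwards [Ioo_mem_nhdsGT h0] with η hη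
      exact (Metric.ball_subset_ball hη.2.le).trans hs
  obtain ⟨η, ⟨hη1, hη2⟩, hη0⟩ := (hη.and self_mem_nhdsWithin).exists
  have hη0 : 0 < η := hη0
  have hnear : ∀ᶠ x in 𝓝 b, dist (ρ x) r < η := by
    have := hρc (by rw [hρ0]; exact Metric.ball_mem_nhds r hη0)
    exact this
  obtain ⟨ε, hε0, hε⟩ := Metric.eventually_nhds_iff.1 hnear
  have hidx : ∀ q : S.Over K, ∃ i : Fin d, dist q.1.1 b < ε → dist q.1.2 (r i) < η := by
    rintro ⟨⟨x, z⟩, hz, hx⟩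
    have hz' : (S.F x 1).IsRoot z := hz
    rw [hρ x, isRoot_prod_iff] at hz'
    obtain ⟨i, rfl⟩ := hz'
    exact ⟨i, fun h => (dist_le_pi_dist _ _ i).trans_lt (hε h)⟩
  choose idx hidx using hidx
  have haij : ∀ (z : ℂ) (i j : Fin d), dist z (r i) < η → dist z (r j) < η → a i = a j := by
    intro z i j h1 h2
    refine Subtype.ext (Prod.ext rfl ?_)
    by_contra hij
    have := hη1 i j hij
    have := dist_triangle_left (r i) (r j) z
    linarith
  have hball : ∀ (q : S.Over K) i, dist q.1.1 b < η → dist q.1.2 (r i) < η →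
      φ q ∈ O (φ (a i)) := fun q i h1 h2 => hη2 i (by
    show dist q.1 (b, r i) < η
    rw [Prod.dist_eq]
    exact max_lt h1 h2)
  refine ⟨min ε η, lt_min hε0 hη0, fun q => s (φ (a (idx q))) (φ q), ?_, ?_⟩
  · intro q hq
    have hq' : dist q.1.1 b < min ε η := hq
    have h1 := lt_of_lt_of_le hq' (min_le_left _ _)
    have h2 := lt_of_lt_of_le hq' (min_le_right _ _)
    have h3 := hidx q h1
    apply ContinuousAt.continuousWithinAt
    have h4 : ContinuousAt (fun q' => s (φ (a (idx q))) (φ q')) q :=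
      ContinuousAt.comp ((hsO _).continuousAt ((hO _).mem_nhds (hball q _ h2 h3)))
        hφ.continuousAt
    refine h4.congr ?_
    have e1 : ∀ᶠ q' : S.Over K in 𝓝 q, dist q'.1.1 b < ε :=
      (show Continuous fun q' : S.Over K => dist q'.1.1 b by fun_prop).continuousAt.eventually_lt
        continuousAt_const h1
    have e2 : ∀ᶠ q' : S.Over K in 𝓝 q, dist q'.1.2 (r (idx q)) < η :=
      (show Continuous fun q' : S.Over K => dist q'.1.2 (r (idx q)) by
        fun_prop).continuousAt.eventually_lt continuousAt_const h3
    filter_upwards [e1, e2] with q' e1 e2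
    rw [haij q'.1.2 (idx q) (idx q') e2 (hidx q' e1)]
  · intro q hq
    have h1 := lt_of_lt_of_le hq (min_le_left _ _)
    have h2 := lt_of_lt_of_le hq (min_le_right _ _)
    exact hps _ _ (hball q _ h2 (hidx q h1))

/-- Maps from the curve over a star-shaped set with at most one branch point lift through
surjective coverings. -/
theorem exists_lift_of_starConvex {E T : Type*} [TopologicalSpace E] [TopologicalSpace T]
    {p : E → T} (hp : IsCoveringMap p) (hsurj : Function.Surjective p) {K : Set ℂ} {b : ℂ}
    (hb : b ∈ K) (hstar : StarConvex ℝ b K) (hB : ∀ x ∈ K, x ∈ S.B → x = b)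
    {φ : S.Over K → T} (hφ : Continuous φ) :
    ∃ ψ : S.Over K → E, Continuous ψ ∧ ∀ a, p (ψ a) = φ a := by
  obtain ⟨ε, hε, ψ₀, hψ₀, hpψ₀⟩ := S.exists_lift_near_fibre hp hsurj hb hφ
  obtain ⟨D, hD0, hD1⟩ := S.exists_deformation hstar hB hε
  let H : C(I × S.Over K, T) := ⟨fun q => φ (D (σ q.1, q.2)), hφ.comp (D.continuous.comp (by fun_prop))⟩
  let f : C(S.Over K, E) := ⟨fun a => ψ₀ (D (1, a)), hψ₀.comp_continuous (by fun_prop) fun a => hD1 a⟩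
  have H0 : ∀ a, H (0, a) = p (f a) := fun a => by
    simp [H, f, hpψ₀ _ (hD1 a)]
  refine ⟨fun a => hp.liftHomotopy H f H0 (1, a), by fun_prop, fun a => ?_⟩
  have := congrFun (hp.liftHomotopy_lifts H f H0) (1, a)
  simp only [Function.comp] at this
  rw [this]
  simp [H, hD0]

end Sheeted
end HomSurf

end

section

open Filter Topology Polynomial

namespace HomSurf

/-- A cyclic covering of order `n`. -/
structure CyclicCover (n : ℕ) (X Y : Type) [TopologicalSpace X] [TopologicalSpace Y] where
  pos : 0 < n
  p : Y → X
  isCoveringMap : IsCoveringMap p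
  surjective : Function.Surjective p
  σ : Y → Y
  continuous_σ : Continuous σ
  p_σ : ∀ y, p (σ y) = p y
  exists_iterate : ∀ y y', p y = p y' → ∃ k : ℕ, y = σ^[k] y'
  iterate_eq_iff : ∀ (k : ℕ) y, σ^[k] y = y ↔ n ∣ k

/-- The standard primitive root of unity. -/
noncomputable def unityRoot (n : ℕ) : ℂ := Complex.exp (2 * Real.pi * Complex.I / n)

lemma isPrimitiveRoot_unityRoot {n : ℕ} (hn : 0 < n) : IsPrimitiveRoot (unityRoot n) n :=
  Complex.isPrimitiveRoot_exp n hn.ne'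

lemma unityRoot_ne_zero (n : ℕ) : unityRoot n ≠ 0 := Complex.exp_ne_zero _

namespace CyclicCover
variable {n : ℕ} {X Y : Type} [TopologicalSpace X] [TopologicalSpace Y] (Q : CyclicCover n X Y)

lemma p_iterate (k : ℕ) (y : Y) : Q.p (Q.σ^[k] y) = Q.p y := by
  induction k with
  | zero => rfl
  | succ k ih => rw [Function.iterate_succ_apply', Q.p_σ, ih]

lemma iterate_n (y : Y) : Q.σ^[n] y = y := (Q.iterate_eq_iff n y).2 dvd_rfl

lemma σ_injective : Function.Injective Q.σ := by
  have h : Function.Injective (Q.σ^[n - 1] ∘ Q.σ) := by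
    rw [← Function.iterate_succ, Nat.succ_eq_add_one, Nat.sub_add_cancel Q.pos]
    intro a b hab
    rwa [Q.iterate_n, Q.iterate_n] at hab
  exact h.of_comp

lemma pow_eq_of_iterate_eq {j k : ℕ} {y : Y} (h : Q.σ^[j] y = Q.σ^[k] y) :
    unityRoot n ^ j = unityRoot n ^ k := by
  wlog hjk : j ≤ k generalizing j k
  · exact (this h.symm (le_of_not_ge hjk)).symm
  obtain ⟨m, rfl⟩ := Nat.exists_eq_add_of_le hjk
  rw [Function.iterate_add_apply] at h
  have h1 := (Q.iterate_eq_iff m y).1 ((Q.σ_injective.iterate j) h).symm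
  rw [pow_add, ((isPrimitiveRoot_unityRoot Q.pos).pow_eq_one_iff_dvd m).2 h1, mul_one]

open Classical in
/-- The root of unity comparing two points of the same fibre. -/
noncomputable def diff (y y' : Y) : ℂ :=
  if h : Q.p y = Q.p y' then unityRoot n ^ (Q.exists_iterate y y' h).choose else 1

lemma diff_iterate (k : ℕ) (y : Y) : Q.diff (Q.σ^[k] y) y = unityRoot n ^ k := by
  have h : Q.p (Q.σ^[k] y) = Q.p y := Q.p_iterate k y
  rw [diff, dif_pos h]
  exact Q.pow_eq_of_iterate_eq (Q.exists_iterate _ y h).choose_spec.symm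

lemma diff_σ {y y' : Y} (h : Q.p y = Q.p y') : Q.diff (Q.σ y) y' = unityRoot n * Q.diff y y' := by
  obtain ⟨k, rfl⟩ := Q.exists_iterate y y' h
  rw [← Function.iterate_succ_apply' Q.σ, diff_iterate, diff_iterate, pow_succ']

lemma diff_ne_zero (y y' : Y) : Q.diff y y' ≠ 0 := by
  rw [diff]
  split_ifs
  · exact pow_ne_zero _ (unityRoot_ne_zero n)
  · exact one_ne_zero

lemma diff_pow (y y' : Y) : Q.diff y y' ^ n = 1 := by
  rw [diff]
  split_ifs
  · rw [← pow_mul, mul_comm, pow_mul, (isPrimitiveRoot_unityRoot Q.pos).pow_eq_one, one_pow]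
  · exact one_pow n

lemma diff_σ_σ {y y' : Y} (h : Q.p y = Q.p y') : Q.diff (Q.σ y) (Q.σ y') = Q.diff y y' := by
  obtain ⟨k, rfl⟩ := Q.exists_iterate y y' h
  rw [← Function.iterate_succ_apply' Q.σ, Function.iterate_succ_apply, diff_iterate, diff_iterate]

lemma continuous_diff {Z : Type*} [TopologicalSpace Z] {a b : Z → Y} (ha : Continuous a)
    (hb : Continuous b) (h : ∀ z, Q.p (a z) = Q.p (b z)) : Continuous fun z => Q.diff (a z) (b z) := by
  rw [continuous_iff_continuousAt]
  intro z
  obtain ⟨k, hk⟩ := Q.exists_iterate _ _ (h z)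
  have hσ : Continuous Q.σ^[k] := Q.continuous_σ.iterate k
  have hopen : IsOpen {z | a z = Q.σ^[k] (b z)} :=
    Q.isCoveringMap.isLocalHomeomorph.isLocallyInjective.isOpen_eqLocus ha (hσ.comp hb)
      (by funext z; simp [Function.comp, h z, Q.p_iterate])
  refine (continuousAt_const (y := unityRoot n ^ k)).congr ?_
  filter_upwards [hopen.mem_nhds hk] with z' hz'
  rw [show a z' = Q.σ^[k] (b z') from hz', diff_iterate]

/-- Invariant functions descend to the base. -/
lemma exists_descent {A : Set X} {f : Y → ℂ} (hf : ContinuousOn f (Q.p ⁻¹' A))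
    (hσ : ∀ y, Q.p y ∈ A → f (Q.σ y) = f y) :
    ∃ g : X → ℂ, ContinuousOn g A ∧ ∀ y, Q.p y ∈ A → f y = g (Q.p y) := by
  have hit : ∀ (k : ℕ) y, Q.p y ∈ A → f (Q.σ^[k] y) = f y := by
    intro k
    induction k with
    | zero => intro y _; rfl
    | succ k ih =>
      intro y hy
      rw [Function.iterate_succ_apply', hσ _ (by rwa [Q.p_iterate]), ih y hy]
  choose s hs using Q.surjective
  have hfs : ∀ y, Q.p y ∈ A → f y = f (s (Q.p y)) := fun y hy => by
    obtain ⟨k, hk⟩ := Q.exists_iterate y (s (Q.p y)) (hs _).symm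
    conv_lhs => rw [hk]
    exact hit k _ (by rwa [hs])
  refine ⟨fun x => f (s x), fun x hx => ?_, hfs⟩
  obtain ⟨O, t, hO, hxO, htc, htp, -⟩ := exists_local_sections Q.isCoveringMap (s x)
  rw [hs] at hxO
  have h1 : ContinuousWithinAt (fun x' => f (t x')) (A ∩ O) x := by
    refine ContinuousOn.comp (t := Q.p ⁻¹' A) hf (htc.mono Set.inter_subset_right) ?_ x ⟨hx, hxO⟩
    intro x' hx'
    show Q.p (t x') ∈ A
    rw [htp _ hx'.2]
    exact hx'.1
  have h2 : ContinuousWithinAt (fun x' => f (s x')) (A ∩ O) x := by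
    refine h1.congr (fun x' hx' => ?_) ?_
    · have := hfs (t x') (by rw [htp _ hx'.2]; exact hx'.1)
      rw [htp _ hx'.2] at this
      exact this.symm
    · have := hfs (t x) (by rw [htp _ hxO]; exact hx)
      rw [htp _ hxO] at this
      exact this.symm
  exact (continuousWithinAt_inter (hO.mem_nhds hxO)).1 h2

/-- The deck transformation over a subset of the base. -/
def restrictσ (A : Set X) (y : Q.p ⁻¹' A) : Q.p ⁻¹' A :=
  ⟨Q.σ y, Set.mem_preimage.2 (by rw [Q.p_σ]; exact y.2)⟩

lemma coe_iterate_restrictσ (A : Set X) (k : ℕ) (y : Q.p ⁻¹' A) :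
    ((Q.restrictσ A)^[k] y).1 = Q.σ^[k] y.1 :=
  Function.Semiconj.iterate_right (f := Subtype.val) (ga := Q.restrictσ A) (gb := Q.σ)
    (fun _ => rfl) k y

/-- Restriction of a cyclic covering to a subset of the base. -/
def restrict (A : Set X) : CyclicCover n A (Q.p ⁻¹' A) where
  pos := Q.pos
  p := A.restrictPreimage Q.p
  isCoveringMap := Q.isCoveringMap.restrictPreimage A
  surjective := Q.surjective.restrictPreimage A
  σ := Q.restrictσ A
  continuous_σ := (Q.continuous_σ.comp continuous_subtype_val).subtype_mk _
  p_σ y := Subtype.ext (Q.p_σ y)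
  exists_iterate y y' h := by
    obtain ⟨k, hk⟩ := Q.exists_iterate y y' (congrArg Subtype.val h)
    exact ⟨k, Subtype.ext (by rw [hk, coe_iterate_restrictσ])⟩
  iterate_eq_iff k y := by
    rw [← Q.iterate_eq_iff k y.1, Subtype.ext_iff, coe_iterate_restrictσ]

/-- Transport of a cyclic covering along a homeomorphism of the base. -/
def map {X' : Type} [TopologicalSpace X'] (e : X ≃ₜ X') : CyclicCover n X' Y where
  pos := Q.pos
  p := e ∘ Q.p
  isCoveringMap := Q.isCoveringMap.homeomorph_comp e
  surjective := e.surjective.comp Q.surjective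
  σ := Q.σ
  continuous_σ := Q.continuous_σ
  p_σ y := congrArg e (Q.p_σ y)
  exists_iterate y y' h := Q.exists_iterate y y' (e.injective h)
  iterate_eq_iff := Q.iterate_eq_iff

end CyclicCover
end HomSurf

end

section

open Filter Topology Polynomial

namespace HomSurf
namespace Sheeted
variable {d : ℕ} (S : Sheeted d)

/-- Nonvanishing functions on the curve over a star-shaped set with at most one branch point have
logarithms. -/
theorem exists_log_of_starConvex {K : Set ℂ} {b : ℂ}
    (hb : b ∈ K) (hstar : StarConvex ℝ b K) (hB : ∀ x ∈ K, x ∈ S.B → x = b)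
    {g : S.Over K → ℂ} (hg : Continuous g) (hg0 : ∀ a, g a ≠ 0) :
    ∃ l : S.Over K → ℂ, Continuous l ∧ ∀ a, Complex.exp (l a) = g a := by
  obtain ⟨ψ, h1, h2⟩ := S.exists_lift_of_starConvex Complex.isCoveringMap_exp
    (fun z => ⟨Complex.log z, Subtype.ext (Complex.exp_log z.2)⟩) hb hstar hB
    (hg.subtype_mk hg0)
  exact ⟨ψ, h1, fun a => congrArg Subtype.val (h2 a)⟩

variable {n : ℕ} {Y : Type} [TopologicalSpace Y] (Q : CyclicCover n S.curve Y)

/-- A nonvanishing function on the part of a cyclic covering over `K`, equivariant for the deck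
transformation. -/
def Equivariant (K : Set ℂ) (u : Y → ℂ) : Prop :=
  ContinuousOn u {y | (Q.p y).1.1 ∈ K} ∧ ∀ y, (Q.p y).1.1 ∈ K →
    u y ≠ 0 ∧ u (Q.σ y) = unityRoot n * u y

lemma exists_equivariant_of_starConvex {K : Set ℂ} {b : ℂ}
    (hb : b ∈ K) (hstar : StarConvex ℝ b K) (hB : ∀ x ∈ K, x ∈ S.B → x = b) :
    ∃ u, S.Equivariant Q K u := by
  classical
  obtain ⟨ψ, hψ, hψp⟩ := S.exists_lift_of_starConvex Q.isCoveringMap Q.surjective hb hstar hB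
    (φ := fun a => (⟨a.1, a.2.1⟩ : S.curve)) (by fun_prop)
  let lift : (y : Y) → (Q.p y).1.1 ∈ K → Y := fun y hy => ψ ⟨(Q.p y).1, (Q.p y).2, hy⟩
  have hlift : ∀ y hy, Q.p (lift y hy) = Q.p y := fun y hy => by simp [lift, hψp]
  refine ⟨fun y => if hy : (Q.p y).1.1 ∈ K then Q.diff y (lift y hy) else 0, ?_, fun y hy => ?_⟩
  · rw [continuousOn_iff_continuous_domRestrict]
    have : Continuous fun y : {y | (Q.p y).1.1 ∈ K} => Q.diff y.1 (lift y.1 y.2) := by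
      refine Q.continuous_diff continuous_subtype_val ?_ fun y => (hlift y.1 y.2).symm
      have hp := Q.isCoveringMap.continuous
      exact hψ.comp (Continuous.subtype_mk (by fun_prop) _)
    convert this using 1
    funext y
    have hy : (Q.p y.1).1.1 ∈ K := y.2
    simp [Set.domRestrict, hy]
  · have hy' : (Q.p (Q.σ y)).1.1 ∈ K := by rwa [Q.p_σ]
    simp only [dif_pos hy, dif_pos hy']
    refine ⟨Q.diff_ne_zero _ _, ?_⟩
    have e : lift (Q.σ y) hy' = lift y hy := by
      simp only [lift]
      congr 2
      simp only [Q.p_σ]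
    rw [e, Q.diff_σ (hlift y hy).symm]

lemma exists_equivariant_of_glue {K : Set ℂ} (hK : IsOpen K) (hconv : Convex ℝ K) (ℓ : ℂ →L[ℝ] ℝ)
    {c ε : ℝ} (hε : 0 < ε) (hB : ∀ b ∈ S.B, b ∈ K → ε ≤ |ℓ b - c|)
    {u₁ u₂ : Y → ℂ} (h₁ : S.Equivariant Q (K ∩ {x | ℓ x < c + ε}) u₁)
    (h₂ : S.Equivariant Q (K ∩ {x | c - ε < ℓ x}) u₂) : ∃ u, S.Equivariant Q K u := by
  classical
  have hpc := Q.isCoveringMap.continuous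
  set K' : Set ℂ := K ∩ {x | ℓ x < c + ε} ∩ {x | c - ε < ℓ x} with hK'
  have hK'o : IsOpen K' := (hK.inter (isOpen_lt (by fun_prop) (by fun_prop))).inter
    (isOpen_lt (by fun_prop) (by fun_prop))
  have hK'c : Convex ℝ K' :=
    (hconv.inter ((convex_Iio (c + ε)).linear_preimage ℓ.toLinearMap)).inter
      ((convex_Ioi (c - ε)).linear_preimage ℓ.toLinearMap)
  have hK'B : ∀ x ∈ K', x ∉ S.B := fun x hx hxB => by
    have h1 := hB x hxB hx.1.1
    have h2 : |ℓ x - c| < ε := abs_lt.2 ⟨by have := hx.2; simp at this; linarith, by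
      have := hx.1.2; simp at this; linarith⟩
    linarith
  have hu1 : ∀ y, (Q.p y).1.1 ∈ K' → u₁ y ≠ 0 ∧ u₁ (Q.σ y) = unityRoot n * u₁ y :=
    fun y hy => h₁.2 y hy.1
  have hu2 : ∀ y, (Q.p y).1.1 ∈ K' → u₂ y ≠ 0 ∧ u₂ (Q.σ y) = unityRoot n * u₂ y :=
    fun y hy => h₂.2 y ⟨hy.1.1, hy.2⟩
  have hc1 : ContinuousOn u₁ {y | (Q.p y).1.1 ∈ K'} := h₁.1.mono fun y hy => hy.1
  have hc2 : ContinuousOn u₂ {y | (Q.p y).1.1 ∈ K'} := h₂.1.mono fun y hy => ⟨hy.1.1, hy.2⟩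
  obtain ⟨l, hlc, hl⟩ : ∃ l : Y → ℂ, ContinuousOn l {y | (Q.p y).1.1 ∈ K'} ∧
      ∀ y, (Q.p y).1.1 ∈ K' → l (Q.σ y) = l y ∧ u₁ y = u₂ y * Complex.exp (l y) := by
    rcases K'.eq_empty_or_nonempty with he | ⟨b, hb⟩
    · exact ⟨0, continuousOn_const, fun y hy => by simp [he] at hy⟩
    obtain ⟨g, hg, hgu⟩ := Q.exists_descent (A := {q | q.1.1 ∈ K'}) (f := fun y => u₁ y / u₂ y)
      (hc1.div hc2 fun y hy => (hu2 y hy).1) (fun y hy => by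
        rw [(hu1 y hy).2, (hu2 y hy).2, mul_div_mul_left _ _ (unityRoot_ne_zero n)])
    obtain ⟨l, hl, hlg⟩ := S.exists_log_of_starConvex hb (hK'c hb) (fun x hx hxB =>
      absurd hxB (hK'B x hx)) (g := fun a => g ⟨a.1, a.2.1⟩)
      (hg.comp_continuous (by fun_prop) fun a => a.2.2) (fun a => by
        obtain ⟨y, hy⟩ := Q.surjective ⟨a.1, a.2.1⟩
        have hyK : (Q.p y).1.1 ∈ K' := by rw [hy]; exact a.2.2
        have := hgu y hyK
        simp only [hy] at this
        rw [← this]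
        exact div_ne_zero (hu1 y hyK).1 (hu2 y hyK).1)
    refine ⟨fun y => if hy : (Q.p y).1.1 ∈ K' then l ⟨(Q.p y).1, (Q.p y).2, hy⟩ else 0, ?_, ?_⟩
    · rw [continuousOn_iff_continuous_domRestrict]
      have : Continuous fun y : {y | (Q.p y).1.1 ∈ K'} => l ⟨(Q.p y.1).1, (Q.p y.1).2, y.2⟩ :=
        hl.comp (Continuous.subtype_mk (by fun_prop) _)
      convert this using 1
      funext y
      have hy : (Q.p y.1).1.1 ∈ K' := y.2
      simp [Set.domRestrict, hy]
    · intro y hy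
      have hy' : (Q.p (Q.σ y)).1.1 ∈ K' := by rwa [Q.p_σ]
      simp only [dif_pos hy, dif_pos hy', hlg]
      refine ⟨by simp only [Q.p_σ], ?_⟩
      have := hgu y hy
      rw [← this, mul_div_cancel₀ _ (hu2 y hy).1]
  let θ : ℝ → ℝ := fun t => max 0 (min 1 ((t - c) / ε + 1 / 2))
  have hθc : Continuous θ := by simp only [θ]; fun_prop
  have hθ0 : ∀ t, t ≤ c - ε / 2 → θ t = 0 := fun t ht => by
    apply max_eq_left
    refine (min_le_right _ _).trans ?_
    have : (t - c) / ε ≤ -(1 / 2) := by rw [div_le_iff₀ hε]; linarith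
    linarith
  have hθ1 : ∀ t, c + ε / 2 ≤ t → θ t = 1 := fun t ht => by
    have : 1 / 2 ≤ (t - c) / ε := by rw [le_div_iff₀ hε]; linarith
    simp only [θ]
    rw [min_eq_left (by linarith), max_eq_right zero_le_one]
  let x : Y → ℂ := fun y => (Q.p y).1.1
  have hxc : Continuous x := by simp only [x]; fun_prop
  have hxσ : ∀ y, x (Q.σ y) = x y := fun y => by simp only [x, Q.p_σ]
  let w : Y → ℂ := fun y => u₁ y * Complex.exp (-(θ (ℓ (x y)) : ℂ) * l y)
  let u : Y → ℂ := fun y => if ℓ (x y) ≤ c - ε / 2 then u₁ y else if c + ε / 2 ≤ ℓ (x y) then u₂ y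
    else w y
  have huw : ∀ y, x y ∈ K' → u y = w y := fun y hy => by
    simp only [u, w]
    split_ifs with h1 h2
    · simp [hθ0 _ h1]
    · rw [hθ1 _ h2, (hl y hy).2]
      simp [mul_assoc, ← Complex.exp_add]
    · rfl
  refine ⟨u, fun y hy => ContinuousAt.continuousWithinAt ?_, fun y hy => ?_⟩
  · have hy : x y ∈ K := hy
    rcases lt_trichotomy (|ℓ (x y) - c|) ε with h | h | h
    · rw [abs_lt] at h
      have hyK : x y ∈ K' := ⟨⟨hy, by simp only [Set.mem_ofPred_eq]; linarith⟩, by simp only [Set.mem_ofPred_eq]; linarith⟩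
      have hO : {y | x y ∈ K'} ∈ 𝓝 y := (hK'o.preimage hxc).mem_nhds hyK
      have hw : ContinuousAt w y := by
        refine (hc1.continuousAt hO).mul (ContinuousAt.cexp (ContinuousAt.mul ?_ (hlc.continuousAt hO)))
        have : Continuous fun y => -(θ (ℓ (x y)) : ℂ) := by fun_prop
        exact this.continuousAt
      refine hw.congr ?_
      filter_upwards [hO] with y' hy'
      exact (huw y' hy').symm
    all_goals
      have hor : ℓ (x y) < c - ε / 2 ∨ c + ε / 2 < ℓ (x y) := by
        rcases le_total 0 (ℓ (x y) - c) with h0 | h0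
        · rw [abs_of_nonneg h0] at h; right; linarith
        · rw [abs_of_nonpos h0] at h; left; linarith
      rcases hor with hlt | hlt
      · have hO : {y | x y ∈ K ∩ {x | ℓ x < c + ε}} ∈ 𝓝 y :=
          ((hK.inter (isOpen_lt (by fun_prop) (by fun_prop))).preimage hxc).mem_nhds
            ⟨hy, by simp only [Set.mem_ofPred_eq]; linarith⟩
        refine (h₁.1.continuousAt hO).congr ?_
        have : ∀ᶠ y' in 𝓝 y, ℓ (x y') < c - ε / 2 :=
          (show Continuous fun y' => ℓ (x y') by fun_prop).continuousAt.eventually_lt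
            continuousAt_const hlt
        filter_upwards [this] with y' hy'
        simp only [u, if_pos hy'.le]
      · have hO : {y | x y ∈ K ∩ {x | c - ε < ℓ x}} ∈ 𝓝 y :=
          ((hK.inter (isOpen_lt (by fun_prop) (by fun_prop))).preimage hxc).mem_nhds
            ⟨hy, by simp only [Set.mem_ofPred_eq]; linarith⟩
        refine (h₂.1.continuousAt hO).congr ?_
        have : ∀ᶠ y' in 𝓝 y, c + ε / 2 < ℓ (x y') :=
          continuousAt_const.eventually_lt
            (show Continuous fun y' => ℓ (x y') by fun_prop).continuousAt hlt
        filter_upwards [this] with y' hy'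
        simp only [u]
        rw [if_neg (by linarith), if_pos hy'.le]
  · have hy : x y ∈ K := hy
    simp only [u, hxσ]
    split_ifs with h1 h2
    · exact h₁.2 y ⟨hy, by simp only [Set.mem_ofPred_eq]; linarith⟩
    · exact h₂.2 y ⟨hy, by simp only [Set.mem_ofPred_eq]; linarith⟩
    · have hyK : x y ∈ K' := ⟨⟨hy, by simp only [Set.mem_ofPred_eq]; linarith⟩, by simp only [Set.mem_ofPred_eq]; linarith⟩
      refine ⟨mul_ne_zero (hu1 y hyK).1 (Complex.exp_ne_zero _), ?_⟩
      simp only [w, hxσ, (hl y hyK).1, (hu1 y hyK).2, mul_assoc]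

lemma exists_separating {a b : ℂ} (hab : a ≠ b) (B : Finset ℂ) :
    ∃ (ℓ : ℂ →L[ℝ] ℝ) (c ε : ℝ), 0 < ε ∧ (∀ x ∈ B, ε ≤ |ℓ x - c|) ∧
      ((ℓ a < c ∧ c < ℓ b) ∨ (ℓ b < c ∧ c < ℓ a)) := by
  classical
  have key : ∀ (ℓ : ℂ →L[ℝ] ℝ) (a b : ℂ), ℓ a < ℓ b → ∃ c ε : ℝ, 0 < ε ∧ (∀ x ∈ B, ε ≤ |ℓ x - c|) ∧
      (ℓ a < c ∧ c < ℓ b) := by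
    intro ℓ a b h
    obtain ⟨c, hc, hcB⟩ : ∃ c ∈ Set.Ioo (ℓ a) (ℓ b), c ∉ (B.image ℓ : Set ℝ) :=
      ((Set.Ioo_infinite h).sdiff (B.image ℓ).finite_toSet).nonempty
    have : ∀ᶠ ε in 𝓝[>] (0 : ℝ), ∀ x ∈ B, ε ≤ |ℓ x - c| := by
      rw [Filter.eventually_all_finset]
      intro x hx
      have hpos : 0 < |ℓ x - c| := abs_pos.2 (sub_ne_zero.2 fun e => hcB (by
        simp only [Finset.coe_image]; exact ⟨x, hx, e⟩))
      filter_upwards [Ioo_mem_nhdsGT hpos] with ε hε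
      exact hε.2.le
    obtain ⟨ε, h1, h2⟩ := (this.and self_mem_nhdsWithin).exists
    exact ⟨c, ε, h2, h1, hc⟩
  have key' : ∀ (ℓ : ℂ →L[ℝ] ℝ), ℓ a ≠ ℓ b → ∃ (ℓ : ℂ →L[ℝ] ℝ) (c ε : ℝ), 0 < ε ∧
      (∀ x ∈ B, ε ≤ |ℓ x - c|) ∧ ((ℓ a < c ∧ c < ℓ b) ∨ (ℓ b < c ∧ c < ℓ a)) := by
    intro ℓ h
    rcases lt_or_gt_of_ne h with h | h
    · obtain ⟨c, ε, h1, h2, h3⟩ := key ℓ a b h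
      exact ⟨ℓ, c, ε, h1, h2, Or.inl h3⟩
    · obtain ⟨c, ε, h1, h2, h3⟩ := key ℓ b a h
      exact ⟨ℓ, c, ε, h1, h2, Or.inr h3⟩
  by_cases hre : a.re = b.re
  · exact key' Complex.imCLM fun him => hab (Complex.ext hre him)
  · exact key' Complex.reCLM hre

theorem exists_equivariant {K : Set ℂ} (hK : IsOpen K) (hconv : Convex ℝ K) :
    ∃ u, S.Equivariant Q K u := by
  classical
  induction hm : (S.B.filter (· ∈ K)).card using Nat.strong_induction_on generalizing K with
  | _ m ih =>
  by_cases h : ∃ a ∈ S.B.filter (· ∈ K), ∃ b ∈ S.B.filter (· ∈ K), a ≠ b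
  · obtain ⟨a, ha, b, hb, hab⟩ := h
    obtain ⟨ℓ, c, ε, hε, hB, hor⟩ := exists_separating hab S.B
    have hsmall : ∀ (P : ℂ → Prop) (z : ℂ), z ∈ S.B.filter (· ∈ K) → ¬ P z →
        (S.B.filter (· ∈ K ∩ {x | P x})).card < m := fun P z hz hP => by
      rw [← hm]
      apply Finset.card_lt_card
      rw [Finset.ssubset_iff_of_subset]
      · exact ⟨z, hz, fun h => hP (Finset.mem_filter.1 h).2.2⟩
      · intro x hx
        rw [Finset.mem_filter] at hx ⊢
        exact ⟨hx.1, hx.2.1⟩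
    have hle : ∀ z ∈ S.B.filter (· ∈ K), c < ℓ z → c + ε ≤ ℓ z := fun z hz h => by
      have := hB z (Finset.mem_filter.1 hz).1
      rw [abs_of_pos (by linarith)] at this
      linarith
    have hge : ∀ z ∈ S.B.filter (· ∈ K), ℓ z < c → ℓ z ≤ c - ε := fun z hz h => by
      have := hB z (Finset.mem_filter.1 hz).1
      rw [abs_of_neg (by linarith)] at this
      linarith
    obtain ⟨z₁, hz₁, z₂, hz₂, h1, h2⟩ : ∃ z₁ ∈ S.B.filter (· ∈ K), ∃ z₂ ∈ S.B.filter (· ∈ K),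
        ℓ z₁ ≤ c - ε ∧ c + ε ≤ ℓ z₂ := by
      rcases hor with ⟨h1, h2⟩ | ⟨h1, h2⟩
      · exact ⟨a, ha, b, hb, hge a ha h1, hle b hb h2⟩
      · exact ⟨b, hb, a, ha, hge b hb h1, hle a ha h2⟩
    obtain ⟨u₁, hu₁⟩ := ih (K := K ∩ {x | ℓ x < c + ε}) _ (hsmall (fun x => ℓ x < c + ε) z₂ hz₂ (not_lt.2 h2))
      (hK.inter (isOpen_lt ℓ.continuous continuous_const))
      (hconv.inter ((convex_Iio (c + ε)).linear_preimage ℓ.toLinearMap)) (by congr!)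
    obtain ⟨u₂, hu₂⟩ := ih (K := K ∩ {x | c - ε < ℓ x}) _ (hsmall (fun x => c - ε < ℓ x) z₁ hz₁ (not_lt.2 h1))
      (hK.inter (isOpen_lt continuous_const ℓ.continuous))
      (hconv.inter ((convex_Ioi (c - ε)).linear_preimage ℓ.toLinearMap)) (by congr!)
    exact S.exists_equivariant_of_glue Q hK hconv ℓ hε (fun x hx _ => hB x hx) hu₁ hu₂
  · push Not at h
    by_cases hne : ∃ b, b ∈ S.B.filter (· ∈ K)
    · obtain ⟨b, hb⟩ := hne
      have hbK := (Finset.mem_filter.1 hb).2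
      exact S.exists_equivariant_of_starConvex Q hbK (hconv hbK) fun x hx hxB =>
        h x (Finset.mem_filter.2 ⟨hxB, hx⟩) b hb
    · rcases K.eq_empty_or_nonempty with rfl | ⟨b, hb⟩
      · exact ⟨0, continuousOn_const, fun y hy => absurd hy (Set.notMem_empty _)⟩
      · exact S.exists_equivariant_of_starConvex Q hb (hconv hb) fun x hx hxB =>
          absurd ⟨x, Finset.mem_filter.2 ⟨hxB, hx⟩⟩ hne

end Sheeted
end HomSurf

end

section

open Filter Topology Polynomial

namespace HomSurf

/-- The translation by which logarithms are ambiguous. -/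
noncomputable abbrev period : ℂ := 2 * Real.pi * Complex.I

lemma exp_period : Complex.exp period = 1 := Complex.exp_two_pi_mul_I

lemma period_re : period.re = 0 := by simp [period]

lemma eq_of_exp_comp_eq {T : Type*} [TopologicalSpace T] {s : Set T} (hs : IsPreconnected s)
    {f : T → ℂ} (hf : ContinuousOn f s) {c : ℂ} (h : ∀ x ∈ s, Complex.exp (f x) = c) {a b : T}
    (ha : a ∈ s) (hb : b ∈ s) : f a = f b := by
  refine Complex.isCoveringMap_exp.constOn_of_comp hs hf (fun x hx y hy => ?_) ha hb
  exact Subtype.ext ((h x hx).trans (h y hy).symm)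

lemma isPreconnected_halfPlane (ρ : ℝ) : IsPreconnected {τ : ℂ | ρ < τ.re} :=
  (convex_halfSpace_re_gt ρ).isPreconnected

lemma isOpen_halfPlane (ρ : ℝ) : IsOpen {τ : ℂ | ρ < τ.re} :=
  isOpen_lt continuous_const Complex.continuous_re

lemma eq_of_exp_eq {α : Type*} {ρ : ℝ} {f : ℂ → α} (hf : ∀ τ : ℂ, ρ < τ.re → f (τ + period) = f τ)
    {τ τ' : ℂ} (hτ : ρ < τ.re) (h : Complex.exp τ = Complex.exp τ') : f τ' = f τ := by
  have key : ∀ (n : ℕ) (τ : ℂ), ρ < τ.re → f (τ + n * period) = f τ := by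
    intro n
    induction n with
    | zero => simp
    | succ n ih =>
      intro τ hτ
      have : (τ + n * period).re = τ.re := by simp [period]
      have e : τ + (n + 1 : ℕ) * period = τ + n * period + period := by push_cast; ring
      rw [e, hf _ (by rwa [this]), ih τ hτ]
  obtain ⟨n, hn⟩ := Complex.exp_eq_exp_iff_exists_int.1 h
  have hre : τ'.re = τ.re := by
    have := congrArg Complex.re hn
    simp at this
    exact this.symm
  rcases Int.eq_nat_or_neg n with ⟨m, rfl | rfl⟩
  · have := key m τ' (by rwa [hre])
    rw [← this, hn]
    simp [period]
  · have := key m τ hτ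
    rw [← this, hn]
    simp [period]

/-- Periodic functions on a half-plane descend along the exponential. -/
lemma continuousOn_comp_log {α : Type*} [TopologicalSpace α] {ρ : ℝ} {f : ℂ → α}
    (hc : ContinuousOn f {τ | ρ < τ.re})
    (hf : ∀ τ : ℂ, ρ < τ.re → f (τ + period) = f τ) :
    ContinuousOn (fun x => f (Complex.log x)) {x : ℂ | Real.exp ρ < ‖x‖} := by
  intro x₀ hx₀
  apply ContinuousAt.continuousWithinAt
  have hx₀' : Real.exp ρ < ‖x₀‖ := hx₀
  have hne : x₀ ≠ 0 := norm_pos_iff.1 ((Real.exp_pos ρ).trans hx₀)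
  have hre : ∀ x : ℂ, Real.exp ρ < ‖x‖ → ρ < (Complex.log x).re := fun x hx => by
    rw [Complex.log_re]
    exact (Real.lt_log_iff_exp_lt ((Real.exp_pos ρ).trans hx)).2 hx
  have h1 : ContinuousAt (fun x => f (Complex.log x₀ + Complex.log (x / x₀))) x₀ := by
    have hl : ContinuousAt (fun x => Complex.log x₀ + Complex.log (x / x₀)) x₀ := by
      refine continuousAt_const.add (ContinuousAt.clog (by fun_prop) ?_)
      rw [div_self hne]
      exact Complex.one_mem_slitPlane
    refine ContinuousAt.comp (f := fun x => Complex.log x₀ + Complex.log (x / x₀)) ?_ hl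
    refine hc.continuousAt ((isOpen_halfPlane ρ).mem_nhds ?_)
    simpa [div_self hne] using hre x₀ hx₀
  refine h1.congr ?_
  have h2 : ∀ᶠ x in 𝓝 x₀, Real.exp ρ < ‖x‖ :=
    continuousAt_const.eventually_lt continuous_norm.continuousAt hx₀'
  filter_upwards [h2] with x hx
  have hx0 : x ≠ 0 := norm_pos_iff.1 ((Real.exp_pos ρ).trans hx)
  refine eq_of_exp_eq hf (hre x hx) ?_
  rw [Complex.exp_add, Complex.exp_log hne, Complex.exp_log hx0,
    Complex.exp_log (div_ne_zero hx0 hne), mul_div_cancel₀ _ hne]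

namespace Sheeted
variable {d : ℕ} (S : Sheeted d)

lemma eq_prod_sheet {x y : ℂ} (h : (x, y) ∈ S.far) : S.F x y = ∏ i, (X - C (S.sheet i x y)) := by
  have hm : (∏ i, (X - C (S.sheet i x y))).Monic := monic_prod_of_monic _ _ fun i _ => monic_X_sub_C _
  refine eq_of_monic_of_dvd_of_natDegree_le hm (S.monic x y) ?_ ?_
  · refine Finset.prod_dvd_of_coprime ?_ fun i _ => dvd_iff_isRoot.2 (S.isRoot_sheet i h)
    exact (pairwise_coprime_X_sub_C (S.sheet_injective h)).set_pairwise _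
  · rw [S.natDegree_eq, natDegree_prod_of_monic _ _ fun i _ => monic_X_sub_C _]
    simp

lemma large_exp {τ : ℂ} (h : -Real.log S.δ < τ.re) : 1 < ‖Complex.exp τ‖ * S.δ := by
  rw [Complex.norm_exp]
  have := Real.exp_lt_exp.2 h
  rw [Real.exp_neg, Real.exp_log S.δ_pos] at this
  have h2 := mul_lt_mul_of_pos_right this S.δ_pos
  rwa [inv_mul_cancel₀ S.δ_pos.ne'] at h2

/-- The winding numbers of a nonvanishing function at the ends of the curve sum to zero. -/
theorem sum_winding_eq_zero {G : ℂ × ℂ → ℂ} (hG : ContinuousOn G S.curve)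
    (hG0 : ∀ q ∈ S.curve, G q ≠ 0) {ρ : ℝ} {Λ : Fin d → ℂ → ℂ}
    (hΛ : ∀ i, ContinuousOn (Λ i) {τ | ρ < τ.re})
    (hexp : ∀ i τ, ρ < τ.re → Complex.exp (Λ i τ) = G (S.endp i (Complex.exp τ)))
    {g : Fin d → ℂ} (hg : ∀ i τ, ρ < τ.re → Λ i (τ + period) = Λ i τ + period * g i) :
    ∑ i, g i = 0 := by
  obtain ⟨N, hN, hNG⟩ := exists_continuous_norm (G := fun x => S.F x 1) (fun x => S.monic x 1)
    (fun x => S.natDegree_eq x 1) S.continuous_coeff_one G hG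
  have hN0 : ∀ x, N x ≠ 0 := fun x => by
    obtain ⟨r, hr⟩ := exists_eq_prod (S.monic x 1) (S.natDegree_eq x 1)
    rw [hNG x r hr, Finset.prod_ne_zero_iff]
    intro i _
    refine hG0 _ ?_
    show (S.F x 1).IsRoot (r i)
    rw [hr, isRoot_prod_iff]
    exact ⟨i, rfl⟩
  obtain ⟨l, hl, hlN⟩ := exists_log_of_convex convex_univ hN.continuousOn fun x _ => hN0 x
  set R := max ρ (-Real.log S.δ)
  have hR : ∀ τ : ℂ, R < τ.re → ρ < τ.re ∧ -Real.log S.δ < τ.re := fun τ h => max_lt_iff.1 h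
  have hc : ContinuousOn (fun τ => ∑ i, Λ i τ - l (Complex.exp τ)) {τ | R < τ.re} := by
    refine ContinuousOn.sub ?_ ?_
    · exact continuousOn_finsetSum _ fun i _ => (hΛ i).mono fun τ h => (hR τ h).1
    · exact hl.comp Complex.continuous_exp.continuousOn fun _ _ => Set.mem_univ _
  have h1 : ∀ τ ∈ {τ : ℂ | R < τ.re}, Complex.exp (∑ i, Λ i τ - l (Complex.exp τ)) = 1 := by
    intro τ hτ
    have hτ := hR τ hτ
    rw [Complex.exp_sub, Complex.exp_sum, hlN _ (Set.mem_univ _),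
      hNG _ _ (S.eq_prod_sheet (S.far_one (S.large_exp hτ.2)))]
    rw [div_eq_one_iff_eq]
    · exact Finset.prod_congr rfl fun i _ => hexp i τ hτ.1
    · rw [Finset.prod_ne_zero_iff]
      exact fun i _ => hG0 _ (S.endp_mem i (S.large_exp hτ.2))
  have hτ₀ : R < ((R + 1 : ℝ) : ℂ).re := by rw [Complex.ofReal_re]; linarith
  have h2 := eq_of_exp_comp_eq (isPreconnected_halfPlane R) hc h1 (a := ((R + 1 : ℝ) : ℂ))
    (b := ((R + 1 : ℝ) : ℂ) + period) hτ₀ (by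
      show R < (_ : ℂ).re
      rw [Complex.add_re, period_re]; simp)
  simp only [Complex.exp_add, exp_period, mul_one, hg _ _ (hR _ hτ₀).1, Finset.sum_add_distrib,
    ← Finset.mul_sum] at h2
  have h3 : period * ∑ i, g i = 0 := by linear_combination -h2
  exact (mul_eq_zero.1 h3).resolve_left Complex.two_pi_I_ne_zero

end Sheeted
end HomSurf

end

section

open Filter Topology Polynomial

namespace HomSurf

/-- Redefining a continuous function on a sheet. -/
lemma continuousOn_patch {Z : Set (ℂ × ℂ)} {U C : Set ℂ} (hU : IsOpen U) (hC : IsClosed C)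
    (hCU : C ⊆ U) {s w : ℂ → ℂ} (hs : ContinuousOn s U) (hw : ContinuousOn w U)
    {h : ℂ × ℂ → ℂ} (hh : ContinuousOn h Z)
    (hsheet : ∀ x ∈ U, ∀ᶠ q in 𝓝[Z] (x, s x), q.2 = s q.1)
    (heq : ∀ x ∈ U, x ∉ C → w x = h (x, s x)) [∀ q : ℂ × ℂ, Decidable (q.1 ∈ U ∧ q.2 = s q.1)] :
    ContinuousOn (fun q : ℂ × ℂ => if q.1 ∈ U ∧ q.2 = s q.1 then w q.1 else h q) Z := by
  rintro ⟨x, z⟩ hq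
  by_cases hx : x ∈ U
  · have hev : ∀ᶠ q : ℂ × ℂ in 𝓝 (x, z), q.1 ∈ U :=
      continuousAt_fst.eventually (hU.mem_nhds hx)
    by_cases hz : z = s x
    · subst hz
      have hw' : ContinuousWithinAt (fun q : ℂ × ℂ => w q.1) Z (x, s x) :=
        (ContinuousAt.comp (f := fun q : ℂ × ℂ => q.1) (x := (x, s x))
          (hw.continuousAt (hU.mem_nhds hx)) continuousAt_fst).continuousWithinAt
      refine hw'.congr_of_eventuallyEq ?_ (by simp [hx])
      filter_upwards [nhdsWithin_le_nhds hev, hsheet x hx] with q h1 h2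
      rw [if_pos ⟨h1, h2⟩]
    · refine (hh _ hq).congr_of_eventuallyEq ?_ (by simp [hz])
      have hsc : ContinuousAt (fun q : ℂ × ℂ => q.2 - s q.1) (x, z) :=
        continuousAt_snd.sub (ContinuousAt.comp (f := fun q : ℂ × ℂ => q.1) (x := (x, z))
          (hs.continuousAt (hU.mem_nhds hx)) continuousAt_fst)
      filter_upwards [nhdsWithin_le_nhds (hsc.eventually_ne (sub_ne_zero.2 hz))] with q h1
      rw [if_neg fun h => h1 (sub_eq_zero.2 h.2)]
  · have hxC : x ∈ Cᶜ := fun h => hx (hCU h)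
    refine (hh _ hq).congr_of_eventuallyEq ?_ (by simp [hx])
    filter_upwards [nhdsWithin_le_nhds (continuousAt_fst.eventually (hC.isOpen_compl.mem_nhds hxC))]
      with q h1
    split_ifs with h2
    · rw [heq _ h2.1 h1, ← h2.2]
    · rfl

/-- Truncation of a real number to the unit interval. -/
noncomputable def clamp (t : ℝ) : ℝ := max 0 (min 1 t)

lemma continuous_clamp : Continuous clamp := by unfold clamp; fun_prop

lemma clamp_of_nonpos {t : ℝ} (h : t ≤ 0) : clamp t = 0 :=
  max_eq_left ((min_le_right _ _).trans h)

lemma clamp_of_one_le {t : ℝ} (h : 1 ≤ t) : clamp t = 1 := by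
  rw [clamp, min_eq_left h, max_eq_right zero_le_one]

lemma clamp_of_mem {t : ℝ} (h0 : 0 ≤ t) (h1 : t ≤ 1) : clamp t = t := by
  rw [clamp, min_eq_right h1, max_eq_right h0]

lemma clamp_nonneg (t : ℝ) : 0 ≤ clamp t := le_max_left _ _

lemma clamp_le_one (t : ℝ) : clamp t ≤ 1 := max_le zero_le_one (min_le_left _ _)

lemma zpow_sum {ι : Type*} {x : ℂ} (hx : x ≠ 0) (s : Finset ι) (a : ι → ℤ) :
    x ^ (∑ i ∈ s, a i) = ∏ i ∈ s, x ^ a i := by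
  classical
  induction s using Finset.induction_on with
  | empty => simp
  | insert i s hi ih => rw [Finset.sum_insert hi, Finset.prod_insert hi, zpow_add₀ hx, ih]

namespace Sheeted
variable {d : ℕ} (S : Sheeted d)

lemma eventually_large : ∀ᶠ x in Bornology.cobounded ℂ, 1 < ‖x‖ * S.δ := by
  filter_upwards [tendsto_norm_cobounded_atTop.eventually_gt_atTop (1 / S.δ)] with x hx
  rwa [div_lt_iff₀ S.δ_pos] at hx

/-- Redefining a function on one end. -/
lemma exists_patch_end (i : Fin d) {R : ℝ} {w : ℂ → ℂ} (hR : 1 < R * S.δ)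
    (hw : ContinuousOn w {x | 1 < ‖x‖ * S.δ}) (hw1 : ∀ x, ‖x‖ < R → w x = 1) :
    ∃ h : ℂ × ℂ → ℂ, ContinuousOn h S.curve ∧ (∀ x, 1 < ‖x‖ * S.δ → h (S.endp i x) = w x) ∧
      (∀ q, (¬ ∃ x, 1 < ‖x‖ * S.δ ∧ q = S.endp i x) → h q = 1) := by
  classical
  refine ⟨_, continuousOn_patch (Z := S.curve) (C := {x | R ≤ ‖x‖}) (s := fun x => S.sheet i x 1)
    S.isOpen_large (isClosed_le continuous_const continuous_norm) ?_ ?_ hw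
    (h := fun _ => 1) continuousOn_const ?_ ?_, ?_, ?_⟩
  · intro x hx
    exact hR.trans_le (mul_le_mul_of_nonneg_right hx S.δ_pos.le)
  · exact continuous_snd.comp_continuousOn (S.continuousOn_endp i)
  · intro x hx
    filter_upwards [S.eventually_endp (i := i) hx] with q hq
    exact congrArg Prod.snd hq
  · intro x _ hx
    exact hw1 x (not_le.1 hx)
  · intro x hx
    exact if_pos ⟨hx, rfl⟩
  · intro q hq
    refine if_neg fun h => hq ⟨q.1, h.1, Prod.ext rfl h.2⟩

lemma endp_ne {i j : Fin d} (hij : i ≠ j) {x : ℂ} (h : 1 < ‖x‖ * S.δ) :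
    ¬ ∃ x', 1 < ‖x'‖ * S.δ ∧ S.endp i x = S.endp j x' := by
  rintro ⟨x', -, e⟩
  have : x = x' := congrArg Prod.fst e
  subst this
  exact hij (S.endp_inj h e)

/-- `h` has a simple zero at `c` and a simple pole at the end `i`. -/
def HasDivisor (i : Fin d) (c : ℂ × ℂ) (h : ℂ × ℂ → ℂ) : Prop :=
  ContinuousOn h S.curve ∧ (∀ q ∈ S.curve, h q = 0 → q = c) ∧
    (∀ᶠ q in 𝓝[S.curve] c, h q = q.1 - c.1) ∧
    ∀ᶠ x in Bornology.cobounded ℂ, h (S.endp i x) = x ∧ ∀ k, k ≠ i → h (S.endp k x) = 1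

lemma exists_hasDivisor_base (i : Fin d) : ∃ c ∈ S.reg, ∃ h, S.HasDivisor i c h := by
  set R := 1 / S.δ + 1 with hRdef
  have hR : 1 < R * S.δ := by
    rw [hRdef, add_mul, div_mul_cancel₀ _ S.δ_pos.ne']
    linarith [S.δ_pos]
  have hR0 : 1 < R := by have := S.δ_pos; have : 0 < 1 / S.δ := by positivity
                         linarith
  let α : ℝ → ℝ := fun r => clamp (r - R)
  let β : ℝ → ℝ := fun r => (1 + (R + 1) * clamp (r - R)) * clamp (R + 4 - r)
  let w : ℂ → ℂ := fun x => α ‖x‖ * x + β ‖x‖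
  have hwc : Continuous w := by
    have := continuous_clamp
    simp only [w, α, β]
    fun_prop
  have hw0 : ∀ x, w x = 0 → x = -((R + 2 : ℝ) : ℂ) := by
    intro x hx
    have hx1 : (α ‖x‖ : ℂ) * x = -(β ‖x‖ : ℂ) := by linear_combination hx
    have hα : 0 ≤ α ‖x‖ := clamp_nonneg _
    have hβ : 0 ≤ β ‖x‖ := by
      have := clamp_nonneg (‖x‖ - R)
      have := clamp_nonneg (R + 4 - ‖x‖)
      simp only [β]
      positivity
    have hx2 : α ‖x‖ * ‖x‖ = β ‖x‖ := by
      have := congrArg norm hx1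
      rwa [norm_mul, norm_neg, Complex.norm_real, Complex.norm_real, Real.norm_of_nonneg hα,
        Real.norm_of_nonneg hβ] at this
    have hr : ‖x‖ = R + 2 ∧ α ‖x‖ = 1 := by
      generalize ‖x‖ = r at *
      simp only [α, β] at *
      rcases le_total r R with h1 | h1
      · rw [clamp_of_nonpos (by linarith), clamp_of_one_le (t := R + 4 - r) (by linarith)] at hx2
        linarith
      rcases le_total r (R + 1) with h2 | h2
      · rw [clamp_of_mem (by linarith) (by linarith),
          clamp_of_one_le (t := R + 4 - r) (by linarith)] at hx2
        nlinarith
      rw [clamp_of_one_le (t := r - R) (by linarith)] at hx2 ⊢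
      rcases le_total r (R + 3) with h3 | h3
      · rw [clamp_of_one_le (by linarith)] at hx2
        exact ⟨by linarith, rfl⟩
      · have := clamp_le_one (R + 4 - r)
        nlinarith
    rw [hr.2, hr.1] at hx1
    have hβ1 : β (R + 2) = R + 2 := by rw [hr.2, hr.1] at hx2; linarith
    rw [hβ1] at hx1
    simpa using hx1
  have hwmid : ∀ x : ℂ, R + 1 ≤ ‖x‖ → ‖x‖ ≤ R + 3 → w x = x - -((R + 2 : ℝ) : ℂ) := by
    intro x h1 h2
    simp only [w, α, β]
    rw [clamp_of_one_le (by linarith), clamp_of_one_le (by linarith)]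
    push_cast
    ring
  obtain ⟨h, hc, he, ho⟩ := S.exists_patch_end i hR hwc.continuousOn (w := w) (fun x hx => by
    simp only [w, α, β]
    rw [clamp_of_nonpos (by linarith), clamp_of_one_le (by linarith)]
    simp)
  set c : ℂ := -((R + 2 : ℝ) : ℂ) with hcdef
  have hcn : ‖c‖ = R + 2 := by
    rw [hcdef, norm_neg, Complex.norm_real, Real.norm_of_nonneg (by linarith)]
  have hcl : 1 < ‖c‖ * S.δ := by rw [hcn]; nlinarith [S.δ_pos]
  refine ⟨S.endp i c, S.endp_mem_reg i hcl, h, hc, ?_, ?_, ?_⟩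
  · intro q hq hq0
    by_cases hx : ∃ x, 1 < ‖x‖ * S.δ ∧ q = S.endp i x
    · obtain ⟨x, hx, rfl⟩ := hx
      rw [he x hx] at hq0
      rw [hw0 x hq0]
    · rw [ho q hx] at hq0
      exact absurd hq0 one_ne_zero
  · have h1 : ContinuousAt (fun q : ℂ × ℂ => ‖q.1‖) (S.endp i c) := by fun_prop
    have h2 := h1.eventually (Ioo_mem_nhds (a := R + 1) (b := R + 3)
      (by simp only [endp_fst, hcn]; linarith) (by simp only [endp_fst, hcn]; linarith))
    filter_upwards [S.eventually_endp hcl, nhdsWithin_le_nhds h2] with q hq hq2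
    rw [hq, he _ (by nlinarith [S.δ_pos, hq2.1]), hwmid _ hq2.1.le hq2.2.le]
    rfl
  · filter_upwards [S.eventually_large, tendsto_norm_cobounded_atTop.eventually_gt_atTop (R + 4)]
      with x hx hx2
    refine ⟨?_, fun k hk => ho _ (S.endp_ne hk hx)⟩
    rw [he x hx]
    simp only [w, α, β]
    rw [clamp_of_one_le (by linarith), clamp_of_nonpos (by linarith)]
    simp

lemma exists_sheet_reg {c : ℂ × ℂ} (hc : c ∈ S.reg) : ∃ r > 0, ∃ s : ℂ → ℂ,
    ContinuousOn s (Metric.ball c.1 r) ∧ (∀ x ∈ Metric.ball c.1 r, (x, s x) ∈ S.curve) ∧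
    s c.1 = c.2 ∧ ∀ x ∈ Metric.ball c.1 r, ∀ᶠ q in 𝓝[S.curve] (x, s x), q.2 = s q.1 := by
  obtain ⟨V, hV, hcV, ρ, hρ, hρc, hρi⟩ := exists_local_splitting (fun x => S.monic x 1)
    (fun x => S.natDegree_eq x 1) S.continuous_coeff_one c.1 (S.separable _ hc.1)
  obtain ⟨r, hr, hrV⟩ := Metric.isOpen_iff.1 hV _ hcV
  have hroot : ∀ q : ℂ × ℂ, q ∈ S.curve ↔ ∃ i, q.2 = ρ q.1 i := fun q => by
    show (S.F q.1 1).IsRoot q.2 ↔ _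
    rw [hρ, isRoot_prod_iff]
  obtain ⟨i, hi⟩ := (hroot c).1 hc.2
  have hcont : ∀ j, ContinuousOn (fun x => ρ x j) (Metric.ball c.1 r) := fun j =>
    (continuousOn_pi.1 hρc j).mono hrV
  refine ⟨r, hr, fun x => ρ x i, hcont i, fun x _ => (hroot _).2 ⟨i, rfl⟩, hi.symm, fun x hx => ?_⟩
  have hne : ∀ᶠ q : ℂ × ℂ in 𝓝 (x, ρ x i), ∀ j, j ≠ i → q.2 - ρ q.1 j ≠ 0 := by
    simp only [Filter.eventually_all]
    intro j hj
    have h1 : ContinuousAt (fun q : ℂ × ℂ => q.2 - ρ q.1 j) (x, ρ x i) :=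
      continuousAt_snd.sub (ContinuousAt.comp (f := fun q : ℂ × ℂ => q.1) (x := (x, ρ x i))
        ((hcont j).continuousAt (Metric.isOpen_ball.mem_nhds hx)) continuousAt_fst)
    exact h1.eventually_ne (sub_ne_zero.2 fun e => hj (hρi x (hrV hx) e).symm)
  filter_upwards [nhdsWithin_le_nhds hne, self_mem_nhdsWithin] with q h1 h2
  obtain ⟨j, hj⟩ := (hroot q).1 h2
  by_cases hji : j = i
  · rw [hj, hji]
  · exact absurd (sub_eq_zero.2 hj) (h1 j hji)

lemma hasDivisor_move {i : Fin d} {x₀ : ℂ} {r : ℝ} (hr : 0 < r) {s : ℂ → ℂ}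
    (hs : ContinuousOn s (Metric.ball x₀ r)) (hsc : ∀ x ∈ Metric.ball x₀ r, (x, s x) ∈ S.curve)
    (hsheet : ∀ x ∈ Metric.ball x₀ r, ∀ᶠ q in 𝓝[S.curve] (x, s x), q.2 = s q.1)
    {a b : ℂ} (ha : a ∈ Metric.ball x₀ (r / 4)) (hb : b ∈ Metric.ball x₀ (r / 4))
    (H : ∃ h, S.HasDivisor i (a, s a) h) : ∃ h, S.HasDivisor i (b, s b) h := by
  classical
  obtain ⟨h, hc, h0, hloc, hend⟩ := H
  have hsub : Metric.ball x₀ (r / 4) ⊆ Metric.ball x₀ r := Metric.ball_subset_ball (by linarith)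
  have hsx : ContinuousOn (fun x => (x, s x)) (Metric.ball x₀ r) := continuousOn_id.prodMk hs
  have hhs : ContinuousOn (fun x => h (x, s x)) (Metric.ball x₀ r) :=
    hc.comp hsx fun x hx => hsc x hx
  let g : ℂ → ℂ := fun x => if x = a then 1 else h (x, s x) / (x - a)
  have hg0 : ∀ x ∈ Metric.ball x₀ r, g x ≠ 0 := by
    intro x hx
    simp only [g]
    split_ifs with hxa
    · exact one_ne_zero
    · exact div_ne_zero (fun e => hxa (congrArg Prod.fst (h0 _ (hsc x hx) e))) (sub_ne_zero.2 hxa)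
  have hgc : ContinuousOn g (Metric.ball x₀ r) := by
    intro x hx
    apply ContinuousAt.continuousWithinAt
    have hnb := Metric.isOpen_ball.mem_nhds hx
    by_cases hxa : x = a
    · subst hxa
      have h1 : Tendsto (fun x => (x, s x)) (𝓝 x) (𝓝[S.curve] (x, s x)) := by
        rw [tendsto_nhdsWithin_iff]
        refine ⟨hsx.continuousAt hnb, ?_⟩
        filter_upwards [hnb] with x' hx'
        exact hsc x' hx'
      refine (continuousAt_const (y := (1 : ℂ))).congr ?_
      filter_upwards [h1.eventually hloc] with x' hx'
      simp only [g]
      split_ifs with e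
      · rfl
      · rw [hx', div_self (sub_ne_zero.2 e)]
    · have h1 : ContinuousAt (fun x => h (x, s x) / (x - a)) x :=
        (hhs.continuousAt hnb).div (by fun_prop) (sub_ne_zero.2 hxa)
      refine h1.congr ?_
      filter_upwards [isOpen_ne.mem_nhds hxa] with x' hx'
      exact (if_neg hx').symm
  obtain ⟨l, hl, hlg⟩ := exists_log_of_convex (convex_ball x₀ r) hgc hg0
  have hhl : ∀ x ∈ Metric.ball x₀ r, h (x, s x) = (x - a) * Complex.exp (l x) := by
    intro x hx
    rw [hlg x hx]
    simp only [g]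
    split_ifs with hxa
    · subst hxa
      have : h (x, s x) = (x, s x).1 - (x, s x).1 := hloc.self_of_nhdsWithin (hsc x hx)
      rw [this]; simp
    · rw [mul_div_cancel₀ _ (sub_ne_zero.2 hxa)]
  let χ : ℂ → ℝ := fun x => clamp (3 - 4 * ‖x - x₀‖ / r)
  have hχc : Continuous χ := by
    have := continuous_clamp
    simp only [χ]
    fun_prop
  have hχ1 : ∀ x, ‖x - x₀‖ ≤ r / 2 → χ x = 1 := fun x hx => clamp_of_one_le (by
    have : 4 * ‖x - x₀‖ / r ≤ 2 := by rw [div_le_iff₀ hr]; linarith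
    linarith)
  have hχ0 : ∀ x, 3 * r / 4 ≤ ‖x - x₀‖ → χ x = 0 := fun x hx => clamp_of_nonpos (by
    have : 3 ≤ 4 * ‖x - x₀‖ / r := by rw [le_div_iff₀ hr]; linarith
    linarith)
  let w : ℂ → ℂ := fun x => (x - a - χ x * (b - a)) * Complex.exp ((1 - χ x) * l x)
  have hwc : ContinuousOn w (Metric.ball x₀ r) := by
    refine ContinuousOn.mul (by fun_prop) (Complex.continuous_exp.comp_continuousOn ?_)
    exact ContinuousOn.mul (by fun_prop) hl
  have hw1 : ∀ x, ‖x - x₀‖ ≤ r / 2 → w x = x - b := fun x hx => by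
    simp [w, hχ1 x hx]
  have hw0 : ∀ x, w x = 0 → x = b := by
    intro x hx
    have e : x - a - χ x * (b - a) = 0 := (mul_eq_zero.1 hx).resolve_right (Complex.exp_ne_zero _)
    have hxball : x ∈ Metric.ball x₀ (r / 4) := by
      have hxe : x = (1 - χ x) • a + χ x • b := by
        simp only [Complex.real_smul]
        push_cast
        linear_combination e
      rw [hxe]
      exact (convex_ball x₀ (r / 4)) ha hb (sub_nonneg.2 (clamp_le_one _)) (clamp_nonneg _) (by ring)
    rw [mem_ball_iff_norm] at hxball
    rw [hχ1 x (by linarith)] at e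
    push_cast at e
    linear_combination e
  refine ⟨_, continuousOn_patch (C := Metric.closedBall x₀ (3 * r / 4)) Metric.isOpen_ball
    Metric.isClosed_closedBall (Metric.closedBall_subset_ball (by linarith)) hs hwc hc hsheet ?_,
    ?_, ?_, ?_⟩
  · intro x hx hxC
    rw [mem_closedBall_iff_norm, not_le] at hxC
    simp [w, hχ0 x hxC.le, hhl x hx]
  · intro q hq hq0
    split_ifs at hq0 with h1
    · have e := hw0 _ hq0
      exact Prod.ext e (h1.2.trans (congrArg s e))
    · have e := h0 q hq hq0
      refine absurd ⟨?_, ?_⟩ h1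
      · rw [e]; exact hsub ha
      · rw [e]
  · have h1 : ∀ᶠ q : ℂ × ℂ in 𝓝 (b, s b), q.1 ∈ Metric.ball x₀ (r / 4) :=
      continuousAt_fst.eventually (Metric.isOpen_ball.mem_nhds hb)
    filter_upwards [hsheet b (hsub hb), nhdsWithin_le_nhds h1] with q hq hq1
    rw [if_pos ⟨hsub hq1, hq⟩]
    rw [mem_ball_iff_norm] at hq1
    exact hw1 _ (by linarith)
  · filter_upwards [hend, tendsto_norm_cobounded_atTop.eventually_gt_atTop (‖x₀‖ + r)] with x h1 h2
    have hx : x ∉ Metric.ball x₀ r := fun hx => by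
      rw [mem_ball_iff_norm] at hx
      have := norm_sub_norm_le x x₀
      linarith
    have e : ∀ k, ¬ ((S.endp k x).1 ∈ Metric.ball x₀ r ∧ (S.endp k x).2 = s (S.endp k x).1) :=
      fun k hk => hx hk.1
    simp only [if_neg (e _)]
    exact h1

lemma exists_hasDivisor (i : Fin d) {c : ℂ × ℂ} (hc : c ∈ S.reg) : ∃ h, S.HasDivisor i c h := by
  obtain ⟨c₀, hc₀, H⟩ := S.exists_hasDivisor_base i
  refine (IsPreconnected.induction₂ (s := S.reg) S.preconnected
    (fun c c' => (∃ h, S.HasDivisor i c h) ↔ ∃ h, S.HasDivisor i c' h) (fun c hc => ?_)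
    (fun _ _ _ _ _ _ h1 h2 => h1.trans h2) (fun _ _ _ _ h => h.symm) hc₀ hc).1 H
  obtain ⟨r, hr, s, hs, hsc, hs0, hsheet⟩ := S.exists_sheet_reg hc
  have h1 : ∀ᶠ q : ℂ × ℂ in 𝓝 c, q.1 ∈ Metric.ball c.1 (r / 4) :=
    continuousAt_fst.eventually (Metric.ball_mem_nhds _ (by linarith))
  have h2 := hsheet c.1 (Metric.mem_ball_self hr)
  rw [hs0] at h2
  have h3 : ∀ᶠ q in 𝓝[S.reg] c, q.2 = s q.1 := nhdsWithin_mono _ S.reg_subset_curve h2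
  have ec : c = (c.1, s c.1) := Prod.ext rfl hs0.symm
  filter_upwards [nhdsWithin_le_nhds h1, h3] with q hq1 hq2
  have eq : q = (q.1, s q.1) := Prod.ext rfl hq2
  have hcb : c.1 ∈ Metric.ball c.1 (r / 4) := Metric.mem_ball_self (by linarith)
  constructor
  · intro H
    rw [eq]
    refine S.hasDivisor_move hr hs hsc hsheet hcb hq1 ?_
    rwa [← ec]
  · intro H
    rw [ec]
    refine S.hasDivisor_move hr hs hsc hsheet hq1 hcb ?_
    rwa [← eq]

/-- A nonvanishing function on the curve winding once around the end `i` and minus once around `j`. -/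
lemma exists_ratio {i j : Fin d} (hij : i ≠ j) : ∃ h : ℂ × ℂ → ℂ, ContinuousOn h S.curve ∧
    (∀ q ∈ S.curve, h q ≠ 0) ∧ ∀ᶠ x in Bornology.cobounded ℂ,
      h (S.endp i x) = x ∧ h (S.endp j x) = x⁻¹ ∧ ∀ k, k ≠ i → k ≠ j → h (S.endp k x) = 1 := by
  classical
  obtain ⟨c, hc, -⟩ := S.exists_hasDivisor_base i
  obtain ⟨h₁, hc₁, hz₁, hl₁, he₁⟩ := S.exists_hasDivisor i hc
  obtain ⟨h₂, hc₂, hz₂, hl₂, he₂⟩ := S.exists_hasDivisor j hc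
  have hcc := S.reg_subset_curve hc
  refine ⟨fun q => if h₁ q = h₂ q then 1 else h₁ q / h₂ q, fun q hq => ?_, fun q hq => ?_, ?_⟩
  · by_cases hqc : q = c
    · subst hqc
      refine (continuousWithinAt_const (b := (1 : ℂ))).congr_of_eventuallyEq ?_ ?_
      · filter_upwards [hl₁, hl₂] with q e1 e2
        rw [if_pos (e1.trans e2.symm)]
      · rw [if_pos ((hl₁.self_of_nhdsWithin hcc).trans (hl₂.self_of_nhdsWithin hcc).symm)]
    · have hne : h₂ q ≠ 0 := fun e => hqc (hz₂ q hq e)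
      have hd := (hc₁ q hq).div (hc₂ q hq) hne
      refine hd.congr_of_eventuallyEq ?_ ?_
      · filter_upwards [(hc₂ q hq).eventually_ne hne] with q' hq'
        split_ifs with e
        · rw [Pi.div_apply, e, div_self hq']
        · rfl
      · split_ifs with e
        · rw [Pi.div_apply, e, div_self hne]
        · rfl
  · beta_reduce
    split_ifs with e
    · exact one_ne_zero
    · have hqc : q ≠ c := by
        rintro rfl
        exact e ((hl₁.self_of_nhdsWithin hcc).trans (hl₂.self_of_nhdsWithin hcc).symm)
      exact div_ne_zero (fun e => hqc (hz₁ q hq e)) (fun e => hqc (hz₂ q hq e))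
  · filter_upwards [he₁, he₂, tendsto_norm_cobounded_atTop.eventually_gt_atTop 1] with x e1 e2 hx
    have hx0 : x ≠ 0 := norm_pos_iff.1 (by linarith)
    have hx1 : x ≠ 1 := by rintro rfl; simp at hx
    refine ⟨?_, ?_, fun k hk1 hk2 => ?_⟩
    · rw [e1.1, e2.2 i hij, if_neg hx1, div_one]
    · rw [e2.1, e1.2 j hij.symm, if_neg (Ne.symm hx1), one_div]
    · rw [e1.2 k hk1, e2.2 k hk2, if_pos rfl]

lemma exists_winding (a : Fin d → ℤ) (ha : ∑ i, a i = 0) : ∃ h : ℂ × ℂ → ℂ,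
    ContinuousOn h S.curve ∧ (∀ q ∈ S.curve, h q ≠ 0) ∧
    ∀ᶠ x in Bornology.cobounded ℂ, ∀ i, h (S.endp i x) = x ^ a i := by
  classical
  let o : Fin d := ⟨0, S.pos⟩
  have key : ∀ i : Fin d, ∃ h : ℂ × ℂ → ℂ, ContinuousOn h S.curve ∧
      (∀ q ∈ S.curve, h q ≠ 0) ∧ (i ≠ o → ∀ᶠ x in Bornology.cobounded ℂ,
      h (S.endp i x) = x ∧ h (S.endp o x) = x⁻¹ ∧ ∀ k, k ≠ i → k ≠ o → h (S.endp k x) = 1) := by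
    intro i
    by_cases hi : i = o
    · exact ⟨fun _ => 1, continuousOn_const, fun _ _ => one_ne_zero, fun h => absurd hi h⟩
    · obtain ⟨h, h1, h2, h3⟩ := S.exists_ratio hi
      exact ⟨h, h1, h2, fun _ => h3⟩
  choose H hc hn he using key
  refine ⟨fun q => ∏ i ∈ Finset.univ.erase o, H i q ^ a i, ?_, ?_, ?_⟩
  · exact continuousOn_finsetProd _ fun i _ => (hc i).zpow₀ _ fun q hq => Or.inl (hn i q hq)
  · exact fun q hq => Finset.prod_ne_zero_iff.2 fun i _ => zpow_ne_zero _ (hn i q hq)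
  · have hall : ∀ᶠ x in Bornology.cobounded ℂ, ∀ i, i ≠ o → H i (S.endp i x) = x ∧
        H i (S.endp o x) = x⁻¹ ∧ ∀ k, k ≠ i → k ≠ o → H i (S.endp k x) = 1 := by
      simp only [Filter.eventually_all]
      exact he
    filter_upwards [hall, tendsto_norm_cobounded_atTop.eventually_gt_atTop 0] with x hx hx0 k
    have hx0 : x ≠ 0 := norm_pos_iff.1 hx0
    by_cases hk : k = o
    · have hs : ∑ i ∈ Finset.univ.erase o, -a i = a o := by
        rw [← Finset.sum_erase_add _ _ (Finset.mem_univ o)] at ha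
        rw [Finset.sum_neg_distrib]
        linarith
      rw [hk, ← hs, zpow_sum hx0]
      refine Finset.prod_congr rfl fun i hi => ?_
      rw [(hx i (Finset.ne_of_mem_erase hi)).2.1, inv_zpow, zpow_neg]
    · rw [Finset.prod_eq_single_of_mem k (Finset.mem_erase.2 ⟨hk, Finset.mem_univ _⟩)]
      · rw [(hx k hk).1]
      · intro i hi hik
        rw [(hx i (Finset.ne_of_mem_erase hi)).2.2 k (Ne.symm hik) hk, one_zpow]

lemma exists_end_correction (i : Fin d) {R : ℝ} {E : ℂ → ℂ} (hE : ContinuousOn E {x | R < ‖x‖}) :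
    ∃ h : ℂ × ℂ → ℂ, ContinuousOn h S.curve ∧ (∀ q ∈ S.curve, h q ≠ 0) ∧
    ∀ᶠ x in Bornology.cobounded ℂ, h (S.endp i x) = Complex.exp (E x) ∧
      ∀ k, k ≠ i → h (S.endp k x) = 1 := by
  classical
  set R₁ := max (1 / S.δ) R + 1 with hR₁
  have hR₁δ : 1 < R₁ * S.δ := by
    rw [← div_lt_iff₀ S.δ_pos]
    linarith [le_max_left (1 / S.δ) R]
  have hR₁R : R < R₁ := by linarith [le_max_right (1 / S.δ) R]
  let w : ℂ → ℂ := fun x => if ‖x‖ ≤ R₁ then 1 else Complex.exp (clamp (‖x‖ - R₁) * E x)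
  have hww : ∀ x, w x = Complex.exp (clamp (‖x‖ - R₁) * E x) := by
    intro x
    simp only [w]
    split_ifs with h
    · rw [clamp_of_nonpos (by linarith)]; simp
    · rfl
  have hwc : Continuous w := by
    rw [continuous_iff_continuousAt]
    intro x
    rcases lt_or_ge ‖x‖ R₁ with hx | hx
    · refine (continuousAt_const (y := (1 : ℂ))).congr ?_
      filter_upwards [continuous_norm.continuousAt.eventually_lt continuousAt_const hx] with x' hx'
      exact (if_pos (le_of_lt hx')).symm
    · have : w = fun x => Complex.exp (clamp (‖x‖ - R₁) * E x) := funext hww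
      rw [this]
      have hcl := continuous_clamp
      refine ContinuousAt.cexp (ContinuousAt.mul (Continuous.continuousAt (by fun_prop)) ?_)
      exact hE.continuousAt ((isOpen_lt continuous_const continuous_norm).mem_nhds
        (hR₁R.trans_le hx))
  obtain ⟨h, hc, he, ho⟩ := S.exists_patch_end i hR₁δ hwc.continuousOn (fun x hx => if_pos hx.le)
  refine ⟨h, hc, fun q hq => ?_, ?_⟩
  · by_cases hx : ∃ x, 1 < ‖x‖ * S.δ ∧ q = S.endp i x
    · obtain ⟨x, hx, rfl⟩ := hx
      rw [he x hx, hww]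
      exact Complex.exp_ne_zero _
    · rw [ho q hx]; exact one_ne_zero
  · filter_upwards [S.eventually_large, tendsto_norm_cobounded_atTop.eventually_gt_atTop (R₁ + 1)]
      with x hx hx2
    refine ⟨?_, fun k hk => ho _ (S.endp_ne hk hx)⟩
    rw [he x hx, hww, clamp_of_one_le (by linarith)]
    simp

/-- Nonvanishing functions on the curve with prescribed behaviour at the ends. -/
theorem exists_prescribed_ends {ρ : ℝ} {N : Fin d → ℂ → ℂ}
    (hN : ∀ i, ContinuousOn (N i) {τ | ρ < τ.re}) {a : Fin d → ℤ} (ha : ∑ i, a i = 0)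
    (hNa : ∀ i τ, ρ < τ.re → N i (τ + period) = N i τ + period * a i) :
    ∃ h : ℂ × ℂ → ℂ, ContinuousOn h S.curve ∧ (∀ q ∈ S.curve, h q ≠ 0) ∧
      ∃ ρ' : ℝ, ∀ i τ, ρ' < τ.re → h (S.endp i (Complex.exp τ)) = Complex.exp (N i τ) := by
  classical
  obtain ⟨h₀, hc₀, hn₀, he₀⟩ := S.exists_winding a ha
  have hper : ∀ i (τ : ℂ), ρ < τ.re → N i (τ + period) - a i * (τ + period) = N i τ - a i * τ :=
    fun i τ hτ => by rw [hNa i τ hτ]; ring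
  have key : ∀ i, ∃ h : ℂ × ℂ → ℂ, ContinuousOn h S.curve ∧ (∀ q ∈ S.curve, h q ≠ 0) ∧
      ∀ᶠ x in Bornology.cobounded ℂ, h (S.endp i x) =
        Complex.exp (N i (Complex.log x) - a i * Complex.log x) ∧
      ∀ k, k ≠ i → h (S.endp k x) = 1 := fun i =>
    S.exists_end_correction i (continuousOn_comp_log (f := fun τ => N i τ - a i * τ)
      ((hN i).sub (by fun_prop)) (hper i))
  choose H hc hn he using key
  refine ⟨fun q => h₀ q * ∏ i, H i q, ?_, ?_, ?_⟩
  · exact hc₀.mul (continuousOn_finsetProd _ fun i _ => hc i)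
  · exact fun q hq => mul_ne_zero (hn₀ q hq) (Finset.prod_ne_zero_iff.2 fun i _ => hn i q hq)
  · have hall : ∀ᶠ x in Bornology.cobounded ℂ, ∀ i, H i (S.endp i x) =
        Complex.exp (N i (Complex.log x) - a i * Complex.log x) ∧
        ∀ k, k ≠ i → H i (S.endp k x) = 1 := by
      simp only [Filter.eventually_all]
      exact he
    obtain ⟨R, -, hR⟩ := (Filter.hasBasis_cobounded_norm (E := ℂ)).mem_iff.1 (he₀.and hall)
    refine ⟨max ρ (Real.log (max R 1)), fun i τ hτ => ?_⟩
    have hτ1 : ρ < τ.re := (le_max_left _ _).trans_lt hτ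
    have hτ2 : R ≤ ‖Complex.exp τ‖ := by
      rw [Complex.norm_exp]
      have := (Real.lt_log_iff_exp_lt (Real.exp_pos τ.re) (x := Real.log (max R 1))).1 (by
        rw [Real.log_exp]; exact (le_max_right _ _).trans_lt hτ)
      rw [Real.exp_log (lt_max_of_lt_right one_pos)] at this
      exact (le_max_left _ _).trans this.le
    obtain ⟨h1, h2⟩ := hR hτ2
    simp only
    rw [Finset.prod_eq_single i (fun j _ hj => (h2 j).2 i hj.symm) (by simp), h1 i, (h2 i).1,
      eq_of_exp_eq (f := fun τ => N i τ - a i * τ) (hper i) hτ1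
        (Complex.exp_log (Complex.exp_ne_zero τ)).symm, ← Complex.exp_int_mul, ← Complex.exp_add]
    ring_nf

end Sheeted
end HomSurf

end

section

open Filter Topology Polynomial

namespace HomSurf

namespace CyclicCover
variable {n : ℕ} {X Y : Type} [TopologicalSpace X] [TopologicalSpace Y] (Q : CyclicCover n X Y)

lemma iterate_eq_of_pow_eq {j k : ℕ} (h : unityRoot n ^ j = unityRoot n ^ k) (y : Y) :
    Q.σ^[j] y = Q.σ^[k] y := by
  wlog hjk : j ≤ k generalizing j k
  · exact (this h.symm (le_of_not_ge hjk)).symm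
  obtain ⟨m, rfl⟩ := Nat.exists_eq_add_of_le hjk
  rw [pow_add] at h
  have h1 : unityRoot n ^ m = 1 := by
    have := mul_left_cancel₀ (pow_ne_zero j (unityRoot_ne_zero n)) ((mul_one _).trans h)
    exact this.symm
  rw [(isPrimitiveRoot_unityRoot Q.pos).pow_eq_one_iff_dvd] at h1
  rw [Function.iterate_add_apply, (Q.iterate_eq_iff m y).2 h1]

lemma apply_iterate {u : Y → ℂ} {c : ℂ} {A : Set X} (hu : ∀ y, Q.p y ∈ A → u (Q.σ y) = c * u y)
    (k : ℕ) {y : Y} (hy : Q.p y ∈ A) : u (Q.σ^[k] y) = c ^ k * u y := by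
  induction k with
  | zero => simp
  | succ k ih =>
    rw [Function.iterate_succ_apply', hu _ (by rwa [Q.p_iterate]), ih, pow_succ']
    ring

end CyclicCover

namespace Sheeted
variable {d : ℕ} (S : Sheeted d)

/-- The scaling action on the cone. -/
noncomputable def scale (τ : ℂ) (p : S.cone) : S.cone :=
  ⟨(Complex.exp τ * p.1.1, Complex.exp τ * p.1.2.1, Complex.exp τ * p.1.2.2),
    by simpa using p.2.1, S.homog (Complex.exp_ne_zero τ) p.2.2⟩

lemma continuous_scale : Continuous fun q : S.cone × ℂ => S.scale q.2 q.1 := by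
  unfold scale
  exact Continuous.subtype_mk (by fun_prop) _

@[simp] lemma scale_snd (τ : ℂ) (p : S.cone) : (S.scale τ p).1.2.1 = Complex.exp τ * p.1.2.1 := rfl

lemma scale_congr {τ τ' : ℂ} (h : Complex.exp τ = Complex.exp τ') (p : S.cone) :
    S.scale τ p = S.scale τ' p := by
  simp only [scale, h]

lemma scale_zero (p : S.cone) : S.scale 0 p = p := by
  apply Subtype.ext
  simp [scale]

lemma scale_scale (τ τ' : ℂ) (p : S.cone) : S.scale τ' (S.scale τ p) = S.scale (τ + τ') p := by
  apply Subtype.ext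
  simp only [scale, Complex.exp_add, Prod.mk.injEq]
  refine ⟨by ring, by ring, by ring⟩

/-- The slice `y = 1` of the cone. -/
def slice : Set S.cone := {p | p.1.2.1 = 1}

/-- The embedding of the curve into the cone. -/
def embed (q : S.curve) : S.cone := ⟨(q.1.1, 1, q.1.2), Or.inr one_ne_zero, q.2⟩

lemma continuous_embed : Continuous S.embed := Continuous.subtype_mk (by fun_prop) _

lemma embed_mem_slice (q : S.curve) : S.embed q ∈ S.slice := rfl

/-- The projection of the slice to the curve. -/
def flat (p : S.cone) (hp : p ∈ S.slice) : S.curve :=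
  ⟨(p.1.1, p.1.2.2), by
    have h := p.2.2
    rw [show p.1.2.1 = 1 from hp] at h
    exact h⟩

lemma embed_flat {p : S.cone} (hp : p ∈ S.slice) : S.embed (S.flat p hp) = p :=
  Subtype.ext (Prod.ext rfl (Prod.ext (show p.1.2.1 = 1 from hp).symm rfl))

/-- The slice is homeomorphic to the curve. -/
def sliceHomeo : S.slice ≃ₜ S.curve where
  toFun p := S.flat p.1 p.2
  invFun q := ⟨S.embed q, S.embed_mem_slice q⟩
  left_inv p := Subtype.ext (S.embed_flat p.2)
  right_inv _ := rfl
  continuous_toFun := by unfold flat; exact Continuous.subtype_mk (by fun_prop) _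
  continuous_invFun := S.continuous_embed.subtype_mk _

lemma dense_ne_zero : Dense {p : S.cone | p.1.2.1 ≠ 0} := by
  rintro ⟨⟨x, y, z⟩, hp⟩
  by_cases hy : y = 0
  · subst hy
    have hx : x ≠ 0 := by simpa using hp.1
    have hfar : (x, (0 : ℂ)) ∈ S.far := ⟨hx, by simpa using S.δ_pos⟩
    obtain ⟨i, hi⟩ := S.exists_sheet hfar hp.2
    have h1 : ContinuousAt (fun s : ℂ => (x, s, S.sheet i x s)) 0 := by
      refine continuousAt_const.prodMk (continuousAt_id.prodMk ?_)
      exact ContinuousAt.comp (f := fun s : ℂ => (x, s)) (x := (0 : ℂ))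
        ((S.continuousOn_sheet i).continuousAt (S.isOpen_far.mem_nhds hfar)) (by fun_prop)
    have h2 : ∀ᶠ s : ℂ in 𝓝 0, (x, s) ∈ S.far :=
      (show ContinuousAt (fun s : ℂ => (x, s)) 0 by fun_prop).eventually
        (S.isOpen_far.mem_nhds hfar)
    rw [closure_subtype]
    have h3 : Tendsto (fun s : ℂ => (x, s, S.sheet i x s)) (𝓝[≠] 0) (𝓝 (x, 0, z)) := by
      have h := h1.tendsto.mono_left (nhdsWithin_le_nhds (s := {0}ᶜ))
      rwa [← hi] at h
    refine mem_closure_of_tendsto h3 ?_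
    filter_upwards [nhdsWithin_le_nhds h2, self_mem_nhdsWithin] with s hs hs0
    exact ⟨⟨(x, s, S.sheet i x s), Or.inl hx, S.isRoot_sheet i hs⟩, hs0, rfl⟩
  · exact subset_closure hy

variable {n : ℕ} {Y : Type} [TopologicalSpace Y] (Q : CyclicCover n S.cone Y)

lemma exists_slice_function : ∃ u : Y → ℂ, ContinuousOn u (Q.p ⁻¹' S.slice) ∧
    ∀ y, Q.p y ∈ S.slice → u y ≠ 0 ∧ u (Q.σ y) = unityRoot n * u y := by
  classical
  obtain ⟨u, hu, hu'⟩ := S.exists_equivariant ((Q.restrict S.slice).map S.sliceHomeo) isOpen_univ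
    convex_univ
  refine ⟨fun y => if hy : y ∈ Q.p ⁻¹' S.slice then u ⟨y, hy⟩ else 0, ?_, fun y hy => ?_⟩
  · rw [continuousOn_iff_continuous_domRestrict]
    have : Continuous u := by
      rw [← continuousOn_univ]
      exact hu.mono fun _ _ => Set.mem_univ _
    convert this using 1
    funext y
    simp only [Set.domRestrict]
    rw [dif_pos y.2]
  · have hy0 : y ∈ Q.p ⁻¹' S.slice := hy
    have hy1 : Q.σ y ∈ Q.p ⁻¹' S.slice := by rwa [Set.mem_preimage, Q.p_σ]
    simp only [dif_pos hy0, dif_pos hy1]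
    exact hu' ⟨y, hy⟩ (Set.mem_univ _)

/-- A lift of the scaling action to a covering. -/
structure Flow where
  L : Y → ℂ → Y
  cont : Continuous fun q : Y × ℂ => L q.1 q.2
  p_L : ∀ y τ, Q.p (L y τ) = S.scale τ (Q.p y)
  zero : ∀ y, L y 0 = y
  add : ∀ y τ τ', L (L y τ) τ' = L y (τ + τ')
  σ_comm : ∀ y τ, L (Q.σ y) τ = Q.σ (L y τ)

open unitInterval in
lemma nonempty_flow : Nonempty (S.Flow Q) := by
  have hp := Q.isCoveringMap.continuous
  let H : C(I × (Y × ℂ), S.cone) := ⟨fun q => S.scale (((q.1 : ℝ) : ℂ) * q.2.2) (Q.p q.2.1),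
    S.continuous_scale.comp (f := fun q : I × (Y × ℂ) => (Q.p q.2.1, ((q.1 : ℝ) : ℂ) * q.2.2))
      (by fun_prop)⟩
  have H0 : ∀ a : Y × ℂ, H (0, a) = Q.p ((⟨Prod.fst, continuous_fst⟩ : C(Y × ℂ, Y)) a) := fun a => by
    simp [H, scale_zero]
  let G := Q.isCoveringMap.liftHomotopy H ⟨Prod.fst, continuous_fst⟩ H0
  have hG : ∀ q, Q.p (G q) = H q := fun q =>
    congrFun (Q.isCoveringMap.liftHomotopy_lifts H ⟨Prod.fst, continuous_fst⟩ H0) q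
  have hG0 : ∀ a : Y × ℂ, G (0, a) = a.1 :=
    Q.isCoveringMap.liftHomotopy_zero H ⟨Prod.fst, continuous_fst⟩ H0
  let L : Y → ℂ → Y := fun y τ => G (1, y, τ)
  have hLc : Continuous fun q : Y × ℂ => L q.1 q.2 := by
    exact G.continuous.comp (f := fun q : Y × ℂ => ((1 : I), q.1, q.2)) (by fun_prop)
  have hLy : ∀ y, Continuous (L y) := fun y =>
    hLc.comp (f := fun τ : ℂ => (y, τ)) (by fun_prop)
  have hpL : ∀ y τ, Q.p (L y τ) = S.scale τ (Q.p y) := fun y τ => by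
    simp [L, hG, H]
  have hz : ∀ y, L y 0 = y := fun y => by
    have h1 : Continuous fun s : I => G (s, y, 0) := by
      exact G.continuous.comp (f := fun s : I => (s, y, (0 : ℂ))) (by fun_prop)
    have := Q.isCoveringMap.const_of_comp h1 (fun s s' => by simp [hG, H]) 1 0
    exact this.trans (hG0 _)
  refine ⟨⟨L, hLc, hpL, hz, fun y τ τ' => ?_, fun y τ => ?_⟩⟩
  · have := Q.isCoveringMap.eq_of_comp_eq (g₁ := L (L y τ)) (g₂ := fun τ' => L y (τ + τ'))
      (hLy _) ((hLy _).comp (by fun_prop)) (by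
        funext τ'
        simp [Function.comp, hpL, scale_scale]) 0 (by simp [hz])
    exact congrFun this τ'
  · have := Q.isCoveringMap.eq_of_comp_eq (g₁ := L (Q.σ y)) (g₂ := fun τ => Q.σ (L y τ))
      (hLy _) (Q.continuous_σ.comp (hLy _)) (by
        funext τ'
        simp [Function.comp, hpL, Q.p_σ]) 0 (by simp [hz])
    exact congrFun this τ

namespace Flow
variable {S Q} (F : S.Flow Q)

lemma iterate_comm (k : ℕ) (y : Y) (τ : ℂ) : F.L (Q.σ^[k] y) τ = Q.σ^[k] (F.L y τ) := by
  induction k with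
  | zero => rfl
  | succ k ih => rw [Function.iterate_succ_apply', Function.iterate_succ_apply', F.σ_comm, ih]

/-- The full turn acts as a power of the deck transformation. -/
lemma exists_monodromy : ∃ t : ℕ, ∀ y, Q.p y ∈ S.slice → F.L y period = Q.σ^[t] y := by
  have hp : ∀ y, Q.p (F.L y period) = Q.p y := fun y => by
    rw [F.p_L, S.scale_congr (τ' := 0) (by rw [exp_period, Complex.exp_zero]), scale_zero]
  have hLc : Continuous fun y => F.L y period :=
    F.cont.comp (f := fun y => (y, period)) (by fun_prop)
  obtain ⟨g, hg, hgp⟩ := Q.exists_descent (A := Set.univ) (f := fun y => Q.diff (F.L y period) y)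
    (Q.continuous_diff hLc continuous_id hp).continuousOn (fun y _ => by
      rw [F.σ_comm, Q.diff_σ_σ (hp y)])
  have hgc : Continuous fun q : S.curve => g (S.embed q) :=
    (continuousOn_univ.1 hg).comp S.continuous_embed
  have : PreconnectedSpace S.curve := Subtype.preconnectedSpace S.isPreconnected_curve
  have hconst : ∀ q q' : S.curve, g (S.embed q) = g (S.embed q') := fun q q' =>
    isPreconnected_univ.constant_of_mapsTo (T := (nthRootsFinset n (1 : ℂ) : Set ℂ))
      (f := fun q => g (S.embed q)) (Finset.finite_toSet _).isDiscrete hgc.continuousOn (fun q _ => by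
        obtain ⟨y, hy⟩ := Q.surjective (S.embed q)
        show g (S.embed q) ∈ _
        rw [← hy, ← hgp y (Set.mem_univ _), Finset.mem_coe, mem_nthRootsFinset Q.pos]
        exact Q.diff_pow _ _) (Set.mem_univ q) (Set.mem_univ q')
  by_cases h : ∃ y, Q.p y ∈ S.slice
  · obtain ⟨y₀, hy₀⟩ := h
    obtain ⟨t, ht⟩ := Q.exists_iterate _ _ (hp y₀)
    refine ⟨t, fun y hy => ?_⟩
    obtain ⟨k, hk⟩ := Q.exists_iterate _ _ (hp y)
    rw [hk]
    apply Q.iterate_eq_of_pow_eq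
    rw [← Q.diff_iterate k y, ← hk, ← Q.diff_iterate t y₀, ← ht]
    have h1 := hgp y (Set.mem_univ _)
    have h2 := hgp y₀ (Set.mem_univ _)
    rw [← S.embed_flat hy] at h1
    rw [← S.embed_flat hy₀] at h2
    exact h1.trans ((hconst _ _).trans h2.symm)
  · exact ⟨0, fun y hy => absurd ⟨y, hy⟩ h⟩

end Flow
end Sheeted
end HomSurf

end

section

open Filter Topology Polynomial

namespace HomSurf

/-- Extend a continuous function from the subtype of a set. -/
lemma exists_extension_of_subtype {α β : Type*} [TopologicalSpace α] [TopologicalSpace β] {s : Set α}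
    (b : β) {f : s → β} (hf : Continuous f) :
    ∃ g : α → β, ContinuousOn g s ∧ ∀ x (hx : x ∈ s), g x = f ⟨x, hx⟩ := by
  classical
  refine ⟨fun x => if hx : x ∈ s then f ⟨x, hx⟩ else b, ?_, fun x hx => dif_pos hx⟩
  rw [continuousOn_iff_continuous_domRestrict]
  convert hf using 1
  funext y
  simp only [Set.domRestrict]
  rw [dif_pos y.2]

/-- A logarithm of a function which is multiplied by a constant under a full turn changes by a
constant. -/
lemma exists_turn {ρ : ℝ} {M : ℂ → ℂ} (hM : ContinuousOn M {τ | ρ < τ.re}) {a : ℂ}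
    (h : ∀ τ : ℂ, ρ < τ.re → Complex.exp (M (τ + period)) = Complex.exp a * Complex.exp (M τ)) :
    ∃ m : ℤ, ∀ τ : ℂ, ρ < τ.re → M (τ + period) = M τ + a + m * period := by
  have hre : ∀ τ : ℂ, ρ < τ.re → ρ < (τ + period).re := fun τ hτ => by
    rwa [Complex.add_re, period_re, add_zero]
  have hτ₀ : ρ < ((ρ + 1 : ℝ) : ℂ).re := by rw [Complex.ofReal_re]; linarith
  have h0 := h _ hτ₀
  rw [← Complex.exp_add, Complex.exp_eq_exp_iff_exists_int] at h0
  obtain ⟨m, hm⟩ := h0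
  refine ⟨m, fun τ hτ => ?_⟩
  have hc : ContinuousOn (fun τ => M (τ + period) - M τ) {τ | ρ < τ.re} :=
    (hM.comp (by fun_prop) hre).sub hM
  have := eq_of_exp_comp_eq (isPreconnected_halfPlane ρ) hc (c := Complex.exp a) (fun τ hτ => by
    rw [Complex.exp_sub, h τ hτ, mul_div_cancel_right₀ _ (Complex.exp_ne_zero _)]) hτ hτ₀
  linear_combination this + hm

namespace Sheeted
variable {d : ℕ} (S : Sheeted d) {n : ℕ} {Y : Type} [TopologicalSpace Y]

/-- The transversal discs at infinity. -/
lemma exists_disc (i : Fin d) : ∃ P : ℂ → S.cone, ContinuousOn P (Metric.ball 0 S.δ) ∧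
    ∀ s ∈ Metric.ball (0 : ℂ) S.δ, (P s).1 = (1, s, S.ζ i s) := by
  have hr : ∀ s ∈ Metric.ball (0 : ℂ) S.δ, ((1 : ℂ), s, S.ζ i s) ∈ S.cone := fun s hs => by
    refine ⟨Or.inl one_ne_zero, ?_⟩
    show (S.F 1 s).IsRoot (S.ζ i s)
    rw [S.ζ_eq s hs, isRoot_prod_iff]
    exact ⟨i, rfl⟩
  obtain ⟨P, hP, hPs⟩ := exists_extension_of_subtype (β := S.cone)
    ⟨_, hr 0 (Metric.mem_ball_self S.δ_pos)⟩
    (f := fun s : Metric.ball (0 : ℂ) S.δ => ⟨_, hr s.1 s.2⟩) (Continuous.subtype_mk (by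
      have := continuousOn_iff_continuous_domRestrict.1 (S.ζ_cont i)
      exact continuous_const.prodMk (continuous_subtype_val.prodMk this)) _)
  exact ⟨P, hP, fun s hs => by rw [hPs s hs]⟩

/-- Lifts of the transversal discs at infinity. -/
lemma exists_end_lift (Q : CyclicCover n S.cone Y) (i : Fin d) :
    ∃ e : ℂ → Y, ContinuousOn e (Metric.ball 0 S.δ) ∧
      ∀ s ∈ Metric.ball (0 : ℂ) S.δ, (Q.p (e s)).1 = (1, s, S.ζ i s) := by
  obtain ⟨P, hP, hPs⟩ := S.exists_disc i
  let k₀ : Metric.ball (0 : ℂ) S.δ := ⟨0, Metric.mem_ball_self S.δ_pos⟩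
  obtain ⟨e₀, he₀⟩ := Q.surjective (P k₀)
  obtain ⟨ψ, hψ, hψp, -⟩ := exists_lift_of_convex Q.isCoveringMap (convex_ball 0 S.δ)
    (continuousOn_iff_continuous_domRestrict.1 hP) k₀ e₀ he₀
  obtain ⟨e, he, hee⟩ := exists_extension_of_subtype e₀ hψ
  refine ⟨e, he, fun s hs => ?_⟩
  rw [hee s hs, hψp]
  exact hPs s hs

lemma exp_neg_mem_ball {τ : ℂ} (h : -Real.log S.δ < τ.re) :
    Complex.exp (-τ) ∈ Metric.ball (0 : ℂ) S.δ := by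
  rw [mem_ball_zero_iff, Complex.norm_exp, Complex.neg_re]
  calc Real.exp (-τ.re) < Real.exp (Real.log S.δ) := Real.exp_lt_exp.2 (by linarith)
    _ = S.δ := Real.exp_log S.δ_pos

lemma scale_end {p : S.cone} {i : Fin d} {τ : ℂ} (hτ : -Real.log S.δ < τ.re)
    (hp : p.1 = (1, Complex.exp (-τ), S.ζ i (Complex.exp (-τ)))) :
    S.scale τ p = S.embed ⟨S.endp i (Complex.exp τ), S.endp_mem i (S.large_exp hτ)⟩ := by
  apply Subtype.ext
  simp only [scale, hp, embed, endp, sheet, mul_one, one_div, Complex.exp_neg,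
    mul_inv_cancel₀ (Complex.exp_ne_zero τ)]

variable {S} {Q : CyclicCover n S.cone Y}

/-- A nonvanishing function on the slice with prescribed equivariance, trivial at the ends. -/
lemma Flow.exists_slice_trivialization (F : S.Flow Q) {t : ℕ}
    (ht : ∀ y, Q.p y ∈ S.slice → F.L y period = Q.σ^[t] y) {e : Fin d → ℂ → Y}
    (he : ∀ i, ContinuousOn (e i) (Metric.ball 0 S.δ))
    (hep : ∀ i, ∀ s ∈ Metric.ball (0 : ℂ) S.δ, (Q.p (e i s)).1 = (1, s, S.ζ i s)) :
    (unityRoot n ^ d) ^ t = 1 ∧ ∃ V : Y → ℂ, ContinuousOn V (Q.p ⁻¹' S.slice) ∧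
      (∀ y, Q.p y ∈ S.slice → V y ≠ 0 ∧ V (Q.σ y) = unityRoot n ^ d * V y) ∧
      ∃ ρ ≥ -Real.log S.δ, ∀ i (τ : ℂ), ρ < τ.re → V (F.L (e i (Complex.exp (-τ))) τ) = 1 := by
  have hn : (n : ℂ) ≠ 0 := Nat.cast_ne_zero.2 Q.pos.ne'
  have hP : period ≠ 0 := Complex.two_pi_I_ne_zero
  obtain ⟨u, hu, hu'⟩ := S.exists_slice_function Q
  set ρ₀ := -Real.log S.δ
  let y : Fin d → ℂ → Y := fun i τ => F.L (e i (Complex.exp (-τ))) τ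
  have hyp : ∀ i (τ : ℂ) (hτ : ρ₀ < τ.re), Q.p (y i τ) =
      S.embed ⟨S.endp i (Complex.exp τ), S.endp_mem i (S.large_exp hτ)⟩ := fun i τ hτ => by
    rw [F.p_L, S.scale_end hτ (hep i _ (S.exp_neg_mem_ball hτ))]
  have hys : ∀ i (τ : ℂ), ρ₀ < τ.re → Q.p (y i τ) ∈ S.slice := fun i τ hτ => by
    rw [hyp i τ hτ]; exact S.embed_mem_slice _
  have hyc : ∀ i, ContinuousOn (y i) {τ | ρ₀ < τ.re} := fun i => by
    refine F.cont.comp_continuousOn (f := fun τ : ℂ => (e i (Complex.exp (-τ)), τ)) ?_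
    exact ((he i).comp (f := fun τ => Complex.exp (-τ)) (by fun_prop)
      fun τ hτ => S.exp_neg_mem_ball hτ).prodMk continuousOn_id
  have hyt : ∀ i (τ : ℂ), ρ₀ < τ.re → y i (τ + period) = Q.σ^[t] (y i τ) := fun i τ hτ => by
    rw [← ht _ (hys i τ hτ)]
    simp only [y]
    rw [F.add, neg_add, Complex.exp_add, Complex.exp_neg period, exp_period, inv_one, mul_one]
  have hlog : ∀ i, ∃ l : ℂ → ℂ, ContinuousOn l {τ : ℂ | ρ₀ < τ.re} ∧
      ∀ τ ∈ {τ : ℂ | ρ₀ < τ.re}, Complex.exp (l τ) = u (y i τ) := fun i =>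
    exists_log_of_convex (convex_halfSpace_re_gt ρ₀) (hu.comp (hyc i) (hys i))
      fun τ hτ => (hu' _ (hys i τ hτ)).1
  choose M hM hMu using hlog
  have hturn : ∀ i, ∃ m : ℤ, ∀ τ : ℂ, ρ₀ < τ.re →
      M i (τ + period) = M i τ + t * (period / n) + m * period := fun i => by
    refine exists_turn (hM i) fun τ hτ => ?_
    rw [hMu i τ hτ, hMu i _ (by simpa [period] using hτ), hyt i τ hτ,
      Q.apply_iterate (fun y hy => (hu' y hy).2) t (hys i τ hτ), Complex.exp_nat_mul, unityRoot]
  choose m hm using hturn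
  -- the power `u ^ n` descends to the curve
  obtain ⟨g, hg, hgp⟩ := Q.exists_descent (A := S.slice) (f := fun y => u y ^ n) (hu.pow n)
    (fun y hy => by
      rw [(hu' y hy).2, mul_pow, (isPrimitiveRoot_unityRoot Q.pos).pow_eq_one, one_mul])
  have hgc : Continuous fun q : S.curve => g (S.embed q) :=
    hg.comp_continuous S.continuous_embed S.embed_mem_slice
  obtain ⟨G, hG, hGg⟩ := exists_extension_of_subtype (0 : ℂ) hgc
  have hGu : ∀ y (q : S.curve), Q.p y = S.embed q → G q = u y ^ n := fun y q h => by
    rw [hGg q q.2, hgp y (by rw [h]; exact S.embed_mem_slice q), h]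
  have hsum := S.sum_winding_eq_zero (G := G) hG (fun q hq => by
      obtain ⟨y, hy⟩ := Q.surjective (S.embed ⟨q, hq⟩)
      rw [hGu y ⟨q, hq⟩ hy]
      exact pow_ne_zero _ (hu' y (by rw [hy]; exact S.embed_mem_slice _)).1)
    (ρ := ρ₀) (Λ := fun i τ => n * M i τ) (fun i => continuousOn_const.mul (hM i))
    (fun i τ hτ => by
      rw [Complex.exp_nat_mul, hMu i τ hτ, ← hGu _ _ (hyp i τ hτ)])
    (g := fun i => t + n * m i) (fun i τ hτ => by
      simp only [hm i τ hτ]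
      field_simp
      ring)
  have hdt : (d : ℤ) * t = -(n * ∑ i, m i) := by
    rw [Finset.sum_add_distrib, ← Finset.mul_sum] at hsum
    simp only [Finset.sum_const, Finset.card_univ, Fintype.card_fin, nsmul_eq_mul] at hsum
    have : ((d * t + n * ∑ i, m i : ℤ) : ℂ) = 0 := by push_cast; exact hsum
    have := Int.cast_eq_zero.1 this
    linarith
  have hdvd : n ∣ d * t := by
    have : (n : ℤ) ∣ ((d * t : ℕ) : ℤ) := ⟨-∑ i, m i, by push_cast; rw [hdt]; ring⟩
    exact_mod_cast this
  refine ⟨by rw [← pow_mul]; exact ((isPrimitiveRoot_unityRoot Q.pos).pow_eq_one_iff_dvd _).2 hdvd, ?_⟩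
  have hdt' : (d : ℂ) * t = -(n * ∑ i, (m i : ℂ)) := by exact_mod_cast congrArg (Int.cast : ℤ → ℂ) hdt
  obtain ⟨h, hh, hh0, ρ', hρ'⟩ := S.exists_prescribed_ends (ρ := ρ₀) (N := fun i τ => -d * M i τ)
    (fun i => continuousOn_const.mul (hM i)) (a := fun i => ∑ j, m j - d * m i) (by
      rw [Finset.sum_sub_distrib, ← Finset.mul_sum]; simp)
    (fun i τ hτ => by
      simp only [hm i τ hτ]
      push_cast
      have : (d : ℂ) * t / n = -∑ i, (m i : ℂ) := by
        rw [hdt']; field_simp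
      linear_combination -period * this)
  have hcurve : ∀ y, Q.p y ∈ S.slice → ((Q.p y).1.1, (Q.p y).1.2.2) ∈ S.curve := fun y hy =>
    (S.flat _ hy).2
  refine ⟨fun y => u y ^ d * h ((Q.p y).1.1, (Q.p y).1.2.2), ?_, fun y hy => ⟨?_, ?_⟩,
    max ρ₀ ρ', le_max_left _ _, fun i τ hτ => ?_⟩
  · have hpc := Q.isCoveringMap.continuous
    exact (hu.pow d).mul (hh.comp (f := fun y => ((Q.p y).1.1, (Q.p y).1.2.2)) (by fun_prop)
      fun y hy => hcurve y hy)
  · exact mul_ne_zero (pow_ne_zero _ (hu' y hy).1) (hh0 _ (hcurve y hy))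
  · simp only [Q.p_σ, (hu' y hy).2, mul_pow]
    ring
  · have hτ' := max_lt_iff.1 hτ
    have h1 := hyp i τ hτ'.1
    have h2 := hMu i τ hτ'.1
    simp only [y] at h1 h2
    simp only [h1]
    rw [← h2]
    show _ * h (S.endp i (Complex.exp τ)) = 1
    rw [hρ' i τ hτ'.2, ← Complex.exp_nat_mul, ← Complex.exp_add, ← Complex.exp_zero]
    congr 1
    ring

end Sheeted
end HomSurf

end

section

open Filter Topology Polynomial

namespace HomSurf

namespace CyclicCover
variable {n : ℕ} {X Y : Type} [TopologicalSpace X] [TopologicalSpace Y] (Q : CyclicCover n X Y)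

lemma eventually_eq_iterate {Z : Type*} [TopologicalSpace Z] {a b : Z → Y} {z : Z}
    (ha : ContinuousAt a z) (hb : ContinuousAt b z) (h : ∀ᶠ z' in 𝓝 z, Q.p (a z') = Q.p (b z')) :
    ∃ k : ℕ, ∀ᶠ z' in 𝓝 z, a z' = Q.σ^[k] (b z') := by
  obtain ⟨k, hk⟩ := Q.exists_iterate _ _ h.self_of_nhds
  obtain ⟨N, hN, haN, hinj⟩ := Q.isCoveringMap.isLocalHomeomorph.isLocallyInjective (a z)
  have hb' : ContinuousAt (fun z' => Q.σ^[k] (b z')) z :=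
    ContinuousAt.comp (f := b) (Q.continuous_σ.iterate k).continuousAt hb
  refine ⟨k, ?_⟩
  filter_upwards [h, ha.eventually (hN.mem_nhds haN),
    hb'.eventually (hN.mem_nhds (by beta_reduce; rwa [← hk]))] with z' h1 h2 h3
  exact hinj h2 h3 (by rw [h1, Q.p_iterate])

end CyclicCover

namespace Sheeted
variable {d : ℕ} (S : Sheeted d) {n : ℕ} {Y : Type} [TopologicalSpace Y]

/-- The `d`-th power of the tautological character of a cyclic covering of the cone is trivial. -/
theorem exists_equivariant_pow (Q : CyclicCover n S.cone Y) : ∃ v : Y → ℂ, Continuous v ∧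
    ∀ y, v y ≠ 0 ∧ v (Q.σ y) = unityRoot n ^ d * v y := by
  classical
  obtain ⟨F⟩ := S.nonempty_flow Q
  obtain ⟨t, ht⟩ := F.exists_monodromy
  choose e he hep using S.exists_end_lift Q
  obtain ⟨hroot, V, hV, hV', ρ, hρ, hVe⟩ := F.exists_slice_trivialization ht he hep
  have hpc := Q.isCoveringMap.continuous
  have hVt : ∀ y, Q.p y ∈ S.slice → V (Q.σ^[t] y) = V y := fun y hy => by
    rw [Q.apply_iterate (fun y hy => (hV' y hy).2) t hy, hroot, one_mul]
  have hbranch : ∀ y (τ τ' : ℂ), Complex.exp τ = Complex.exp τ' → Q.p (F.L y τ) ∈ S.slice →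
      V (F.L y τ') = V (F.L y τ) := fun y τ τ' hττ hs => by
    have hsl : ∀ τ, Q.p (F.L y (τ + period)) = Q.p (F.L y τ) := fun τ => by
      rw [F.p_L, F.p_L]
      exact S.scale_congr (by rw [Complex.exp_add, exp_period, mul_one]) _
    have := eq_of_exp_eq (ρ := τ.re - 1) (τ := τ) (τ' := τ')
      (f := fun τ => if Q.p (F.L y τ) ∈ S.slice then V (F.L y τ) else 0)
      (fun τ _ => by
        simp only [hsl]
        split_ifs with h
        · rw [← F.add, ht _ h, hVt _ h]
        · rfl) (by linarith) hττ
    have hs' : Q.p (F.L y τ') ∈ S.slice := by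
      rwa [F.p_L, ← S.scale_congr hττ, ← F.p_L]
    simpa only [if_pos hs, if_pos hs'] using this
  let w : Y → ℂ := fun y => (Q.p y).1.2.1
  have hw : Continuous w := by fun_prop
  let A : Set Y := {y | w y ≠ 0}
  have hA : Dense A := S.dense_ne_zero.preimage Q.isCoveringMap.isOpenMap
  have hslice : ∀ y (τ : ℂ), y ∈ A → Complex.exp τ = (w y)⁻¹ → Q.p (F.L y τ) ∈ S.slice :=
    fun y τ hy hτ => by
      show (Q.p (F.L y τ)).1.2.1 = 1
      rw [F.p_L, scale_snd, hτ, inv_mul_cancel₀ hy]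
  let v₀ : Y → ℂ := fun y => V (F.L y (-Complex.log (w y)))
  have hv₀ : ∀ y (τ : ℂ), y ∈ A → Complex.exp τ = (w y)⁻¹ → v₀ y = V (F.L y τ) := fun y τ hy hτ =>
    hbranch y τ _ (by rw [hτ, Complex.exp_neg, Complex.exp_log hy]) (hslice y τ hy hτ)
  have hlog : ∀ {a b : ℂ}, a ≠ 0 → b ≠ 0 →
      Complex.exp (-(Complex.log a + Complex.log (b / a))) = b⁻¹ := fun {a b} ha hb => by
    rw [Complex.exp_neg, Complex.exp_add, Complex.exp_log ha, Complex.exp_log (div_ne_zero hb ha),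
      mul_div_cancel₀ _ ha]
  have hlogc : ∀ {f : Y → ℂ} {y₀ : Y}, Continuous f → f y₀ ≠ 0 →
      ContinuousAt (fun y => F.L y (-(Complex.log (f y₀) + Complex.log (f y / f y₀)))) y₀ := by
    intro f y₀ hf h0
    refine F.cont.continuousAt.comp (f := fun y => (y, -(Complex.log (f y₀) + Complex.log (f y / f y₀))))
      (continuousAt_id.prodMk (continuousAt_const.add (ContinuousAt.clog ?_ ?_)).neg)
    · fun_prop
    · rw [div_self h0]
      exact Complex.one_mem_slitPlane
  have hcA : ContinuousOn v₀ A := fun y₀ hy₀ => by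
    have h1 : ContinuousWithinAt
        (fun y => V (F.L y (-(Complex.log (w y₀) + Complex.log (w y / w y₀))))) A y₀ :=
      ContinuousWithinAt.comp (t := Q.p ⁻¹' S.slice)
        (f := fun y => F.L y (-(Complex.log (w y₀) + Complex.log (w y / w y₀))))
        (hV _ (hslice _ _ hy₀ (hlog hy₀ hy₀))) (hlogc hw hy₀).continuousWithinAt
        (fun y hy => hslice _ _ hy (hlog hy₀ hy))
    exact h1.congr (fun y hy => hv₀ _ _ hy (hlog hy₀ hy)) (hv₀ _ _ hy₀ (hlog hy₀ hy₀))
  have hlim : ∀ y₀, y₀ ∉ A → ∃ c : ℂ, c ≠ 0 ∧ Tendsto v₀ (𝓝[A] y₀) (𝓝 c) := fun y₀ hy₀ => by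
    have hw0 : w y₀ = 0 := not_not.1 hy₀
    let x : Y → ℂ := fun y => (Q.p y).1.1
    have hx : Continuous x := by fun_prop
    have hx0 : x y₀ ≠ 0 := (Q.p y₀).2.1.resolve_right hy₀
    have hfar : (x y₀, w y₀) ∈ S.far := ⟨hx0, by simpa [hw0] using S.δ_pos⟩
    obtain ⟨i, hi⟩ := S.exists_sheet hfar (Q.p y₀).2.2
    have hdiv : ContinuousAt (fun y => w y / x y) y₀ := hw.continuousAt.div hx.continuousAt hx0
    have h1 : ∀ᶠ y in 𝓝 y₀, x y ≠ 0 := hx.continuousAt.eventually_ne hx0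
    have h2 : ∀ᶠ y in 𝓝 y₀, (Q.p y).1.2.2 = S.sheet i (x y) (w y) := by
      have h := (show ContinuousAt (fun y => (Q.p y).1) y₀ by fun_prop).eventually
        (S.eventually_sheet hfar hi)
      filter_upwards [h] with y hy
      exact hy (Q.p y).2.2
    have h3 : ∀ r : ℝ, 0 < r → ∀ᶠ y in 𝓝 y₀, w y / x y ∈ Metric.ball (0 : ℂ) r := fun r hr =>
      hdiv.eventually (Metric.isOpen_ball.mem_nhds (by simpa [hw0] using hr))
    obtain ⟨k, hk⟩ := Q.eventually_eq_iterate (hlogc hx hx0)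
      (b := fun y => e i (w y / x y))
      (ContinuousAt.comp (f := fun y => w y / x y)
        ((he i).continuousAt (Metric.isOpen_ball.mem_nhds (by simpa [hw0] using S.δ_pos))) hdiv) (by
        filter_upwards [h1, h2, h3 _ S.δ_pos] with y a b c
        apply Subtype.ext
        rw [hep i _ c, F.p_L]
        simp only [scale, hlog hx0 a]
        rw [b, sheet]
        refine Prod.ext (inv_mul_cancel₀ a) (Prod.ext ?_ (inv_mul_cancel_left₀ a _))
        exact inv_mul_eq_div _ _)
    refine ⟨(unityRoot n ^ d) ^ k, pow_ne_zero _ (pow_ne_zero _ (unityRoot_ne_zero n)), ?_⟩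
    refine tendsto_const_nhds.congr' ?_
    filter_upwards [nhdsWithin_le_nhds h1, nhdsWithin_le_nhds hk, nhdsWithin_le_nhds (h3 _ S.δ_pos),
      nhdsWithin_le_nhds (h3 _ (Real.exp_pos (-ρ))), self_mem_nhdsWithin] with y a b c c' hyA
    have hs : w y / x y ≠ 0 := div_ne_zero hyA a
    set τ := -Complex.log (w y / x y) with hτ
    have hexp : Complex.exp (-τ) = w y / x y := by rw [hτ, neg_neg, Complex.exp_log hs]
    have hre : ρ < τ.re := by
      rw [hτ, Complex.neg_re, Complex.log_re]
      rw [mem_ball_zero_iff, ← Real.log_lt_iff_lt_exp (norm_pos_iff.2 hs)] at c'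
      linarith
    have hys : Q.p (F.L (e i (w y / x y)) τ) ∈ S.slice := by
      rw [F.p_L, S.scale_end (i := i) (lt_of_le_of_lt hρ hre) (by rw [hexp]; exact hep i _ c)]
      exact S.embed_mem_slice _
    rw [hv₀ y (-(Complex.log (x y₀) + Complex.log (x y / x y₀)) + τ) hyA (by
      rw [Complex.exp_add, hlog hx0 a, hτ, Complex.exp_neg, Complex.exp_log hs, inv_div,
        ← div_eq_inv_mul, div_right_comm, div_self a, one_div])]
    have hone := hVe i τ hre
    rw [hexp] at hone
    rw [← F.add, b, F.iterate_comm, Q.apply_iterate (fun y hy => (hV' y hy).2) k hys, hone, mul_one]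
  have hAlim : ∀ y, ∃ c : ℂ, Tendsto v₀ (𝓝[A] y) (𝓝 c) := fun y => by
    by_cases hy : y ∈ A
    · exact ⟨_, hcA y hy⟩
    · exact (hlim y hy).imp fun _ h => h.2
  have hvc : Continuous (extendFrom A v₀) := continuous_extendFrom hA hAlim
  have hvA : ∀ y ∈ A, extendFrom A v₀ y = v₀ y := fun y hy =>
    extendFrom_eq (hA y) (hcA y hy)
  refine ⟨extendFrom A v₀, hvc, fun y => ⟨?_, ?_⟩⟩
  · by_cases hy : y ∈ A
    · rw [hvA y hy]
      refine (hV' _ (hslice _ _ hy ?_)).1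
      rw [Complex.exp_neg, Complex.exp_log hy]
    · obtain ⟨c, hc0, hc⟩ := hlim y hy
      rwa [extendFrom_eq (hA y) hc]
  · have : (fun y => extendFrom A v₀ (Q.σ y)) = fun y => unityRoot n ^ d * extendFrom A v₀ y := by
      refine Continuous.ext_on hA (hvc.comp Q.continuous_σ) (continuous_const.mul hvc) fun y hy => ?_
      have hwσ : w (Q.σ y) = w y := by simp only [w, Q.p_σ]
      have hy' : Q.σ y ∈ A := by
        show w (Q.σ y) ≠ 0
        rwa [hwσ]
      simp only [hvA y hy, hvA _ hy', v₀, hwσ]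
      rw [F.σ_comm]
      refine (hV' _ (hslice _ _ hy ?_)).2
      rw [Complex.exp_neg, Complex.exp_log hy]
    exact congrFun this y

end Sheeted
end HomSurf

end

section

open Filter Topology Polynomial

namespace HomSurf

lemma exists_local_root {X : Type*} [TopologicalSpace X] {U : Set X} (hU : IsOpen U) {f : X → ℂ}
    (hf : ContinuousOn f U) {n : ℕ} (hn : 0 < n) {x₀ : X} (hx₀ : x₀ ∈ U) (h0 : f x₀ ≠ 0) :
    ∃ V : Set X, IsOpen V ∧ x₀ ∈ V ∧ V ⊆ U ∧ ∃ ρ : X → ℂ, ContinuousOn ρ V ∧ ∀ x ∈ V, ρ x ^ n = f x := by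
  have hq : ContinuousOn (fun x => f x / f x₀) U := hf.div_const _
  refine ⟨U ∩ (fun x => f x / f x₀) ⁻¹' Complex.slitPlane,
    hq.isOpen_inter_preimage hU Complex.isOpen_slitPlane,
    ⟨hx₀, by simp [div_self h0, Complex.one_mem_slitPlane]⟩, Set.inter_subset_left,
    fun x => Complex.exp ((Complex.log (f x₀) + Complex.log (f x / f x₀)) / n), ?_, fun x hx => ?_⟩
  · refine Complex.continuous_exp.comp_continuousOn (ContinuousOn.div_const (continuousOn_const.add
      (ContinuousOn.clog (hq.mono Set.inter_subset_left) fun x hx => hx.2)) _)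
  · have hn' : (n : ℂ) ≠ 0 := Nat.cast_ne_zero.2 hn.ne'
    rw [← Complex.exp_nat_mul, mul_div_cancel₀ _ hn', Complex.exp_add, Complex.exp_log h0,
      Complex.exp_log (Complex.slitPlane_ne_zero hx.2), mul_div_cancel₀ _ h0]

lemma exists_pow_mul_of_pow_eq {n : ℕ} (hn : 0 < n) {a b : ℂ} (hb : b ≠ 0) (h : a ^ n = b ^ n) :
    ∃ k : ℕ, a = unityRoot n ^ k * b := by
  have : NeZero n := ⟨hn.ne'⟩
  have h1 : (a / b) ^ n = 1 := by rw [div_pow, h, div_self (pow_ne_zero _ hb)]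
  obtain ⟨k, -, hk⟩ := (isPrimitiveRoot_unityRoot hn).eq_pow_of_pow_eq_one h1
  exact ⟨k, by rw [hk, div_mul_cancel₀ _ hb]⟩

/-- A map with a fibrewise simply transitive cyclic action and local sections is a cyclic
covering. -/
def CyclicCover.ofSections {n : ℕ} (hn : 0 < n) {X Y : Type} [TopologicalSpace X] [TopologicalSpace Y]
    [T2Space Y] (p : Y → X) (hp : Continuous p) (σ : Y → Y) (hσ : Continuous σ)
    (hpσ : ∀ y, p (σ y) = p y) (hit : ∀ y y', p y = p y' → ∃ k : ℕ, y = σ^[k] y')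
    (hfree : ∀ (k : ℕ) y, σ^[k] y = y ↔ n ∣ k)
    (hsec : ∀ x, ∃ V : Set X, IsOpen V ∧ x ∈ V ∧ ∃ s : X → Y, ContinuousOn s V ∧
      ∀ x ∈ V, p (s x) = x) : CyclicCover n X Y where
  pos := hn
  p := p
  isCoveringMap := by
    have hpit : ∀ (k : ℕ) y, p (σ^[k] y) = p y := fun k y => by
      induction k with
      | zero => rfl
      | succ k ih => rw [Function.iterate_succ_apply', hpσ, ih]
    have hmod : ∀ (k : ℕ) y, σ^[k % n] y = σ^[k] y := fun k y => by
      conv_rhs => rw [← Nat.mod_add_div k n, Function.iterate_add_apply,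
        (hfree _ _).2 (dvd_mul_right n _)]
    refine isCoveringMap_of_sections (n := n) hp fun x => ?_
    obtain ⟨V, hV, hxV, s, hs, hps⟩ := hsec x
    refine ⟨V, hV, hxV, fun i x => σ^[i] (s x), fun i => (hσ.iterate i).comp_continuousOn hs,
      fun i x hx => by rw [hpit, hps x hx], fun x _ => ?_, fun y hy => ?_⟩
    · have key : ∀ i j : Fin n, i ≤ j → σ^[i] (s x) = σ^[j] (s x) → i = j := fun i j hij h => by
        have h2 : σ^[n - i + j] (s x) = s x := by
          rw [Function.iterate_add_apply, ← h, ← Function.iterate_add_apply,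
            Nat.sub_add_cancel i.2.le]
          exact (hfree n _).2 dvd_rfl
        obtain ⟨c, hc⟩ := (hfree _ _).1 h2
        have hi := i.2
        have hj := j.2
        have hij' : (i : ℕ) ≤ j := hij
        have hc1 : c < 2 := by
          by_contra hcon
          have := Nat.mul_le_mul_left n (not_lt.1 hcon)
          omega
        interval_cases c
        · omega
        · exact Fin.ext (by omega)
      intro i j h
      rcases le_total i j with hij | hij
      · exact key i j hij h
      · exact (key j i hij h.symm).symm
    · obtain ⟨k, hk⟩ := hit y (s (p y)) (hps _ hy).symm
      exact ⟨⟨k % n, Nat.mod_lt _ hn⟩, by beta_reduce; rw [hmod]; exact hk⟩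
  surjective x := by
    obtain ⟨V, -, hxV, s, -, hps⟩ := hsec x
    exact ⟨s x, hps x hxV⟩
  σ := σ
  continuous_σ := hσ
  p_σ := hpσ
  exists_iterate := hit
  iterate_eq_iff := hfree

/-- Two local root extraction problems together with their gluing. -/
structure GlueData (n : ℕ) (X : Type) [TopologicalSpace X] where
  pos : 0 < n
  U₁ : Set X
  U₂ : Set X
  isOpen₁ : IsOpen U₁
  isOpen₂ : IsOpen U₂
  cover : ∀ x, x ∈ U₁ ∨ x ∈ U₂
  s : X → ℂ
  r : X → ℂ
  κ : X → ℂ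
  β : X → ℂ
  s_cont : ContinuousOn s U₁
  r_cont : ContinuousOn r U₂
  κ_cont : ContinuousOn κ U₂
  β_cont : ContinuousOn β U₁
  s_ne : ∀ x ∈ U₁, s x ≠ 0
  r_ne : ∀ x ∈ U₂, r x ≠ 0
  s_eq : ∀ x ∈ U₁, x ∈ U₂ → s x = κ x ^ n * r x
  κ_β : ∀ x ∈ U₁, x ∈ U₂ → κ x * β x = 1

namespace GlueData
variable {n : ℕ} {X : Type} [TopologicalSpace X] (D : GlueData n X)

/-- The total space of the glued covering. -/
def total : Set (X × ℂ × ℂ) :=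
  {q | (q.1 ∈ D.U₁ ∧ q.2.1 ^ n = D.s q.1 ∧ q.2.2 = D.β q.1 * q.2.1) ∨
    (q.1 ∈ D.U₂ ∧ q.2.2 ^ n = D.r q.1 ∧ q.2.1 = D.κ q.1 * q.2.2)}

lemma mem_total₁ {x : X} (hx : x ∈ D.U₁) {c : ℂ × ℂ} :
    (x, c) ∈ D.total ↔ c.1 ^ n = D.s x ∧ c.2 = D.β x * c.1 := by
  refine ⟨?_, fun h => Or.inl ⟨hx, h⟩⟩
  rintro (h | ⟨h, h1, h2⟩)
  · exact h.2
  · simp only at h h1 h2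
    refine ⟨by rw [h2, mul_pow, h1, D.s_eq x hx h], ?_⟩
    rw [h2, ← mul_assoc, mul_comm (D.β x), D.κ_β x hx h, one_mul]

lemma mem_total₂ {x : X} (hx : x ∈ D.U₂) {c : ℂ × ℂ} :
    (x, c) ∈ D.total ↔ c.2 ^ n = D.r x ∧ c.1 = D.κ x * c.2 := by
  refine ⟨?_, fun h => Or.inr ⟨hx, h⟩⟩
  rintro (⟨h, h1, h2⟩ | h)
  · simp only at h h1 h2
    refine ⟨?_, by rw [h2, ← mul_assoc, D.κ_β x h hx, one_mul]⟩
    rw [h2, mul_pow, h1, D.s_eq x h hx, ← mul_assoc, ← mul_pow, mul_comm (D.β x), D.κ_β x h hx,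
      one_pow, one_mul]
  · exact h.2

lemma ne_zero {q : X × ℂ × ℂ} (hq : q ∈ D.total) : q.2 ≠ 0 := by
  obtain ⟨x, c⟩ := q
  rintro rfl
  have hn := D.pos.ne'
  rcases D.cover x with h | h
  · have := ((D.mem_total₁ h).1 hq).1
    rw [Prod.fst_zero, zero_pow hn] at this
    exact D.s_ne x h this.symm
  · have := ((D.mem_total₂ h).1 hq).1
    rw [Prod.snd_zero, zero_pow hn] at this
    exact D.r_ne x h this.symm

lemma smul_mem {c : ℂ} (hc : c ^ n = 1) {q : X × ℂ × ℂ} (hq : q ∈ D.total) :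
    (q.1, c • q.2) ∈ D.total := by
  rcases D.cover q.1 with h | h
  · have h1 := (D.mem_total₁ h).1 hq
    refine (D.mem_total₁ h).2 ⟨?_, ?_⟩
    · simp [mul_pow, hc, h1.1]
    · simp [h1.2]; ring
  · have h1 := (D.mem_total₂ h).1 hq
    refine (D.mem_total₂ h).2 ⟨?_, ?_⟩
    · simp [mul_pow, hc, h1.1]
    · simp [h1.2]; ring

/-- The deck transformation of the glued covering. -/
noncomputable def deck (q : D.total) : D.total :=
  ⟨(q.1.1, unityRoot n • q.1.2), D.smul_mem (isPrimitiveRoot_unityRoot D.pos).pow_eq_one q.2⟩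

lemma deck_iterate (k : ℕ) (q : D.total) : (D.deck^[k] q).1 = (q.1.1, unityRoot n ^ k • q.1.2) := by
  induction k with
  | zero => simp
  | succ k ih =>
    rw [Function.iterate_succ_apply']
    show ((D.deck^[k] q).1.1, unityRoot n • (D.deck^[k] q).1.2) = _
    rw [ih, smul_smul, pow_succ']

/-- The glued covering. -/
noncomputable def cyclicCover [T2Space X] : CyclicCover n X D.total :=
  CyclicCover.ofSections D.pos (fun q => q.1.1) (by fun_prop) D.deck
    (Continuous.subtype_mk (by fun_prop) _) (fun _ => rfl)
    (by
      rintro ⟨⟨x, c⟩, hq⟩ ⟨⟨x', c'⟩, hq'⟩ (rfl : x = x')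
      rcases D.cover x with h | h
      · obtain ⟨h1, h2⟩ := (D.mem_total₁ h).1 hq
        obtain ⟨h1', h2'⟩ := (D.mem_total₁ h).1 hq'
        have h0 : c'.1 ≠ 0 := fun h0 => by
          rw [h0, zero_pow D.pos.ne'] at h1'
          exact D.s_ne x h h1'.symm
        obtain ⟨k, hk⟩ := exists_pow_mul_of_pow_eq D.pos h0 (h1.trans h1'.symm)
        refine ⟨k, Subtype.ext ?_⟩
        rw [deck_iterate]
        refine Prod.ext rfl (Prod.ext hk ?_)
        simp only [h2, h2', hk, Prod.smul_snd, smul_eq_mul]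
        ring
      · obtain ⟨h1, h2⟩ := (D.mem_total₂ h).1 hq
        obtain ⟨h1', h2'⟩ := (D.mem_total₂ h).1 hq'
        have h0 : c'.2 ≠ 0 := fun h0 => by
          rw [h0, zero_pow D.pos.ne'] at h1'
          exact D.r_ne x h h1'.symm
        obtain ⟨k, hk⟩ := exists_pow_mul_of_pow_eq D.pos h0 (h1.trans h1'.symm)
        refine ⟨k, Subtype.ext ?_⟩
        rw [deck_iterate]
        refine Prod.ext rfl (Prod.ext ?_ hk)
        simp only [h2, h2', hk, Prod.smul_fst, smul_eq_mul]
        ring)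
    (by
      intro k q
      rw [← (isPrimitiveRoot_unityRoot D.pos).pow_eq_one_iff_dvd, Subtype.ext_iff, deck_iterate]
      constructor
      · intro h
        have h1 : unityRoot n ^ k • q.1.2 = (1 : ℂ) • q.1.2 := by
          rw [one_smul]; exact congrArg Prod.snd h
        exact smul_left_injective ℂ (D.ne_zero q.2) h1
      · intro h
        rw [h, one_smul])
    (by
      intro x
      rcases D.cover x with h | h
      · obtain ⟨V, hV, hxV, hVU, ρ, hρ, hρs⟩ := exists_local_root D.isOpen₁ D.s_cont D.pos h (D.s_ne x h)
        have hm : ∀ x ∈ V, (x, ρ x, D.β x * ρ x) ∈ D.total := fun x hx =>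
          (D.mem_total₁ (hVU hx)).2 ⟨hρs x hx, rfl⟩
        obtain ⟨g, hg, hgm⟩ := exists_extension_of_subtype (s := V) (β := D.total) ⟨_, hm x hxV⟩
          (f := fun x => ⟨_, hm x.1 x.2⟩) (Continuous.subtype_mk (by
            refine continuous_subtype_val.prodMk (Continuous.prodMk ?_ ?_)
            · exact continuousOn_iff_continuous_domRestrict.1 hρ
            · exact continuousOn_iff_continuous_domRestrict.1 ((D.β_cont.mono hVU).mul hρ)) _)
        exact ⟨V, hV, hxV, g, hg, fun x hx => by rw [hgm x hx]⟩
      · obtain ⟨V, hV, hxV, hVU, ρ, hρ, hρs⟩ := exists_local_root D.isOpen₂ D.r_cont D.pos h (D.r_ne x h)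
        have hm : ∀ x ∈ V, (x, D.κ x * ρ x, ρ x) ∈ D.total := fun x hx =>
          (D.mem_total₂ (hVU hx)).2 ⟨hρs x hx, rfl⟩
        obtain ⟨g, hg, hgm⟩ := exists_extension_of_subtype (s := V) (β := D.total) ⟨_, hm x hxV⟩
          (f := fun x => ⟨_, hm x.1 x.2⟩) (Continuous.subtype_mk (by
            refine continuous_subtype_val.prodMk (Continuous.prodMk ?_ ?_)
            · exact continuousOn_iff_continuous_domRestrict.1 ((D.κ_cont.mono hVU).mul hρ)
            · exact continuousOn_iff_continuous_domRestrict.1 hρ) _)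
        exact ⟨V, hV, hxV, g, hg, fun x hx => by rw [hgm x hx]⟩)

end GlueData

/-- A function with a zero of order divisible by `n` along `Z` determines a cyclic covering. -/
lemma exists_glueData {n : ℕ} (hn : 0 < n) {X : Type} [TopologicalSpace X]
    [TopologicalSpace.MetrizableSpace X] {Z U : Set X} (hZ : IsClosed Z) (hU : IsOpen U)
    (hZU : Z ⊆ U) {s r κ : X → ℂ} (hs : ContinuousOn s Zᶜ) (hr : ContinuousOn r U)
    (hκ : ContinuousOn κ U) (hs0 : ∀ x ∉ Z, s x ≠ 0) (hr0 : ∀ x ∈ U, r x ≠ 0)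
    (hκ0 : ∀ x ∈ U, x ∉ Z → κ x ≠ 0) (hsr : ∀ x ∈ U, x ∉ Z → s x = κ x ^ n * r x) :
    ∃ D : GlueData n X, D.U₁ = Zᶜ ∧ D.s = s := by
  obtain ⟨U', hU', hZU', hUU'⟩ := normal_exists_closure_subset hZ hU hZU
  let C : Set (Zᶜ : Set X) := Subtype.val ⁻¹' closure U'
  have hC : IsClosed C := isClosed_closure.preimage continuous_subtype_val
  let f : C(C, ℂ) := ⟨fun x => (κ x.1.1)⁻¹, by
    refine Continuous.inv₀ ?_ fun x => hκ0 _ (hUU' x.2) x.1.2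
    exact hκ.comp_continuous (f := fun x : C => x.1.1) (by fun_prop) fun x => hUU' x.2⟩
  obtain ⟨b, hb⟩ := ContinuousMap.exists_restrict_eq hC f
  obtain ⟨β, hβ, hβb⟩ := exists_extension_of_subtype (0 : ℂ) b.continuous
  refine ⟨⟨hn, Zᶜ, U', hZ.isOpen_compl, hU', fun x => ?_, s, r, κ, β, hs,
    hr.mono (subset_closure.trans hUU'), hκ.mono (subset_closure.trans hUU'), hβ, hs0,
    fun x hx => hr0 x (hUU' (subset_closure hx)),
    fun x hx hx' => hsr x (hUU' (subset_closure hx')) hx, fun x hx hx' => ?_⟩, rfl, rfl⟩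
  · by_cases h : x ∈ Z
    · exact Or.inr (hZU' h)
    · exact Or.inl h
  · have h1 : b ⟨x, hx⟩ = (κ x)⁻¹ := by
      have := DFunLike.congr_fun hb ⟨⟨x, hx⟩, subset_closure hx'⟩
      exact this
    rw [hβb x hx, h1, mul_inv_cancel₀ (hκ0 x (hUU' (subset_closure hx')) hx)]

end HomSurf

end

section

open Filter Topology Polynomial

namespace HomSurf

namespace Sheeted
variable {d : ℕ} (S : Sheeted d)

open unitInterval in
/-- The logarithm of a nonvanishing function along the scaling action. -/
lemma exists_log_scale {G : S.cone → ℂ} (hG : Continuous G) (hG0 : ∀ p, G p ≠ 0) :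
    ∃ M : S.cone × ℂ → ℂ, Continuous M ∧
      ∀ p τ, Complex.exp (M (p, τ)) = G (S.scale τ p) / G p := by
  have hs : Continuous fun q : I × (S.cone × ℂ) => S.scale (((q.1 : ℝ) : ℂ) * q.2.2) q.2.1 :=
    S.continuous_scale.comp (f := fun q : I × (S.cone × ℂ) => (q.2.1, ((q.1 : ℝ) : ℂ) * q.2.2))
      (by fun_prop)
  let H : C(I × (S.cone × ℂ), {z : ℂ // z ≠ 0}) :=
    ⟨fun q => ⟨G (S.scale (((q.1 : ℝ) : ℂ) * q.2.2) q.2.1) / G q.2.1,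
      div_ne_zero (hG0 _) (hG0 _)⟩, by
      refine Continuous.subtype_mk ?_ _
      exact (hG.comp hs).div (by fun_prop) fun q => hG0 _⟩
  have H0 : ∀ a : S.cone × ℂ, H (0, a) =
      ⟨_, Complex.exp_ne_zero ((⟨fun _ => 0, continuous_const⟩ : C(S.cone × ℂ, ℂ)) a)⟩ := fun a => by
    apply Subtype.ext
    simp [H, scale_zero, hG0]
  let L := Complex.isCoveringMap_exp.liftHomotopy H ⟨fun _ => 0, continuous_const⟩ H0
  have hL : ∀ q, (⟨_, Complex.exp_ne_zero (L q)⟩ : {z : ℂ // z ≠ 0}) = H q := fun q =>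
    congrFun (Complex.isCoveringMap_exp.liftHomotopy_lifts H ⟨fun _ => 0, continuous_const⟩ H0) q
  refine ⟨fun a => L (1, a), by fun_prop, fun p τ => ?_⟩
  have := congrArg Subtype.val (hL (1, p, τ))
  simpa [H] using this

/-- A nonvanishing function on the cone does not wind along the orbits of the scaling action. -/
lemma winding_orbit_eq_zero {G : S.cone → ℂ} (hG : Continuous G) (hG0 : ∀ p, G p ≠ 0)
    (q : S.curve) {l : ℂ → ℂ} (hl : Continuous l)
    (hexp : ∀ τ, Complex.exp (l τ) = G (S.scale τ (S.embed q))) {g : ℂ}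
    (hg : ∀ τ, l (τ + period) = l τ + period * g) : g = 0 := by
  obtain ⟨M, hM, hMG⟩ := S.exists_log_scale hG hG0
  have : PreconnectedSpace S.curve := Subtype.preconnectedSpace S.isPreconnected_curve
  let D : S.curve × ℂ × ℂ → ℂ := fun a =>
    M (S.scale a.2.1 (S.embed a.1), a.2.2 + period) - M (S.scale a.2.1 (S.embed a.1), a.2.2)
  have hsc : Continuous fun a : S.curve × ℂ × ℂ => S.scale a.2.1 (S.embed a.1) :=
    S.continuous_scale.comp (f := fun a : S.curve × ℂ × ℂ => (S.embed a.1, a.2.1))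
      ((S.continuous_embed.comp continuous_fst).prodMk (by fun_prop))
  have hD : Continuous D := by
    refine Continuous.sub (hM.comp (hsc.prodMk ?_)) (hM.comp (hsc.prodMk ?_)) <;> fun_prop
  have hper : ∀ τ p, S.scale (τ + period) p = S.scale τ p := fun τ p =>
    S.scale_congr (by rw [Complex.exp_add, exp_period, mul_one]) _
  have hconst : ∀ a b, D a = D b := fun a b =>
    eq_of_exp_comp_eq isPreconnected_univ hD.continuousOn (c := 1) (fun a _ => by
      simp only [D, Complex.exp_sub, hMG, hper]
      exact div_self (div_ne_zero (hG0 _) (hG0 _))) (Set.mem_univ a) (Set.mem_univ b)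
  -- the winding along the given orbit
  have h1 : D (q, 0, 0) = period * g := by
    have hc : Continuous fun τ => M (S.embed q, τ) - l τ :=
      (hM.comp (f := fun τ => (S.embed q, τ)) (by fun_prop)).sub hl
    have := eq_of_exp_comp_eq isPreconnected_univ hc.continuousOn (c := (G (S.embed q))⁻¹)
      (fun τ _ => by
        rw [Complex.exp_sub, hMG, hexp, div_div, mul_comm, ← div_div, div_self (hG0 _), one_div])
      (Set.mem_univ (0 + period)) (Set.mem_univ 0)
    simp only [D, scale_zero]
    linear_combination this + hg 0
  choose P hP hPs using S.exists_disc
  have hlog : ∀ i, ∃ k : ℂ → ℂ, ContinuousOn k (Metric.ball 0 S.δ) ∧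
      ∀ s ∈ Metric.ball (0 : ℂ) S.δ, Complex.exp (k s) = G (P i s) := fun i =>
    exists_log_of_convex (convex_ball 0 S.δ) (hG.comp_continuousOn (hP i)) fun s _ => hG0 _
  choose k hk hkP using hlog
  obtain ⟨Γ, hΓ, hΓG⟩ := exists_extension_of_subtype (0 : ℂ) (hG.comp S.continuous_embed)
  set ρ₀ := -Real.log S.δ
  have hball : Set.MapsTo (fun τ : ℂ => Complex.exp (-τ)) {τ | ρ₀ < τ.re} (Metric.ball 0 S.δ) :=
    fun τ hτ => S.exp_neg_mem_ball hτ
  have hexpc : ContinuousOn (fun τ : ℂ => Complex.exp (-τ)) {τ | ρ₀ < τ.re} := by fun_prop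
  have hscale : ∀ i (τ : ℂ) (hτ : ρ₀ < τ.re), S.scale τ (P i (Complex.exp (-τ))) =
      S.embed ⟨S.endp i (Complex.exp τ), S.endp_mem i (S.large_exp hτ)⟩ := fun i τ hτ =>
    S.scale_end hτ (hPs i _ (hball hτ))
  have hsum := S.sum_winding_eq_zero hΓ (fun q hq => by rw [hΓG q hq]; exact hG0 _) (ρ := ρ₀)
    (Λ := fun i τ => k i (Complex.exp (-τ)) + M (P i (Complex.exp (-τ)), τ))
    (fun i => ((hk i).comp hexpc hball).add (hM.comp_continuousOn
      (((hP i).comp hexpc hball).prodMk continuousOn_id)))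
    (fun i τ hτ => by
      rw [Complex.exp_add, hkP i _ (hball hτ), hMG, mul_div_cancel₀ _ (hG0 _), hscale i τ hτ,
        hΓG _ (S.endp_mem i (S.large_exp hτ))]
      rfl)
    (g := fun _ => g) (fun i τ hτ => by
      have h2 := hconst (⟨S.endp i (Complex.exp τ), S.endp_mem i (S.large_exp hτ)⟩, -τ, τ) (q, 0, 0)
      rw [h1] at h2
      simp only [D, ← hscale i τ hτ, scale_scale, add_neg_cancel, scale_zero] at h2
      rw [neg_add, Complex.exp_add, Complex.exp_neg period, exp_period, inv_one, mul_one]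
      linear_combination h2)
  rw [Finset.sum_const, Finset.card_univ, Fintype.card_fin, nsmul_eq_mul, mul_eq_zero] at hsum
  exact hsum.resolve_left (Nat.cast_ne_zero.2 S.pos.ne')

end Sheeted
end HomSurf

end

section

open Filter Topology Polynomial

namespace HomSurf

/-- Only trivial characters of the covering are represented by nonvanishing functions. -/
def CyclicCover.Faithful {n : ℕ} {X Y : Type} [TopologicalSpace X] [TopologicalSpace Y]
    (Q : CyclicCover n X Y) : Prop :=
  ∀ k : ℕ, 0 < k → k < n → ¬ ∃ u : Y → ℂ, Continuous u ∧
    ∀ y, u y ≠ 0 ∧ u (Q.σ y) = unityRoot n ^ k * u y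

namespace Sheeted
variable {d : ℕ} (S : Sheeted d)

lemma normalize_mem {p : S.cone} (h : p.1.2.1 ≠ 0) :
    (p.1.1 / p.1.2.1, p.1.2.2 / p.1.2.1) ∈ S.curve := by
  have := S.homog (inv_ne_zero h) p.2.2
  rw [inv_mul_cancel₀ h, inv_mul_eq_div, inv_mul_eq_div] at this
  exact this

lemma normalize_eq_endp {p : S.cone} {i : Fin d} (h : p.1.2.1 ≠ 0)
    (hz : p.1.2.2 = S.sheet i p.1.1 p.1.2.1) :
    (p.1.1 / p.1.2.1, p.1.2.2 / p.1.2.1) = S.endp i (p.1.1 / p.1.2.1) := by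
  refine Prod.ext rfl ?_
  have := S.sheet_mul i (x := p.1.1) (y := p.1.2.1) (inv_ne_zero h)
  rw [inv_mul_cancel₀ h, inv_mul_eq_div, inv_mul_eq_div, ← hz] at this
  exact this.symm

/-- The cone carries a function of degree one with a single zero of order `d` at infinity. -/
lemma exists_glueData_cone : ∃ D : GlueData d S.cone, ∃ h : ℂ × ℂ → ℂ,
    ∀ p : S.cone, p.1.2.1 ≠ 0 → p ∈ D.U₁ ∧
      D.s p = p.1.2.1 * h (p.1.1 / p.1.2.1, p.1.2.2 / p.1.2.1) := by
  classical
  let o : Fin d := ⟨0, S.pos⟩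
  let a : Fin d → ℤ := fun i => if i = o then 1 - d else 1
  have ha : ∑ i, a i = 0 := by
    have : ∀ i, a i = 1 - if i = o then (d : ℤ) else 0 := fun i => by
      simp only [a]; split_ifs <;> ring
    simp [this, Finset.sum_sub_distrib]
  obtain ⟨h, hh, hh0, ρ, hρ⟩ := S.exists_prescribed_ends (ρ := 0) (N := fun i τ => a i * τ)
    (fun i => by fun_prop) ha (fun i τ _ => by ring)
  have hend : ∀ i (x : ℂ), x ≠ 0 → ρ < Real.log ‖x‖ → h (S.endp i x) = x ^ a i := fun i x hx hx' => by
    have := hρ i (Complex.log x) (by rwa [Complex.log_re])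
    rwa [Complex.exp_log hx, Complex.exp_int_mul, Complex.exp_log hx] at this
  let s : S.cone → ℂ := fun p =>
    if p.1.2.1 = 0 then p.1.1 else p.1.2.1 * h (p.1.1 / p.1.2.1, p.1.2.2 / p.1.2.1)
  let near : Fin d → Set S.cone := fun i => {p | ((p.1.1, p.1.2.1) ∈ S.far ∧
    ‖p.1.2.1 / p.1.1‖ < Real.exp (-ρ)) ∧ p.1.2.2 = S.sheet i p.1.1 p.1.2.1}
  have hs_near : ∀ i, ∀ p ∈ near i, p.1.2.1 ≠ 0 → s p = p.1.2.1 * (p.1.1 / p.1.2.1) ^ a i := by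
    rintro i p ⟨⟨h1, h2⟩, h3⟩ hy
    have hx : p.1.1 ≠ 0 := h1.1
    simp only [s, if_neg hy]
    rw [S.normalize_eq_endp hy h3, hend i _ (div_ne_zero hx hy)]
    rw [← inv_div, norm_inv, Real.log_inv]
    have := (Real.log_lt_iff_lt_exp (norm_pos_iff.2 (div_ne_zero hy hx))).2 h2
    linarith
  have hnear : ∀ i, IsOpen (near i) := fun i => by
    rw [isOpen_iff_mem_nhds]
    rintro p ⟨⟨h1, h2⟩, h3⟩
    have hx : p.1.1 ≠ 0 := h1.1
    have e1 := (show ContinuousAt (fun p : S.cone => p.1) p by fun_prop).eventually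
      (S.eventually_sheet h1 h3)
    have e2 := (show ContinuousAt (fun p : S.cone => (p.1.1, p.1.2.1)) p by fun_prop).eventually
      (S.isOpen_far.mem_nhds h1)
    have e3 : ContinuousAt (fun p : S.cone => ‖p.1.2.1 / p.1.1‖) p :=
      (ContinuousAt.div (f := fun p : S.cone => p.1.2.1) (g := fun p : S.cone => p.1.1)
        (by fun_prop) (by fun_prop) hx).norm
    filter_upwards [e1, e2, e3.eventually_lt continuousAt_const h2] with q a b c
    exact ⟨⟨b, c⟩, a q.2.2⟩
  have hmem : ∀ p : S.cone, p.1.2.1 = 0 → p.1.1 ≠ 0 ∧ ∃ i, p ∈ near i := fun p hy => by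
    have hx : p.1.1 ≠ 0 := p.2.1.resolve_right (not_not.2 hy)
    have hfar : (p.1.1, p.1.2.1) ∈ S.far := ⟨hx, by simpa [hy] using S.δ_pos⟩
    obtain ⟨i, hi⟩ := S.exists_sheet hfar p.2.2
    exact ⟨hx, i, ⟨hfar, by simpa [hy] using Real.exp_pos _⟩, hi⟩
  let Z : Set S.cone := {p | p.1.2.1 = 0 ∧ p.1.2.2 = p.1.1 * S.ζ o 0}
  have hZ : IsClosed Z := (isClosed_eq (by fun_prop) continuous_const).inter
    (isClosed_eq (by fun_prop) (by fun_prop))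
  have hZiff : ∀ p : S.cone, p.1.2.1 = 0 → p ∈ near o → p ∈ Z := fun p hy hp => by
    refine ⟨hy, ?_⟩
    rw [hp.2, sheet, hy, zero_div]
  have hZU : Z ⊆ near o := fun p hp => by
    obtain ⟨hx, i, hi⟩ := hmem p hp.1
    refine ⟨hi.1, ?_⟩
    rw [hp.2, sheet, hp.1, zero_div]
  have hs0 : ∀ p ∉ Z, s p ≠ 0 := fun p hp => by
    simp only [s]
    split_ifs with hy
    · exact (hmem p hy).1
    · exact mul_ne_zero hy (hh0 _ (S.normalize_mem hy))
  have hsc : ContinuousOn s Zᶜ := by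
    refine ContinuousOn.mono (s := {p | p.1.2.1 ≠ 0} ∪ ⋃ i ∈ {i | i ≠ o}, near i) ?_ fun p hp => ?_
    · have hopen : IsOpen {p : S.cone | p.1.2.1 ≠ 0} :=
        isOpen_ne_fun (by fun_prop) continuous_const
      refine ContinuousOn.union_of_isOpen ?_ ?_ hopen
        (isOpen_biUnion fun i _ => hnear i)
      · have h1 : ContinuousOn (fun p : S.cone => p.1.2.1 *
            h (p.1.1 / p.1.2.1, p.1.2.2 / p.1.2.1)) {p | p.1.2.1 ≠ 0} := by
          refine ContinuousOn.mul (by fun_prop) (hh.comp (f := fun p : S.cone =>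
            (p.1.1 / p.1.2.1, p.1.2.2 / p.1.2.1)) ?_ fun p hp => S.normalize_mem hp)
          exact (ContinuousOn.div (by fun_prop) (by fun_prop) fun p hp => hp).prodMk
            (ContinuousOn.div (by fun_prop) (by fun_prop) fun p hp => hp)
        exact h1.congr fun p hp => if_neg hp
      · have h1 : ContinuousOn (fun p : S.cone => p.1.1) (⋃ i ∈ {i | i ≠ o}, near i) := by fun_prop
        refine h1.congr fun p hp => ?_
        simp only [Set.mem_iUnion] at hp
        obtain ⟨i, hi, hp⟩ := hp
        have hi' : i ≠ o := hi
        by_cases hy : p.1.2.1 = 0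
        · exact if_pos hy
        · rw [hs_near i p hp hy]
          simp only [a, if_neg hi', zpow_one]
          exact mul_div_cancel₀ _ hy
    · by_cases hy : p.1.2.1 = 0
      · obtain ⟨-, i, hi⟩ := hmem p hy
        refine Or.inr (Set.mem_biUnion (x := i) ?_ hi)
        rintro rfl
        exact hp (hZiff p hy hi)
      · exact Or.inl hy
  have hyU : ∀ p ∈ near o, p ∉ Z → p.1.2.1 ≠ 0 := fun p hp hpZ hy => hpZ (hZiff p hy hp)
  obtain ⟨D, hD1, hD2⟩ := exists_glueData S.pos hZ (hnear o) hZU hsc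
    (r := fun p => p.1.1) (κ := fun p => p.1.2.1 / p.1.1) (by fun_prop)
    (ContinuousOn.div (by fun_prop) (by fun_prop) fun p hp => hp.1.1.1) hs0
    (fun p hp => hp.1.1.1) (fun p hp hpZ => div_ne_zero (hyU p hp hpZ) hp.1.1.1)
    (fun p hp hpZ => by
      have hy := hyU p hp hpZ
      have hx : p.1.1 ≠ 0 := hp.1.1.1
      rw [hs_near o p hp hy]
      simp only [a, if_true]
      rw [zpow_sub₀ (div_ne_zero hx hy), zpow_one, zpow_natCast, ← inv_div p.1.1, inv_pow]
      field_simp)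
  refine ⟨D, h, fun p hy => ⟨?_, ?_⟩⟩
  · rw [hD1]
    exact fun hp => hy hp.1
  · rw [hD2]
    exact if_neg hy

/-- The cone has a faithful cyclic covering of order `d`. -/
theorem exists_faithful : ∃ (Y : Type) (_ : TopologicalSpace Y) (Q : CyclicCover d S.cone Y),
    Q.Faithful := by
  obtain ⟨D, h, hD⟩ := S.exists_glueData_cone
  refine ⟨D.total, inferInstance, D.cyclicCover, fun k hk hkd => ?_⟩
  rintro ⟨u, hu, hu'⟩
  have hd : (d : ℂ) ≠ 0 := Nat.cast_ne_zero.2 S.pos.ne'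
  have hroot : ∀ k, (unityRoot d ^ k) ^ d = 1 := fun k => by
    rw [← pow_mul, mul_comm, pow_mul, (isPrimitiveRoot_unityRoot S.pos).pow_eq_one, one_pow]
  obtain ⟨G, hG, hGu⟩ := D.cyclicCover.exists_descent (A := Set.univ) (f := fun y => u y ^ d)
    (hu.pow d).continuousOn (fun y _ => by rw [(hu' y).2, mul_pow, hroot, one_mul])
  obtain ⟨p⟩ : Nonempty S.curve := by
    obtain ⟨r, hr⟩ := exists_eq_prod (S.monic 0 1) (S.natDegree_eq 0 1)
    refine ⟨⟨(0, r ⟨0, S.pos⟩), ?_⟩⟩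
    show (S.F 0 1).IsRoot _
    rw [hr, isRoot_prod_iff]
    exact ⟨_, rfl⟩
  have hone : ∀ τ, (S.scale τ (S.embed p)).1.2.1 = Complex.exp τ := fun τ => by
    simp [embed]
  have hDτ := fun τ => hD (S.scale τ (S.embed p)) (by rw [hone]; exact Complex.exp_ne_zero τ)
  have hs : ∀ τ, D.s (S.scale τ (S.embed p)) = Complex.exp τ * D.s (S.embed p) := fun τ => by
    have h0 := (hDτ 0).2
    rw [scale_zero] at h0
    rw [(hDτ τ).2, h0, hone]
    simp only [scale, embed, mul_one, div_one]
    rw [mul_div_cancel_left₀ _ (Complex.exp_ne_zero τ), mul_div_cancel_left₀ _ (Complex.exp_ne_zero τ),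
      one_mul]
  obtain ⟨a, ha⟩ := IsAlgClosed.exists_pow_nat_eq (D.s (S.embed p)) S.pos
  have hm : ∀ τ : ℂ, (S.scale τ (S.embed p), a * Complex.exp (τ / d),
      D.β (S.scale τ (S.embed p)) * (a * Complex.exp (τ / d))) ∈ D.total := fun τ =>
    (D.mem_total₁ (hDτ τ).1).2 ⟨by
      rw [mul_pow, ha, ← Complex.exp_nat_mul, mul_div_cancel₀ _ hd, hs, mul_comm], rfl⟩
  let γ : ℂ → D.total := fun τ => ⟨_, hm τ⟩
  have hsc : Continuous fun τ => S.scale τ (S.embed p) :=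
    S.continuous_scale.comp (f := fun τ => (S.embed p, τ)) (by fun_prop)
  have hγ : Continuous γ := by
    refine Continuous.subtype_mk (hsc.prodMk (Continuous.prodMk (by fun_prop) ?_)) _
    exact (D.β_cont.comp_continuous hsc fun τ => (hDτ τ).1).mul (by fun_prop)
  have hγσ : ∀ τ, γ (τ + period) = D.cyclicCover.σ (γ τ) := fun τ => by
    apply Subtype.ext
    show _ = ((γ τ).1.1, unityRoot d • (γ τ).1.2)
    have h1 : S.scale (τ + period) (S.embed p) = S.scale τ (S.embed p) :=
      S.scale_congr (by rw [Complex.exp_add, exp_period, mul_one]) _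
    have h2 : Complex.exp ((τ + period) / d) = unityRoot d * Complex.exp (τ / d) := by
      rw [add_div, Complex.exp_add, mul_comm, unityRoot]
    simp only [γ, h1, h2]
    refine Prod.ext rfl (Prod.ext ?_ ?_)
    · simp only [Prod.smul_mk, smul_eq_mul]; ring
    · simp only [Prod.smul_mk, smul_eq_mul]; ring
  obtain ⟨l, hl, hlu⟩ := exists_log_of_convex convex_univ (hu.comp hγ).continuousOn
    fun τ _ => (hu' (γ τ)).1
  rw [continuousOn_univ] at hl
  have hlu : ∀ τ, Complex.exp (l τ) = u (γ τ) := fun τ => hlu τ (Set.mem_univ τ)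
  have hstep : ∀ τ, Complex.exp (l (τ + period)) =
      Complex.exp (k * (period / d)) * Complex.exp (l τ) := fun τ => by
    rw [hlu, hlu, hγσ, (hu' _).2, Complex.exp_nat_mul, unityRoot]
  have h0 := hstep 0
  rw [← Complex.exp_add, Complex.exp_eq_exp_iff_exists_int] at h0
  obtain ⟨m, hm0⟩ := h0
  have hturn : ∀ τ, l (τ + period) - l τ = l (0 + period) - l 0 := fun τ => by
    have hc : Continuous fun τ => l (τ + period) - l τ := (hl.comp (by fun_prop)).sub hl
    exact eq_of_exp_comp_eq isPreconnected_univ hc.continuousOn (c := Complex.exp (k * (period / d)))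
      (fun τ _ => by rw [Complex.exp_sub, hstep τ, mul_div_cancel_right₀ _ (Complex.exp_ne_zero _)])
      (Set.mem_univ τ) (Set.mem_univ 0)
  have hzero := S.winding_orbit_eq_zero (continuousOn_univ.1 hG) (fun x => by
      obtain ⟨y, rfl⟩ := D.cyclicCover.surjective x
      rw [← hGu y (Set.mem_univ _)]
      exact pow_ne_zero _ (hu' y).1) p (l := fun τ => d * l τ) (continuous_const.mul hl)
    (fun τ => by
      rw [Complex.exp_nat_mul, hlu]
      exact hGu (γ τ) (Set.mem_univ _))
    (g := k + d * m) (fun τ => by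
      have := hturn τ
      have e : (d : ℂ) * (period / d) = period := mul_div_cancel₀ _ hd
      linear_combination d * this + d * hm0 + k * e)
  have hz : (k : ℤ) + d * m = 0 := by exact_mod_cast hzero
  have hdvd : (d : ℤ) ∣ k := ⟨-m, by linarith⟩
  exact absurd (Nat.le_of_dvd hk (Int.natCast_dvd_natCast.1 hdvd)) (not_le.2 hkd)

/-- The degree is an upper bound for the orders of faithful cyclic coverings. -/
theorem le_of_faithful {n : ℕ} {Y : Type} [TopologicalSpace Y] (Q : CyclicCover n S.cone Y)
    (hQ : Q.Faithful) : n ≤ d := by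
  by_contra h
  exact hQ d S.pos (not_le.1 h) (S.exists_equivariant_pow Q)

/-- The degree of the cone is a topological invariant. -/
theorem degree_le {e : ℕ} (S' : Sheeted e) (φ : S.cone ≃ₜ S'.cone) : d ≤ e := by
  obtain ⟨Y, _, Q, hQ⟩ := S.exists_faithful
  exact S'.le_of_faithful (Q.map φ) hQ

end Sheeted
end HomSurf

end

section

open Filter Topology Polynomial

namespace HomSurf

/-- Nonnegative functions of polynomial growth. -/
def PolyGrowth (u : ℂ → ℝ) : Prop :=
  ∃ K : ℝ, ∃ N : ℕ, ∀ x, 0 ≤ u x ∧ u x ≤ K * (1 + ‖x‖) ^ N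

namespace PolyGrowth

lemma const {c : ℝ} (hc : 0 ≤ c) : PolyGrowth fun _ => c := ⟨c, 0, fun x => by simp [hc]⟩

lemma id_norm : PolyGrowth fun x => ‖x‖ := ⟨1, 1, fun x => by simp⟩

lemma add {u v : ℂ → ℝ} (hu : PolyGrowth u) (hv : PolyGrowth v) :
    PolyGrowth fun x => u x + v x := by
  obtain ⟨K, N, h⟩ := hu
  obtain ⟨L, M, k⟩ := hv
  refine ⟨|K| + |L|, max N M, fun x => ⟨add_nonneg (h x).1 (k x).1, ?_⟩⟩
  have h1 : (1 : ℝ) ≤ 1 + ‖x‖ := by linarith [norm_nonneg x]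
  have a1 := pow_le_pow_right₀ h1 (le_max_left N M)
  have a2 := pow_le_pow_right₀ h1 (le_max_right N M)
  rw [add_mul]
  refine add_le_add ((h x).2.trans ?_) ((k x).2.trans ?_)
  · exact mul_le_mul (le_abs_self K) a1 (by positivity) (abs_nonneg K)
  · exact mul_le_mul (le_abs_self L) a2 (by positivity) (abs_nonneg L)

lemma mul {u v : ℂ → ℝ} (hu : PolyGrowth u) (hv : PolyGrowth v) :
    PolyGrowth fun x => u x * v x := by
  obtain ⟨K, N, h⟩ := hu
  obtain ⟨L, M, k⟩ := hv
  refine ⟨K * L, N + M, fun x => ⟨mul_nonneg (h x).1 (k x).1, ?_⟩⟩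
  calc u x * v x ≤ (K * (1 + ‖x‖) ^ N) * (L * (1 + ‖x‖) ^ M) :=
        mul_le_mul (h x).2 (k x).2 (k x).1 ((h x).1.trans (h x).2)
    _ = _ := by ring

lemma pow {u : ℂ → ℝ} (hu : PolyGrowth u) (n : ℕ) : PolyGrowth fun x => u x ^ n := by
  induction n with
  | zero => simpa using const zero_le_one
  | succ n ih => simpa [pow_succ] using ih.mul hu

lemma sum {ι : Type*} (s : Finset ι) {u : ι → ℂ → ℝ} (hu : ∀ i, PolyGrowth (u i)) :
    PolyGrowth fun x => ∑ i ∈ s, u i x := by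
  classical
  induction s using Finset.induction_on with
  | empty => simpa using const le_rfl
  | insert a s ha ih => simpa [Finset.sum_insert ha] using (hu a).add ih

lemma mono {u v : ℂ → ℝ} (hv : PolyGrowth v) (h0 : ∀ x, 0 ≤ u x) (h : ∀ x, u x ≤ v x) :
    PolyGrowth u := by
  obtain ⟨K, N, k⟩ := hv
  exact ⟨K, N, fun x => ⟨h0 x, (h x).trans (k x).2⟩⟩

lemma eval (p : ℂ[X]) : PolyGrowth fun x => ‖p.eval x‖ := by
  refine (sum (Finset.range (p.natDegree + 1))
    fun i => (const (norm_nonneg (p.coeff i))).mul (id_norm.pow i)).mono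
    (fun x => norm_nonneg _) fun x => ?_
  rw [eval_eq_sum_range]
  exact (norm_sum_le _ _).trans (Finset.sum_le_sum fun i _ => by rw [norm_mul, norm_pow])

end PolyGrowth

/-- An entire function of polynomial growth is a polynomial. -/
lemma exists_polynomial_of_growth {f : ℂ → ℂ} (hf : Differentiable ℂ f)
    (hg : PolyGrowth fun x => ‖f x‖) : ∃ p : ℂ[X], ∀ x, p.eval x = f x := by
  obtain ⟨K, N, h⟩ := hg
  have hK : 0 ≤ K := by
    have := (h 0).1.trans (h 0).2
    simpa using this
  have hz : ∀ n, N < n → iteratedDeriv n f 0 = 0 := fun n hn => by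
    have hb : ∀ R : ℝ, 1 ≤ R → ‖iteratedDeriv n f 0‖ ≤ (n.factorial * (K * 2 ^ N)) / R :=
      fun R hR => by
      have hR0 : 0 < R := by linarith
      refine (Complex.norm_iteratedDeriv_le_of_forall_mem_sphere_norm_le n hR0
        hf.diffContOnCl (C := K * (2 * R) ^ N) fun z hz => ?_).trans ?_
      · refine (h z).2.trans (mul_le_mul_of_nonneg_left ?_ hK)
        have : ‖z‖ = R := by simpa using hz
        exact pow_le_pow_left₀ (by positivity) (by linarith) _
      · rw [div_le_div_iff₀ (by positivity) hR0, mul_pow]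
        have : R ^ N * R ≤ R ^ n := by
          rw [← pow_succ]; exact pow_le_pow_right₀ hR hn
        calc _ = (n.factorial * (K * 2 ^ N)) * (R ^ N * R) := by ring
          _ ≤ _ := mul_le_mul_of_nonneg_left this (by positivity)
    have ht : Tendsto (fun R : ℝ => (n.factorial * (K * 2 ^ N)) / R) atTop (𝓝 0) :=
      tendsto_const_nhds.div_atTop tendsto_id
    have := ge_of_tendsto ht ((eventually_ge_atTop 1).mono hb)
    exact norm_le_zero_iff.1 this
  refine ⟨∑ n ∈ Finset.range (N + 1), C ((n.factorial : ℂ)⁻¹ * iteratedDeriv n f 0) * X ^ n,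
    fun x => ?_⟩
  rw [← Complex.taylorSeries_eq_of_entire' 0 x hf, tsum_eq_sum (s := Finset.range (N + 1))]
  · simp [eval_finsetSum]
  · intro n hn
    rw [hz n (by simpa using hn)]; simp

/-- A continuous branch of simple roots is differentiable. -/
lemma differentiableAt_branch {h : ℂ[X][X]} {a : ℂ} {ρ : ℂ → ℂ} (hρ : ContinuousAt ρ a)
    (hroot : ∀ᶠ x in 𝓝 a, (h.map (evalRingHom x)).IsRoot (ρ x))
    (hs : (h.map (evalRingHom a)).derivative.eval (ρ a) ≠ 0) : DifferentiableAt ℂ ρ a := by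
  have h0 : (h.map (evalRingHom a)).IsRoot (ρ a) := hroot.self_of_nhds
  obtain ⟨q, hq⟩ := dvd_iff_isRoot.2 h0
  have hq0 : q.eval (ρ a) ≠ 0 := by
    rw [hq] at hs; simpa using hs
  obtain ⟨A, hA⟩ : C (X - C a) ∣ h - (h.map (evalRingHom a)).map C := by
    rw [C_dvd_iff_dvd_coeff]
    intro i
    rw [dvd_iff_isRoot]; simp
  have key : ∀ x z, (h.map (evalRingHom x)).eval z =
      (z - ρ a) * q.eval z + (x - a) * (A.map (evalRingHom x)).eval z := fun x z => by
    have e := congrArg (fun P : ℂ[X][X] => (P.map (evalRingHom x)).eval z) hA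
    have e2 := congrArg (fun P : ℂ[X] => P.eval z) hq
    have e3 : (evalRingHom x).comp (C.comp (evalRingHom a)) = evalRingHom a := by ext <;> simp
    simp only [Polynomial.map_sub, Polynomial.map_mul, Polynomial.map_map, e3,
      eval_sub, eval_mul, map_C, eval_C, coe_evalRingHom, eval_X] at e e2
    linear_combination e + e2
  have hAc : ContinuousAt (fun x => (A.map (evalRingHom x)).eval (ρ x)) a := by
    simp only [eval_map, eval₂_eq_sum_range, coe_evalRingHom]
    exact tendsto_finsetSum _ fun i _ =>
      (A.coeff i).continuous.continuousAt.mul (hρ.pow i)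
  have hqc : ContinuousAt (fun x => q.eval (ρ x)) a := q.continuous.continuousAt.comp hρ
  refine HasDerivAt.differentiableAt (f' := -(A.map (evalRingHom a)).eval (ρ a) / q.eval (ρ a)) ?_
  rw [hasDerivAt_iff_tendsto_slope]
  have hl : ContinuousAt
      (fun x => -(A.map (evalRingHom x)).eval (ρ x) / q.eval (ρ x)) a := hAc.neg.div hqc hq0
  refine (hl.tendsto.mono_left nhdsWithin_le_nhds).congr' ?_
  filter_upwards [nhdsWithin_le_nhds hroot, nhdsWithin_le_nhds (hqc.eventually_ne hq0),
    self_mem_nhdsWithin] with x h1 h2 h3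
  have h4 : x - a ≠ 0 := sub_ne_zero.2 h3
  have h5 := key x (ρ x)
  rw [h1.eq_zero] at h5
  rw [slope_def_field, div_eq_div_iff h2 h4]
  linear_combination h5

end HomSurf

end

section

open Filter Topology Polynomial

namespace HomSurf

lemma norm_prod_sub_roots_le {p : ℂ[X]} (hp : p.Monic) (T : ℂ) {s : Finset ℂ}
    (hs : ∀ z ∈ s, p.IsRoot z) :
    ‖∏ z ∈ s, (T - z)‖ ≤
      (‖T‖ + (∑ k ∈ Finset.range p.natDegree, ‖p.coeff k‖ + 1)) ^ p.natDegree := by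
  set M := ∑ k ∈ Finset.range p.natDegree, ‖p.coeff k‖ with hM
  have hM0 : 0 ≤ M := Finset.sum_nonneg fun _ _ => norm_nonneg _
  have hcard : s.card ≤ p.natDegree := by
    refine (Finset.card_le_card (t := p.roots.toFinset) fun z hz => ?_).trans
      ((Multiset.toFinset_card_le _).trans (card_roots' p))
    simpa [hp.ne_zero] using hs z hz
  rw [norm_prod]
  calc ∏ z ∈ s, ‖T - z‖ ≤ ∏ z ∈ s, (‖T‖ + (M + 1)) := by
        refine Finset.prod_le_prod (fun _ _ => norm_nonneg _) fun z hz => ?_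
        refine (norm_sub_le _ _).trans ?_
        gcongr
        refine norm_root_le hp hM0 ?_ (hs z hz)
        exact fun k hk => Finset.single_le_sum (f := fun k => ‖p.coeff k‖)
          (fun _ _ => norm_nonneg _) (Finset.mem_range.2 hk)
    _ = (‖T‖ + (M + 1)) ^ s.card := by rw [Finset.prod_const]
    _ ≤ _ := pow_le_pow_right₀ (by linarith [norm_nonneg T]) hcard

/-- The product over the roots lying in one part of a clopen partition of the unbranched curve is,
up to a power of the discriminant, a polynomial. -/
lemma exists_partial_product {h : ℂ[X][X]} (hm : h.Monic) {D : ℂ[X]}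
    (hsep : ∀ x, D.eval x ≠ 0 → (h.map (evalRingHom x)).Separable) {U V : Set (ℂ × ℂ)}
    [∀ q, Decidable (q ∈ U)]
    (hU : IsOpen U) (hV : IsOpen V)
    (hUV : ∀ x z, D.eval x ≠ 0 → (h.map (evalRingHom x)).IsRoot z → (x, z) ∉ U → (x, z) ∈ V)
    (hdisj : ∀ x z, D.eval x ≠ 0 → (h.map (evalRingHom x)).IsRoot z → (x, z) ∈ U → (x, z) ∉ V) :
    ∃ P : ℂ[X][X], ∀ x, P.map (evalRingHom x) = C (D.eval x ^ 2) *
      ∏ z ∈ (h.map (evalRingHom x)).roots.toFinset with (x, z) ∈ U, (X - C z) := by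
  have hmx : ∀ x, (h.map (evalRingHom x)).Monic := fun x => hm.map _
  have hdx : ∀ x, (h.map (evalRingHom x)).natDegree = h.natDegree := fun x => hm.natDegree_map _
  have hcx : ∀ k, Continuous fun x => (h.map (evalRingHom x)).coeff k := fun k => by
    simpa using (h.coeff k).continuous
  set R : ℂ → Finset ℂ := fun x => {z ∈ (h.map (evalRingHom x)).roots.toFinset | (x, z) ∈ U}
    with hR
  have hRmem : ∀ x z, z ∈ R x ↔ (h.map (evalRingHom x)).IsRoot z ∧ (x, z) ∈ U := fun x z => by
    simp [hR, (hmx x).ne_zero]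
  set W : ℂ → ℂ → ℝ := fun T x =>
    (‖T‖ + (∑ k ∈ Finset.range h.natDegree, ‖(h.coeff k).eval x‖ + 1)) ^ h.natDegree with hW
  have hbound : ∀ T x, ‖∏ z ∈ R x, (T - z)‖ ≤ W T x := fun T x => by
    have := norm_prod_sub_roots_le (hmx x) T (s := R x) fun z hz => ((hRmem x z).1 hz).1
    simpa [hW, hdx] using this
  have hWc : ∀ T, Continuous (W T) := fun T => by
    simp only [hW]
    have : ∀ k, Continuous fun x => (h.coeff k).eval x := fun k => (h.coeff k).continuous
    fun_prop
  have hWg : ∀ T, PolyGrowth (W T) := fun T =>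
    ((PolyGrowth.const (norm_nonneg T)).add ((PolyGrowth.sum _ fun k =>
      PolyGrowth.eval (h.coeff k)).add (PolyGrowth.const zero_le_one))).pow _
  have hdiff : ∀ T, Differentiable ℂ fun x => D.eval x ^ 2 * ∏ z ∈ R x, (T - z) := fun T a => by
    by_cases ha : D.eval a = 0
    · obtain ⟨q, hq⟩ := dvd_iff_isRoot.2 ha
      refine HasDerivAt.differentiableAt (f' := 0) ?_
      rw [hasDerivAt_iff_tendsto_slope]
      have ht : Tendsto (fun x => ‖x - a‖ * (‖q.eval x‖ ^ 2 * W T x)) (𝓝[≠] a) (𝓝 0) := by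
        have hc : Continuous fun x => ‖x - a‖ * (‖q.eval x‖ ^ 2 * W T x) := by
          have := q.continuous
          have := hWc T
          fun_prop
        have := (hc.tendsto a).mono_left (nhdsWithin_le_nhds (s := {a}ᶜ))
        simpa using this
      refine squeeze_zero_norm' ?_ ht
      filter_upwards [self_mem_nhdsWithin] with x hx
      have hx' : x - a ≠ 0 := sub_ne_zero.2 hx
      have e : slope (fun x => D.eval x ^ 2 * ∏ z ∈ R x, (T - z)) a x =
          (x - a) * (q.eval x ^ 2 * ∏ z ∈ R x, (T - z)) := by
        rw [slope_def_field, ha, hq]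
        simp only [eval_mul, eval_sub, eval_X, eval_C]
        field_simp
        ring
      rw [e, norm_mul, norm_mul, norm_pow]
      gcongr
      exact hbound T x
    · obtain ⟨V', hV'o, haV', ρ, hρ, hρc, hρi⟩ :=
        exists_local_splitting hmx hdx hcx a (hsep a ha)
      have hroot : ∀ x i, (h.map (evalRingHom x)).IsRoot (ρ x i) := fun x i => by
        rw [hρ x]; exact isRoot_prod_iff.2 ⟨i, rfl⟩
      have hρa : ∀ i, ContinuousAt (fun x => ρ x i) a := fun i =>
        (continuousAt_pi.1 (hρc.continuousAt (hV'o.mem_nhds haV'))) i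
      have hρd : ∀ i, DifferentiableAt ℂ (fun x => ρ x i) a := fun i => by
        refine differentiableAt_branch (h := h) (hρa i) (Eventually.of_forall fun x => hroot x i) ?_
        have := (hsep a ha).eval₂_derivative_ne_zero (RingHom.id ℂ) (x := ρ a i)
          (by simpa using hroot a i)
        simpa using this
      have hpair : ∀ i, ContinuousAt (fun x => (x, ρ x i)) a := fun i =>
        continuousAt_id.prodMk (hρa i)
      have hD : ∀ᶠ x in 𝓝 a, D.eval x ≠ 0 := D.continuous.continuousAt.eventually_ne ha
      have hloc : ∀ᶠ x in 𝓝 a, ∀ i, (x, ρ x i) ∈ U ↔ (a, ρ a i) ∈ U := by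
        rw [eventually_all]
        intro i
        by_cases hi : (a, ρ a i) ∈ U
        · filter_upwards [(hpair i).eventually (hU.mem_nhds hi)] with x hx
          exact ⟨fun _ => hi, fun _ => hx⟩
        · filter_upwards [(hpair i).eventually (hV.mem_nhds (hUV _ _ ha (hroot a i) hi)), hD]
            with x hx hDx
          have : (x, ρ x i) ∉ U := fun hxU => hdisj _ _ hDx (hroot x i) hxU hx
          simp [hi, this]
      have hev : (fun x => D.eval x ^ 2 * ∏ z ∈ R x, (T - z)) =ᶠ[𝓝 a]
          fun x => D.eval x ^ 2 * ∏ i with (a, ρ a i) ∈ U, (T - ρ x i) := by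
        filter_upwards [hloc, hV'o.mem_nhds haV'] with x hx hxV
        congr 1
        have : R x = Finset.image (ρ x) {i | (a, ρ a i) ∈ U} := by
          ext z
          rw [hRmem, Finset.mem_image, hρ x, isRoot_prod_iff]
          constructor
          · rintro ⟨⟨i, rfl⟩, hz⟩
            exact ⟨i, by simpa using (hx i).1 hz, rfl⟩
          · rintro ⟨i, hi, rfl⟩
            exact ⟨⟨i, rfl⟩, (hx i).2 (by simpa using hi)⟩
        rw [this, Finset.prod_image (hρi x hxV).injOn]
      refine DifferentiableAt.congr_of_eventuallyEq ?_ hev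
      refine (D.differentiable.differentiableAt.pow 2).mul ?_
      exact DifferentiableAt.fun_finsetProd fun i _ => (differentiableAt_const T).sub (hρd i)
  have hpoly : ∀ T, ∃ p : ℂ[X], ∀ x, p.eval x = D.eval x ^ 2 * ∏ z ∈ R x, (T - z) := fun T =>
    exists_polynomial_of_growth (hdiff T) <|
      (((PolyGrowth.eval D).pow 2).mul (hWg T)).mono (fun _ => norm_nonneg _) fun x => by
        rw [norm_mul, norm_pow]
        gcongr
        exact hbound T x
  choose E hE using hpoly
  set s := Finset.range (h.natDegree + 1)
  have hinj : Set.InjOn (fun n : ℕ => (n : ℂ)) s := Nat.cast_injective.injOn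
  refine ⟨∑ j ∈ s, C (E j) * (Lagrange.basis s (fun n : ℕ => (n : ℂ)) j).map C, fun x => ?_⟩
  have hdeg : (C (D.eval x ^ 2) * ∏ z ∈ R x, (X - C z)).degree < s.card := by
    have : (R x).card ≤ h.natDegree := by
      refine (Finset.card_filter_le _ _).trans ((Multiset.toFinset_card_le _).trans ?_)
      exact (card_roots' _).trans (hdx x).le
    refine degree_le_natDegree.trans_lt (Nat.cast_lt.2 ?_)
    refine (natDegree_C_mul_le _ _).trans_lt ?_
    rw [natDegree_finsetProd_X_sub_C_eq_card, Finset.card_range]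
    exact Nat.lt_succ_of_le this
  have e3 : ((evalRingHom x).comp C : ℂ →+* ℂ) = RingHom.id ℂ := by ext; simp
  rw [Lagrange.eq_interpolate hinj hdeg, Lagrange.interpolate_apply, Polynomial.map_sum]
  refine Finset.sum_congr rfl fun j _ => ?_
  rw [Polynomial.map_mul, Polynomial.map_map, e3, Polynomial.map_id, map_C]
  congr 2
  simp [hE, eval_prod]

/-- The unbranched part of an irreducible plane curve, monic in the second variable, is
connected. -/
theorem isPreconnected_unbranched {h : ℂ[X][X]} (hm : h.Monic) (hp : Prime h) {D : ℂ[X]}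
    (hsep : ∀ x, D.eval x ≠ 0 → (h.map (evalRingHom x)).Separable) :
    IsPreconnected {q : ℂ × ℂ | D.eval q.1 ≠ 0 ∧ (h.map (evalRingHom q.1)).IsRoot q.2} := by
  classical
  rw [isPreconnected_iff_subset_of_disjoint]
  intro U V hU hV hcov hdis
  have hUV : ∀ x z, D.eval x ≠ 0 → (h.map (evalRingHom x)).IsRoot z →
      (x, z) ∈ U ∨ (x, z) ∈ V := fun x z h1 h2 => hcov ⟨h1, h2⟩
  have hnot : ∀ x z, D.eval x ≠ 0 → (h.map (evalRingHom x)).IsRoot z →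
      (x, z) ∈ U → (x, z) ∉ V := fun x z h1 h2 h3 h4 => by
    have : (x, z) ∈ (∅ : Set (ℂ × ℂ)) := hdis ▸ ⟨⟨h1, h2⟩, h3, h4⟩
    exact this
  obtain ⟨P, hP⟩ := exists_partial_product hm hsep hU hV
    (fun x z h1 h2 => (hUV x z h1 h2).resolve_left) hnot
  obtain ⟨Q, hQ⟩ := exists_partial_product hm hsep hV hU
    (fun x z h1 h2 => (hUV x z h1 h2).resolve_right)
    (fun x z h1 h2 h3 h4 => hnot x z h1 h2 h4 h3)
  have hdvd : P * Q = C (D ^ 4) * h := by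
    ext i : 1
    refine Polynomial.funext fun x => ?_
    have key : (P * Q).map (evalRingHom x) = (C (D ^ 4) * h).map (evalRingHom x) := by
      rw [Polynomial.map_mul, Polynomial.map_mul, hP, hQ, map_C, coe_evalRingHom, eval_pow]
      by_cases hx : D.eval x = 0
      · simp [hx]
      have hn := hsep x hx
      have e : h.map (evalRingHom x) =
          ∏ z ∈ (h.map (evalRingHom x)).roots.toFinset, (X - C z) := by
        have := (IsAlgClosed.splits (h.map (evalRingHom x))).eq_prod_roots
        rw [(hm.map _).leadingCoeff, C_1, one_mul] at this
        rw [Finset.prod_eq_multiset_prod, Multiset.toFinset_val,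
          (nodup_roots hn).dedup]
        exact this
      have hfil : ∀ z ∈ (h.map (evalRingHom x)).roots.toFinset, (x, z) ∈ V ↔ ¬ (x, z) ∈ U :=
        fun z hz => by
        have hz' : (h.map (evalRingHom x)).IsRoot z := by
          simpa [(hm.map (evalRingHom x)).ne_zero] using hz
        exact ⟨fun a b => hnot x z hx hz' b a, (hUV x z hx hz').resolve_left⟩
      rw [Finset.filter_congr hfil]
      conv_rhs => rw [e, ← Finset.prod_filter_mul_prod_filter_not _ (fun z => (x, z) ∈ U)]
      simp only [C_pow]
      ring
    have := congrArg (fun p : ℂ[X] => p.coeff i) key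
    simpa only [coeff_map, coe_evalRingHom] using this
  have aux : ∀ {P : ℂ[X][X]} {U : Set (ℂ × ℂ)}, (∀ x, P.map (evalRingHom x) = C (D.eval x ^ 2) *
      ∏ z ∈ (h.map (evalRingHom x)).roots.toFinset with (x, z) ∈ U, (X - C z)) → h ∣ P →
      {q : ℂ × ℂ | D.eval q.1 ≠ 0 ∧ (h.map (evalRingHom q.1)).IsRoot q.2} ⊆ U := by
    rintro P U hP hd ⟨x, z⟩ ⟨hx, hz⟩
    have h1 : (P.map (evalRingHom x)).IsRoot z :=
      hz.dvd (Polynomial.map_dvd (evalRingHom x) hd)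
    rw [hP, IsRoot.def, eval_mul, eval_C, eval_prod] at h1
    have h2 := (mul_eq_zero.1 h1).resolve_left (pow_ne_zero _ hx)
    obtain ⟨w, hw, hw'⟩ := Finset.prod_eq_zero_iff.1 h2
    rw [eval_sub, eval_X, eval_C, sub_eq_zero] at hw'
    rw [hw']
    exact (Finset.mem_filter.1 hw).2
  rcases hp.dvd_or_dvd (hdvd ▸ dvd_mul_left h _ : h ∣ P * Q) with hd | hd
  · exact Or.inl (aux hP hd)
  · exact Or.inr (aux hQ hd)

end HomSurf

end

section

open Filter Topology Polynomial

namespace HomSurf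

/-- An irreducible monic polynomial over `ℂ[X]` has separable specialisations away from a finite
set. -/
lemma exists_separable_specialization {h : ℂ[X][X]} (hm : h.Monic) (hi : Irreducible h) :
    ∃ D : ℂ[X], D ≠ 0 ∧ ∀ x, D.eval x ≠ 0 → (h.map (evalRingHom x)).Separable := by
  let K := FractionRing ℂ[X]
  have hK : Irreducible (h.map (algebraMap ℂ[X] K)) :=
    (hm.irreducible_iff_irreducible_map_fraction_map (K := K)).1 hi
  have hs : (h.map (algebraMap ℂ[X] K)).Separable := hK.separable
  have hinj : Function.Injective (algebraMap ℂ[X] K) := IsFractionRing.injective _ _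
  have hd : h.natDegree ≠ 0 := fun h0 =>
    hi.not_isUnit (by rw [eq_one_of_monic_natDegree_zero hm h0]; exact isUnit_one)
  refine ⟨resultant h (derivative h), fun h0 => ?_, fun x hx => ?_⟩
  · refine resultant_ne_zero _ _ hs ?_
    rw [derivative_map, natDegree_map_eq_of_injective hinj, natDegree_map_eq_of_injective hinj,
      resultant_map_map, h0, map_zero]
  · obtain ⟨p, q, -, -, e⟩ :=
      exists_mul_add_mul_eq_C_resultant h (derivative h) le_rfl le_rfl (Or.inl hd)
    have e' := congrArg (Polynomial.map (evalRingHom x)) e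
    simp only [Polynomial.map_add, Polynomial.map_mul, map_C, coe_evalRingHom,
      ← derivative_map] at e'
    set c := (resultant h (derivative h)).eval x
    refine ⟨C c⁻¹ * p.map (evalRingHom x), C c⁻¹ * q.map (evalRingHom x), ?_⟩
    have : C c⁻¹ * C c = (1 : ℂ[X]) := by rw [← C_mul, inv_mul_cancel₀ hx, C_1]
    linear_combination C c⁻¹ * e' + this

section Homogeneous

variable {σ : Type*}

lemma degree_of_mem_support {f : MvPolynomial σ ℂ} {n : ℕ} (hf : f.IsHomogeneous n) {m : σ →₀ ℕ}
    (hm : m ∈ f.support) : m.degree = n := by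
  rw [Finsupp.degree_eq_weight_one]
  exact hf (MvPolynomial.mem_support_iff.1 hm)

lemma eval_smul_of_isHomogeneous {f : MvPolynomial σ ℂ} {n : ℕ} (hf : f.IsHomogeneous n)
    (l : ℂ) (v : σ → ℂ) : MvPolynomial.eval (l • v) f = l ^ n * MvPolynomial.eval v f := by
  rw [MvPolynomial.eval_eq, MvPolynomial.eval_eq, Finset.mul_sum]
  refine Finset.sum_congr rfl fun m hm => ?_
  simp only [Pi.smul_apply, smul_eq_mul, mul_pow, Finset.prod_mul_distrib,
    Finset.prod_pow_eq_pow_sum]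
  rw [← degree_of_mem_support hf hm, Finsupp.degree_apply]
  ring

/-- Composition of a polynomial with a linear map. -/
noncomputable def linSubst (L : (Fin 3 → ℂ) →ₗ[ℂ] (Fin 3 → ℂ)) :
    MvPolynomial (Fin 3) ℂ →ₐ[ℂ] MvPolynomial (Fin 3) ℂ :=
  MvPolynomial.aeval fun i => ∑ j, MvPolynomial.C (L (Pi.single j 1) i) * MvPolynomial.X j

lemma eval_linSubst (L : (Fin 3 → ℂ) →ₗ[ℂ] (Fin 3 → ℂ)) (f : MvPolynomial (Fin 3) ℂ)
    (v : Fin 3 → ℂ) : MvPolynomial.eval v (linSubst L f) = MvPolynomial.eval (L v) f := by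
  have : (MvPolynomial.aeval v : _ →ₐ[ℂ] ℂ).comp (linSubst L) = MvPolynomial.aeval (L v) := by
    ext i
    simp only [linSubst, AlgHom.comp_apply, MvPolynomial.aeval_X, map_sum, map_mul,
      MvPolynomial.aeval_C, Algebra.algebraMap_self, RingHom.id_apply]
    conv_rhs => rw [pi_eq_sum_univ' v]
    simp [map_sum, Finset.sum_apply, mul_comm]
  simpa [MvPolynomial.aeval_eq_eval] using DFunLike.congr_fun this f

lemma isHomogeneous_linSubst (L : (Fin 3 → ℂ) →ₗ[ℂ] (Fin 3 → ℂ)) {f : MvPolynomial (Fin 3) ℂ}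
    {n : ℕ} (hf : f.IsHomogeneous n) : (linSubst L f).IsHomogeneous n := by
  have := hf.aeval (n := 1) (fun i => ∑ j, MvPolynomial.C (L (Pi.single j 1) i) *
    (MvPolynomial.X j : MvPolynomial (Fin 3) ℂ)) fun i =>
      MvPolynomial.IsHomogeneous.sum _ _ _ fun j _ =>
        (MvPolynomial.isHomogeneous_X _ j).C_mul _
  rwa [one_mul] at this

lemma irreducible_linSubst (L : (Fin 3 → ℂ) ≃ₗ[ℂ] (Fin 3 → ℂ)) {f : MvPolynomial (Fin 3) ℂ}
    (hf : Irreducible f) : Irreducible (linSubst (L : (Fin 3 → ℂ) →ₗ[ℂ] (Fin 3 → ℂ)) f) := by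
  let Φ : MvPolynomial (Fin 3) ℂ ≃ₐ[ℂ] MvPolynomial (Fin 3) ℂ :=
    AlgEquiv.ofAlgHom (linSubst (L : (Fin 3 → ℂ) →ₗ[ℂ] (Fin 3 → ℂ)))
      (linSubst (L.symm : (Fin 3 → ℂ) →ₗ[ℂ] (Fin 3 → ℂ)))
      (AlgHom.ext fun p => MvPolynomial.funext fun v => by simp [eval_linSubst])
      (AlgHom.ext fun p => MvPolynomial.funext fun v => by simp [eval_linSubst])
  exact (MulEquiv.irreducible_iff Φ).2 hf

end Homogeneous

section Specialize

variable {R : Type*} [CommRing R] [Algebra ℂ R]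

/-- The polynomial `f(a, b, X)`. -/
noncomputable def spec (f : MvPolynomial (Fin 3) ℂ) (a b : R) : R[X] :=
  MvPolynomial.aeval ![C a, C b, X] f

lemma spec_eq_sum (f : MvPolynomial (Fin 3) ℂ) (a b : R) :
    spec f a b = ∑ m ∈ f.support,
      C (algebraMap ℂ R (f.coeff m) * a ^ m 0 * b ^ m 1) * X ^ m 2 := by
  rw [spec, MvPolynomial.aeval_def, MvPolynomial.eval₂_eq']
  refine Finset.sum_congr rfl fun m _ => ?_
  rw [Fin.prod_univ_three]
  simp only [Matrix.cons_val_zero, Matrix.cons_val_one, Matrix.cons_val, C_mul, C_pow,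
    Polynomial.algebraMap_apply]
  ring

lemma natDegree_spec_le {f : MvPolynomial (Fin 3) ℂ} {d : ℕ} (hf : f.IsHomogeneous d) (a b : R) :
    (spec f a b).natDegree ≤ d := by
  rw [spec_eq_sum]
  refine natDegree_sum_le_of_forall_le _ _ fun m hm => (natDegree_C_mul_X_pow_le _ _).trans ?_
  exact (Finsupp.le_degree 2 m).trans (degree_of_mem_support hf hm).le

lemma coeff_spec {f : MvPolynomial (Fin 3) ℂ} {d : ℕ} (hf : f.IsHomogeneous d) (a b : R) :
    (spec f a b).coeff d = algebraMap ℂ R (MvPolynomial.eval ![0, 0, 1] f) := by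
  rw [spec_eq_sum, finsetSum_coeff, MvPolynomial.eval_eq', map_sum]
  refine Finset.sum_congr rfl fun m hm => ?_
  have := degree_of_mem_support hf hm
  rw [Finsupp.degree_eq_sum, Fin.sum_univ_three] at this
  rw [coeff_C_mul, coeff_X_pow, Fin.prod_univ_three]
  by_cases h : d = m 2
  · have h0 : m 0 = 0 := by omega
    have h1 : m 1 = 0 := by omega
    simp [h, h0, h1]
  · have : m 0 ≠ 0 ∨ m 1 ≠ 0 := by omega
    rcases this with h' | h' <;> simp [h, h']

lemma monic_spec {f : MvPolynomial (Fin 3) ℂ} {d : ℕ} (hf : f.IsHomogeneous d)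
    (h1 : MvPolynomial.eval ![0, 0, 1] f = 1) (a b : R) : (spec f a b).Monic :=
  monic_of_natDegree_le_of_coeff_eq_one d (natDegree_spec_le hf a b) (by
    rw [coeff_spec hf, h1, map_one])

lemma natDegree_spec [Nontrivial R] {f : MvPolynomial (Fin 3) ℂ} {d : ℕ} (hf : f.IsHomogeneous d)
    (h1 : MvPolynomial.eval ![0, 0, 1] f = 1) (a b : R) : (spec f a b).natDegree = d :=
  le_antisymm (natDegree_spec_le hf a b) (le_natDegree_of_ne_zero (by
    rw [coeff_spec hf, h1, map_one]; exact one_ne_zero))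

lemma eval_spec (f : MvPolynomial (Fin 3) ℂ) (x y z : ℂ) :
    (spec f x y).eval z = MvPolynomial.eval ![x, y, z] f := by
  rw [spec_eq_sum, MvPolynomial.eval_eq', eval_finsetSum]
  refine Finset.sum_congr rfl fun m _ => ?_
  rw [Fin.prod_univ_three]
  simp [mul_assoc]

lemma map_spec (f : MvPolynomial (Fin 3) ℂ) (x : ℂ) :
    (spec f (X : ℂ[X]) 1).map (evalRingHom x) = spec f x 1 := by
  rw [spec_eq_sum, spec_eq_sum, Polynomial.map_sum]
  simp

lemma continuous_coeff_spec (f : MvPolynomial (Fin 3) ℂ) (k : ℕ) :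
    Continuous fun q : ℂ × ℂ => (spec f q.1 q.2).coeff k := by
  simp only [spec_eq_sum, finsetSum_coeff, coeff_C_mul]
  fun_prop

end Specialize

/-- Dehomogenisation of a polynomial in three variables. -/
noncomputable def dehom : MvPolynomial (Fin 3) ℂ →ₐ[ℂ] ℂ[X][X] :=
  MvPolynomial.aeval ![C X, 1, X]

lemma dehom_eq_spec (f : MvPolynomial (Fin 3) ℂ) : dehom f = spec f (X : ℂ[X]) 1 := by
  rw [dehom, spec, C_1]

lemma exists_homogenization (P : ℂ[X][X]) :
    ∃ (p : MvPolynomial (Fin 3) ℂ) (n : ℕ), p.IsHomogeneous n ∧ dehom p = P := by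
  obtain ⟨p, rfl⟩ : ∃ p, dehom p = P := by
    induction P using Polynomial.induction_on' with
    | add P Q hP hQ =>
      obtain ⟨p, rfl⟩ := hP
      obtain ⟨q, rfl⟩ := hQ
      exact ⟨p + q, map_add _ _ _⟩
    | monomial n a =>
      refine ⟨Polynomial.aeval (MvPolynomial.X 0) a * MvPolynomial.X 2 ^ n, ?_⟩
      rw [map_mul, map_pow, ← Polynomial.aeval_algHom_apply]
      simp only [dehom, MvPolynomial.aeval_X, Matrix.cons_val_zero, Matrix.cons_val]
      rw [← C_mul_X_pow_eq_monomial]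
      congr 1
      have : Polynomial.aeval (C X : ℂ[X][X]) =
          (CAlgHom : ℂ[X] →ₐ[ℂ[X]] ℂ[X][X]).restrictScalars ℂ := by ext; simp
      rw [this]; rfl
  set N := p.totalDegree
  refine ⟨∑ i ∈ Finset.range (N + 1), MvPolynomial.X 1 ^ (N - i) *
    MvPolynomial.homogeneousComponent i p, N, ?_, ?_⟩
  · refine MvPolynomial.IsHomogeneous.sum _ _ _ fun i hi => ?_
    have := (MvPolynomial.isHomogeneous_X_pow (R := ℂ) (1 : Fin 3) (N - i)).mul
      (MvPolynomial.homogeneousComponent_isHomogeneous i p)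
    rwa [Nat.sub_add_cancel (by simpa [Nat.lt_succ_iff] using hi)] at this
  · conv_rhs => rw [← MvPolynomial.sum_homogeneousComponent p]
    simp only [map_sum, map_mul, map_pow]
    refine Finset.sum_congr rfl fun i _ => ?_
    simp [dehom]

lemma eq_zero_of_dehom_eq_zero {p : MvPolynomial (Fin 3) ℂ} {n : ℕ} (hp : p.IsHomogeneous n)
    (h : dehom p = 0) : p = 0 := by
  have h1 : ∀ x z, MvPolynomial.eval ![x, 1, z] p = 0 := fun x z => by
    rw [← eval_spec, ← map_spec, ← dehom_eq_spec, h]; simp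
  have h2 : MvPolynomial.X 1 * p = 0 := MvPolynomial.funext fun v => by
    by_cases hv : v 1 = 0
    · simp [hv]
    · have : v = v 1 • ![v 0 / v 1, 1, v 2 / v 1] := by
        ext i; fin_cases i <;> simp <;> field_simp
      rw [this, map_mul, eval_smul_of_isHomogeneous hp, h1]; simp
  exact (mul_eq_zero.1 h2).resolve_left (MvPolynomial.X_ne_zero _)

/-- The dehomogenisation of an irreducible homogeneous polynomial which does not vanish at
`(0, 0, 1)` is prime. -/
lemma prime_dehom {f : MvPolynomial (Fin 3) ℂ} {d : ℕ} (hf : f.IsHomogeneous d)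
    (hirr : Irreducible f) (hd : 0 < d) (h1 : MvPolynomial.eval ![0, 0, 1] f = 1) :
    Prime (dehom f) := by
  have hm : (dehom f).Monic := by rw [dehom_eq_spec]; exact monic_spec hf h1 _ _
  have hdeg : (dehom f).natDegree = d := by rw [dehom_eq_spec]; exact natDegree_spec hf h1 _ _
  have hunit : ¬ IsUnit (dehom f) := fun hu => by
    rw [hm.isUnit_iff] at hu
    rw [hu, natDegree_one] at hdeg
    omega
  refine ⟨hm.ne_zero, hunit, fun P Q ⟨S, hS⟩ => ?_⟩
  obtain ⟨p, n, hp, rfl⟩ := exists_homogenization P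
  obtain ⟨q, m, hq, rfl⟩ := exists_homogenization Q
  obtain ⟨s, k, hs, rfl⟩ := exists_homogenization S
  have hX : dehom (MvPolynomial.X 1) = 1 := by simp [dehom]
  have key : MvPolynomial.X 1 ^ (d + k) * (p * q) - MvPolynomial.X 1 ^ (n + m) * (f * s) = 0 := by
    refine eq_zero_of_dehom_eq_zero (n := d + k + (n + m)) ?_ ?_
    · refine ((MvPolynomial.isHomogeneous_X_pow _ _).mul (hp.mul hq)).sub ?_
      rw [add_comm (d + k)]
      exact (MvPolynomial.isHomogeneous_X_pow _ _).mul (hf.mul hs)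
    · simp [hX, hS]
  have hprime : Prime f := hirr.prime
  have hdvd : f ∣ MvPolynomial.X 1 ^ (d + k) * (p * q) := by
    rw [sub_eq_zero.1 key]
    exact ((dvd_mul_right f s)).mul_left _
  rcases hprime.dvd_or_dvd hdvd with h | h
  · have := map_dvd dehom h
    rw [map_pow, hX, one_pow] at this
    exact absurd (isUnit_of_dvd_one this) hunit
  · exact (hprime.dvd_or_dvd h).imp (map_dvd dehom) (map_dvd dehom)

end HomSurf

end

section

open Filter Topology Polynomial

namespace HomSurf

/-- A normalised irreducible form defines a sheeted family. -/
lemma exists_sheeted_of_separable {f : MvPolynomial (Fin 3) ℂ} {d : ℕ} (hf : f.IsHomogeneous d)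
    (hirr : Irreducible f) (hd : 0 < d) (h1 : MvPolynomial.eval ![0, 0, 1] f = 1)
    (hsep : (spec f (1 : ℂ) 0).Separable) : ∃ S : Sheeted d, S.F = fun x y => spec f x y := by
  have hp := prime_dehom hf hirr hd h1
  have hm : (dehom f).Monic := by rw [dehom_eq_spec]; exact monic_spec hf h1 _ _
  have hmap : ∀ x, (dehom f).map (evalRingHom x) = spec f x 1 := fun x => by
    rw [dehom_eq_spec, map_spec]
  obtain ⟨D, hD0, hD⟩ := exists_separable_specialization hm hp.irreducible
  have hconn := isPreconnected_unbranched hm hp hD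
  simp only [hmap] at hD hconn
  have hB : ∀ x, x ∉ D.roots.toFinset ↔ D.eval x ≠ 0 := fun x => by simp [hD0]
  have hc : ∀ k, Continuous fun t : ℂ => (spec f (1 : ℂ) t).coeff k := fun k =>
    (continuous_coeff_spec f k).comp (g := fun q : ℂ × ℂ => (spec f q.1 q.2).coeff k)
      (f := fun t : ℂ => ((1 : ℂ), t)) (by fun_prop)
  have hm1 : ∀ t : ℂ, (spec f (1 : ℂ) t).Monic := fun t => monic_spec hf h1 _ _
  have hd1 : ∀ t : ℂ, (spec f (1 : ℂ) t).natDegree = d := fun t => natDegree_spec hf h1 _ _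
  obtain ⟨V, hVo, h0V, ρ, hρ, hρc, hρi⟩ := exists_local_splitting hm1 hd1 hc 0 hsep
  obtain ⟨ε, hε, hεV⟩ := Metric.isOpen_iff.1 hVo 0 h0V
  let M := ∑ b ∈ D.roots.toFinset, ‖b‖
  have hM : 0 ≤ M := Finset.sum_nonneg fun _ _ => norm_nonneg _
  have hsub : Metric.ball (0 : ℂ) (min ε (1 / (M + 1))) ⊆ V :=
    (Metric.ball_subset_ball (min_le_left _ _)).trans hεV
  exact ⟨{
    F := fun x y => spec f x y
    monic := fun x y => monic_spec hf h1 x y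
    natDegree_eq := fun x y => natDegree_spec hf h1 x y
    continuous_coeff := continuous_coeff_spec f
    homog := fun {l x y z} _ hz => by
      have e : ![l * x, l * y, l * z] = l • ![x, y, z] := by
        ext i; fin_cases i <;> simp
      rw [IsRoot.def, eval_spec] at hz ⊢
      rw [e, eval_smul_of_isHomogeneous hf, hz, mul_zero]
    pos := hd
    B := D.roots.toFinset
    separable := fun x hx => hD x ((hB x).1 hx)
    preconnected := by simpa only [hB] using hconn
    δ := min ε (1 / (M + 1))
    δ_pos := lt_min hε (by positivity)
    δ_B := fun b hb => by
      have hb' : ‖b‖ ≤ M := Finset.single_le_sum (f := fun b => ‖b‖)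
        (fun _ _ => norm_nonneg _) hb
      calc ‖b‖ * min ε (1 / (M + 1)) ≤ M * (1 / (M + 1)) := by
            gcongr
            exact min_le_right _ _
        _ < 1 := by rw [mul_one_div, div_lt_one (by linarith)]; linarith
    ζ := fun i t => ρ t i
    ζ_cont := fun i => (continuousOn_pi.1 hρc i).mono hsub
    ζ_eq := fun t _ => hρ t
    ζ_inj := fun t ht => hρi t (hsub ht) }, rfl⟩

/-- The linear change of coordinates `(x, y, z) ↦ (c x + y, x, z)`. -/
noncomputable def shear (c : ℂ) : (Fin 3 → ℂ) ≃ₗ[ℂ] (Fin 3 → ℂ) :=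
  LinearEquiv.ofLinearMap
    { toFun := fun v => ![c * v 0 + v 1, v 0, v 2]
      map_add' := fun v w => by ext i; fin_cases i <;> simp <;> ring
      map_smul' := fun a v => by ext i; fin_cases i <;> (simp; try ring) }
    { toFun := fun v => ![v 1, v 0 - c * v 1, v 2]
      map_add' := fun v w => by ext i; fin_cases i <;> simp <;> ring
      map_smul' := fun a v => by ext i; fin_cases i <;> (simp; try ring) }
    (LinearMap.ext fun v => by ext i; fin_cases i <;> simp)
    (LinearMap.ext fun v => by ext i; fin_cases i <;> simp)

lemma shear_apply (c : ℂ) (v : Fin 3 → ℂ) : shear c v = ![c * v 0 + v 1, v 0, v 2] := rfl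

lemma exists_linear_change {f : MvPolynomial (Fin 3) ℂ} {d : ℕ} (hf : f.IsHomogeneous d)
    (hirr : Irreducible f) (L : (Fin 3 → ℂ) ≃ₗ[ℂ] (Fin 3 → ℂ)) {c : ℂ} (hc : c ≠ 0) :
    ∃ g : MvPolynomial (Fin 3) ℂ, g.IsHomogeneous d ∧ Irreducible g ∧
      ∀ v, MvPolynomial.eval v g = c * MvPolynomial.eval (L v) f := by
  have hu : IsUnit (MvPolynomial.C c : MvPolynomial (Fin 3) ℂ) :=
    (IsUnit.mk0 _ hc).map MvPolynomial.C
  refine ⟨linSubst (L : (Fin 3 → ℂ) →ₗ[ℂ] (Fin 3 → ℂ)) (MvPolynomial.C c * f),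
    isHomogeneous_linSubst _ (hf.C_mul _),
    irreducible_linSubst _ ((irreducible_isUnit_mul hu).2 hirr), fun v => ?_⟩
  rw [eval_linSubst, map_mul, MvPolynomial.eval_C]
  rfl

/-- In suitable linear coordinates an irreducible form defines a sheeted family. -/
lemma exists_sheeted {f : MvPolynomial (Fin 3) ℂ} {d : ℕ} (hf : f.IsHomogeneous d)
    (hirr : Irreducible f) (hd : 0 < d) :
    ∃ (S : Sheeted d) (L : (Fin 3 → ℂ) ≃ₗ[ℂ] (Fin 3 → ℂ)),
      (∀ x y z, (S.F x y).IsRoot z ↔ MvPolynomial.eval (L ![x, y, z]) f = 0) ∧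
      ∀ z, (S.F 0 0).IsRoot z → z = 0 := by
  obtain ⟨v, hv⟩ : ∃ v, MvPolynomial.eval v f ≠ 0 := by
    by_contra! h
    exact hirr.ne_zero (MvPolynomial.funext fun v => by simpa using h v)
  have hv0 : v ≠ 0 := by
    rintro rfl
    have := eval_smul_of_isHomogeneous hf 0 (0 : Fin 3 → ℂ)
    rw [smul_zero, zero_pow hd.ne', zero_mul] at this
    exact hv this
  obtain ⟨A, hA⟩ := SeparatingDual.exists_continuousLinearEquiv_apply_eq (R := ℂ)
    (x := (![0, 0, 1] : Fin 3 → ℂ)) (y := v) (fun h => by simpa using congrFun h 2) hv0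
  obtain ⟨f₁, hf₁, hirr₁, he₁⟩ := exists_linear_change hf hirr A.toLinearEquiv (inv_ne_zero hv)
  have h₁ : MvPolynomial.eval ![0, 0, 1] f₁ = 1 := by
    rw [he₁]
    exact (congrArg (fun w => _ * MvPolynomial.eval w f) hA).trans (inv_mul_cancel₀ hv)
  have hm : (dehom f₁).Monic := by rw [dehom_eq_spec]; exact monic_spec hf₁ h₁ _ _
  obtain ⟨D, hD0, hD⟩ := exists_separable_specialization hm
    (prime_dehom hf₁ hirr₁ hd h₁).irreducible
  obtain ⟨a, ha⟩ : ∃ a, D.eval a ≠ 0 := by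
    by_contra! h
    exact hD0 (Polynomial.funext fun x => by simpa using h x)
  have hsa := hD a ha
  rw [dehom_eq_spec, map_spec] at hsa
  obtain ⟨f₂, hf₂, hirr₂, he₂⟩ := exists_linear_change hf₁ hirr₁ (shear a) one_ne_zero
  have h₂ : MvPolynomial.eval ![0, 0, 1] f₂ = 1 := by
    rw [he₂, shear_apply]; simpa using h₁
  have hs₂ : spec f₂ (1 : ℂ) 0 = spec f₁ a 1 := Polynomial.funext fun z => by
    rw [eval_spec, eval_spec, he₂, shear_apply]; simp
  obtain ⟨S, hS⟩ := exists_sheeted_of_separable hf₂ hirr₂ hd h₂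
    (hs₂ ▸ hsa)
  refine ⟨S, (shear a).trans A.toLinearEquiv, fun x y z => ?_, fun z hz => ?_⟩
  · rw [hS, IsRoot.def, eval_spec, he₂, he₁]
    simp [hv]
  · rw [hS, IsRoot.def, eval_spec] at hz
    have e : ![0, 0, z] = z • (![0, 0, 1] : Fin 3 → ℂ) := by ext i; fin_cases i <;> simp
    rw [e, eval_smul_of_isHomogeneous hf₂, h₂, mul_one] at hz
    exact eq_zero_of_pow_eq_zero hz

/-- Triples of complex numbers as vectors. -/
noncomputable def tripleEquiv : (ℂ × ℂ × ℂ) ≃ₜ (Fin 3 → ℂ) where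
  toFun p := ![p.1, p.2.1, p.2.2]
  invFun v := (v 0, v 1, v 2)
  left_inv _ := rfl
  right_inv v := by ext i; fin_cases i <;> rfl
  continuous_toFun := by
    refine continuous_pi fun i => ?_
    fin_cases i
    · exact continuous_fst
    · exact continuous_fst.comp continuous_snd
    · exact continuous_snd.comp continuous_snd
  continuous_invFun := by fun_prop

/-- The punctured zero set of an irreducible form is the cone of a sheeted family. -/
lemma exists_sheeted_cone_homeomorph {f : MvPolynomial (Fin 3) ℂ} {d : ℕ}
    (hf : f.IsHomogeneous d) (hirr : Irreducible f) (hd : 0 < d) :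
    ∃ S : Sheeted d, Nonempty (S.cone ≃ₜ
      ({x | MvPolynomial.eval (x : Fin 3 → ℂ) f = 0} \ {0} : Set (EuclideanSpace ℂ (Fin 3)))) := by
  obtain ⟨S, L, hL, h0⟩ := exists_sheeted hf hirr hd
  let Ψ : (ℂ × ℂ × ℂ) ≃ₜ EuclideanSpace ℂ (Fin 3) :=
    (tripleEquiv.trans L.toContinuousLinearEquiv.toHomeomorph).trans
      (EuclideanSpace.equiv (Fin 3) ℂ).symm.toHomeomorph
  have hΨ : ∀ p : ℂ × ℂ × ℂ, Ψ p = (EuclideanSpace.equiv (Fin 3) ℂ).symm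
      (L ![p.1, p.2.1, p.2.2]) := fun p => rfl
  refine ⟨S, ⟨Ψ.subtype fun p => ?_⟩⟩
  change ((p.1 ≠ 0 ∨ p.2.1 ≠ 0) ∧ (S.F p.1 p.2.1).IsRoot p.2.2) ↔
    MvPolynomial.eval (Ψ p : Fin 3 → ℂ) f = 0 ∧ Ψ p ≠ 0
  have hz : Ψ p = 0 ↔ p.1 = 0 ∧ p.2.1 = 0 ∧ p.2.2 = 0 := by
    rw [hΨ, map_eq_zero_iff _ (EuclideanSpace.equiv (Fin 3) ℂ).symm.injective,
      map_eq_zero_iff _ L.injective]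
    constructor
    · intro h
      exact ⟨congrFun h 0, congrFun h 1, congrFun h 2⟩
    · rintro ⟨h1, h2, h3⟩
      ext i; fin_cases i <;> simp [h1, h2, h3]
  rw [hL, and_comm, ne_eq (Ψ p), hz]
  refine and_congr_right fun he => ?_
  constructor
  · rintro h ⟨h1, h2, -⟩
    exact h.elim (· h1) (· h2)
  · intro h
    by_contra! h'
    refine h ⟨h'.1, h'.2, h0 _ ?_⟩
    rwa [← hL, h'.1, h'.2] at he

end HomSurf

end

/-- the abstract topology of a homogeneous surface germ determines its
multiplicity: if `S = V(f)` and `S' = V(g)` are homogeneous irreducible affine algebraic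
surfaces in `ℂ³` and `S \ {0}` is homeomorphic to `S' \ {0}`, then `deg f = deg g`. -/
theorem degree_homogeneous_surfaces_topological_invariant
    (f g : MvPolynomial (Fin 3) ℂ) (d e : ℕ)
    (hfirr : Irreducible f) (hgirr : Irreducible g)
    (hfhom : f.IsHomogeneous d) (hghom : g.IsHomogeneous e)
    (hd : 0 < d) (he : 0 < e)
    (htop : Nonempty (((mvZeroSet f \ {0} : Set (EuclideanSpace ℂ (Fin 3)))) ≃ₜ
      ((mvZeroSet g \ {0} : Set (EuclideanSpace ℂ (Fin 3)))))) :
    f.totalDegree = g.totalDegree := by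
  obtain ⟨φ⟩ := htop
  obtain ⟨S, ⟨α⟩⟩ := HomSurf.exists_sheeted_cone_homeomorph hfhom hfirr hd
  obtain ⟨S', ⟨β⟩⟩ := HomSurf.exists_sheeted_cone_homeomorph hghom hgirr he
  rw [hfhom.totalDegree hfirr.ne_zero, hghom.totalDegree hgirr.ne_zero]
  let ψ : S.cone ≃ₜ S'.cone := (α.trans φ).trans β.symm
  exact le_antisymm (S.degree_le S' ψ) (S'.degree_le S ψ.symm)
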